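/- Fix ζ > 2/5 and r > 2/3 such that M̂(r) ≠ 0. Then there exist ε₀ > 0 and functions D̂, μ̂ : (0, ε₀) → ℝ with D̂(ε) → D_0(r, u_b(r)) and μ̂(ε) → μ_0(r, u_b(r)) as ε → 0⁺, such that for every ε ∈ (0, ε₀), taking D = D̂(ε), μ = μ̂(ε) and s = −ζ − μ, the traveling-wave system admits a solution (q,p,u) : ℝ → ℝ³ with (q,p,u)(ξ) → X₁ = (0,0,2) as ξ → −∞ and (q,p,u)(ξ) → X₂(r) = (q_{b,+}(r,u_b(r)), 0, u_b(r)) as ξ → +∞ (a simple heteroclinic front), and also a solution with (q,p,u)(ξ) → X₂(r) as ξ → −∞ and (q,p,u)(ξ) → X₁ as ξ → +∞ (a simple heteroclinic back). Together these form a heteroclinic loop connecting the laminar and turbulent equilibria. -/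

import Mathlib

open Filter Topology MeasureTheory

noncomputable section

/-- The Nagumo front profile `φ(χ) = 1/(1 + exp(−χ/√2))`. -/
def phi (χ : ℝ) : ℝ := 1 / (1 + Real.exp (-χ / Real.sqrt 2))

/-- The cubic `K(u;r)`. -/
def Kc (u r : ℝ) : ℝ := 40*u^3 - (50*r + 169)*u^2 + (160*r + 224)*u - 120*r - 96

/-- `q_{f,+}(r) = 1 + √(r/(r + 1/10))`. -/
def qfp (r : ℝ) : ℝ := 1 + Real.sqrt (r / (r + 1/10))

/-- `q_{f,−}(r) = 1 − √(r/(r + 1/10))`. -/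
def qfm (r : ℝ) : ℝ := 1 - Real.sqrt (r / (r + 1/10))

/-- `q_{b,+}(r,u) = 1 + √((r + u − 2)/(r + 1/10))`. -/
def qbp (r u : ℝ) : ℝ := 1 + Real.sqrt ((r + u - 2) / (r + 1/10))

/-- `q_{b,−}(r,u) = 1 − √((r + u − 2)/(r + 1/10))`. -/
def qbm (r u : ℝ) : ℝ := 1 - Real.sqrt ((r + u - 2) / (r + 1/10))

/-- The singular wave-speed parameter `μ_0(r,u)`. -/
def mu0 (r u : ℝ) : ℝ :=
  (2*(2*qbm r u - qbp r u) + u*(2*qfm r - qfp r)) /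
    (qbp r u - 2*qbm r u + qfp r - 2*qfm r)

/-- The singular diffusion coefficient `D_0(r,u)`. -/
def D0 (r u : ℝ) : ℝ :=
  2*(2 - u)^2 / ((r + 1/10) * (2*qbm r u - qbp r u + 2*qfm r - qfp r)^2)

/-- Exponential rate along the front: `a_f = √2(1/2 − q_{f−}/q_{f+})`. -/
def af (r : ℝ) : ℝ := Real.sqrt 2 * (1/2 - qfm r / qfp r)

/-- Exponential rate along the back: `a_b = √2(1/2 − q_{b−}/q_{b+})`. -/
def ab (r u : ℝ) : ℝ := Real.sqrt 2 * (1/2 - qbm r u / qbp r u)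

/-- The basic Melnikov integral `∫ e^{−aχ} φ′(χ)² dχ`. -/
def Jsq (a : ℝ) : ℝ := ∫ χ : ℝ, Real.exp (-a * χ) * (deriv phi χ)^2

/-- The basic Melnikov integral `∫ e^{−aχ} φ′(χ) φ(χ)ⁿ dχ`. -/
def Jn (a : ℝ) (n : ℕ) : ℝ := ∫ χ : ℝ, Real.exp (-a * χ) * (deriv phi χ * (phi χ)^n)

/-- The Melnikov quantity `M_f(r)` (for `∂_D Q_f`). -/
def Mf (r : ℝ) : ℝ :=
  (qfp r / 2) * Real.sqrt 2 * (qfp r - 2 * qfm r) * Jsq (af r)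
    + (1 / (10 * (r + 1/10))) * Jn (af r) 1
    - 2 * qfp r * Jn (af r) 2
    + (qfp r)^2 * Jn (af r) 3

/-- The Melnikov quantity `M_b(r)` (for `∂_D Q_b`), with `u = u_b(r)`. -/
def Mb (r u : ℝ) : ℝ :=
  -(qbp r u / 2) * Real.sqrt 2 * (qbp r u - 2 * qbm r u) * Jsq (ab r u)
    + ((u - 21/10) / (r + 1/10)) * Jn (ab r u) 1
    + 2 * qbp r u * Jn (ab r u) 2
    - (qbp r u)^2 * Jn (ab r u) 3

/-- The Melnikov quantity `M̂_f(r)` (for `∂_μ Q_f`), with `u = u_b(r)`. -/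
def Mhf (r u : ℝ) : ℝ :=
  -(qfp r * D0 r u * Real.sqrt 2 * (qfp r - 2 * qfm r) / (2 * (mu0 r u + 2))) * Jsq (af r)

/-- The Melnikov quantity `M̂_b(r)` (for `∂_μ Q_b`), with `u = u_b(r)`. -/
def Mhb (r u : ℝ) : ℝ :=
  -(qbp r u * Real.sqrt 2 * (qbp r u - 2 * qbm r u) / (2 * (mu0 r u + u))) * Jsq (ab r u)

/-- The Melnikov quantity `M̃_f(r)` (for `∂_u 𝒬_f`), with `u = u_b(r)`. -/
def Mtf (r u : ℝ) : ℝ :=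
  -(qfp r) * Real.sqrt ((r + 1/10) / D0 r u) * Jsq (af r) + Jn (af r) 1

/-- The nondegeneracy quantity `M̂(r) = M_b/M̂_b − M_f/M̂_f`, with `u = u_b(r)`. -/
def Mhat (r u : ℝ) : ℝ := Mb r u / Mhb r u - Mf r / Mhf r u

/-- Reaction term `f(q,u;r)` of the pipe-flow model. -/
def fq (q u r : ℝ) : ℝ := q * (r + u - 2 - (r + 1/10) * (q - 1)^2)

/-- Reaction term `g(q,u)` of the pipe-flow model. -/
def gq (q u : ℝ) : ℝ := 2 - u + 2*q*(1 - u)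

/-- `(Q,P,U)` is a solution of the traveling-wave system
`q_ξ = p`, `p_ξ = D⁻¹((u + μ)p − f(q,u;r))`, `u_ξ = ε g(q,u)/(u − s)`. -/
def IsTWSol (D μ s ε r : ℝ) (Q P U : ℝ → ℝ) : Prop :=
  (∀ ξ : ℝ, U ξ ≠ s) ∧
  (∀ ξ : ℝ, HasDerivAt Q (P ξ) ξ) ∧
  (∀ ξ : ℝ, HasDerivAt P ((1/D) * ((U ξ + μ) * P ξ - fq (Q ξ) (U ξ) r)) ξ) ∧
  (∀ ξ : ℝ, HasDerivAt U (ε * gq (Q ξ) (U ξ) / (U ξ - s)) ξ)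

theorem barrier_pos {n : ℕ} (b : Fin n → ℝ → ℝ) {s T : ℝ}
    (hc : ∀ i, ContinuousOn (b i) (Set.Icc s T)) (h0 : ∀ i, 0 < b i s)
    (hb : ∀ t ∈ Set.Ioc s T, (∀ j, 0 ≤ b j t) → ∀ i, b i t = 0 →
      ∃ d > 0, HasDerivAt (b i) d t) :
    ∀ t ∈ Set.Icc s T, ∀ i, 0 < b i t := by
  by_contra! hcon
  obtain ⟨t₁, ht₁, i₁, hi₁⟩ := hcon
  set S : Set ℝ := ⋃ i, {t ∈ Set.Icc s T | b i t ≤ 0} with hS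
  have hclosed : IsClosed S := by
    refine isClosed_iUnion_of_finite fun i => ?_
    exact (hc i).preimage_isClosed_of_isClosed isClosed_Icc isClosed_Iic
  have hne : S.Nonempty := ⟨t₁, Set.mem_iUnion.2 ⟨i₁, ht₁, hi₁⟩⟩
  have hbdd : BddBelow S := ⟨s, fun t ht => by
    obtain ⟨i, hi⟩ := Set.mem_iUnion.1 ht
    exact hi.1.1⟩
  have hmem := hclosed.csInf_mem hne hbdd
  set t₀ := sInf S
  obtain ⟨i, hi, hi0⟩ := Set.mem_iUnion.1 hmem
  have hst : s < t₀ := lt_of_le_of_ne hi.1 fun h => by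
    rw [← h] at hi0; exact absurd (h0 i) (not_lt.2 hi0)
  have hbefore : ∀ t ∈ Set.Ico s t₀, ∀ j, 0 < b j t := fun t ht j => by
    by_contra! hj
    exact absurd (csInf_le hbdd (Set.mem_iUnion.2 ⟨j, ⟨ht.1, ht.2.le.trans hi.2⟩, hj⟩))
      (not_le.2 ht.2)
  have hnonneg : ∀ j, 0 ≤ b j t₀ := fun j => by
    have hcw : Tendsto (b j) (𝓝[Set.Ico s t₀] t₀) (𝓝 (b j t₀)) :=
      ((hc j) t₀ hi).mono_left (nhdsWithin_mono _ fun x hx => ⟨hx.1, hx.2.le.trans hi.2⟩)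
    have : (𝓝[Set.Ico s t₀] t₀).NeBot := by
      rw [← mem_closure_iff_nhdsWithin_neBot, closure_Ico hst.ne]
      exact Set.right_mem_Icc.2 hst.le
    exact ge_of_tendsto hcw (eventually_nhdsWithin_of_forall fun t ht => (hbefore t ht j).le)
  have hi00 : b i t₀ = 0 := le_antisymm hi0 (hnonneg i)
  obtain ⟨d, hd, hder⟩ := hb t₀ ⟨hst, hi.2⟩ hnonneg i hi00
  have hslope := hder.tendsto_slope_zero_left
  have hev : ∀ᶠ h in 𝓝[<] (0:ℝ), 0 < h⁻¹ • (b i (t₀ + h) - b i t₀) :=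
    hslope.eventually (lt_mem_nhds hd)
  have hev2 : ∀ᶠ h in 𝓝[<] (0:ℝ), s - t₀ < h :=
    nhdsWithin_le_nhds (lt_mem_nhds (by linarith))
  obtain ⟨h, ⟨h1, h2⟩, h3⟩ := ((hev.and hev2).and self_mem_nhdsWithin).exists
  have h3 : h < 0 := h3
  have := hbefore (t₀ + h) ⟨by linarith, by linarith⟩ i
  rw [hi00, sub_zero, smul_eq_mul] at h1
  have : h⁻¹ < 0 := inv_lt_zero.2 h3
  nlinarith

theorem exists_first_eq {f : ℝ → ℝ} {c s t : ℝ} (hst : s ≤ t) (hf : ContinuousOn f (Set.Icc s t))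
    (h0 : f s < c) (ht : c ≤ f t) :
    ∃ t₁ ∈ Set.Ioc s t, f t₁ = c ∧ ∀ u ∈ Set.Icc s t₁, f u ≤ c := by
  set S : Set ℝ := {u ∈ Set.Icc s t | c ≤ f u}
  have hclosed : IsClosed S := hf.preimage_isClosed_of_isClosed isClosed_Icc isClosed_Ici
  have hne : S.Nonempty := ⟨t, ⟨hst, le_rfl⟩, ht⟩
  have hbdd : BddBelow S := ⟨s, fun u hu => hu.1.1⟩
  obtain ⟨h1, h2⟩ := hclosed.csInf_mem hne hbdd
  set t₀ := sInf S
  have hbefore : ∀ u ∈ Set.Ico s t₀, f u < c := fun u hu => by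
    by_contra! hj
    exact absurd (csInf_le hbdd ⟨⟨hu.1, hu.2.le.trans h1.2⟩, hj⟩) (not_le.2 hu.2)
  have hs : s < t₀ := lt_of_le_of_ne h1.1 fun h => by rw [← h] at h2; linarith
  have hle : f t₀ ≤ c := by
    have hcw : Tendsto f (𝓝[Set.Ico s t₀] t₀) (𝓝 (f t₀)) :=
      (hf t₀ h1).mono_left (nhdsWithin_mono _ fun x hx => ⟨hx.1, hx.2.le.trans h1.2⟩)
    have : (𝓝[Set.Ico s t₀] t₀).NeBot := by
      rw [← mem_closure_iff_nhdsWithin_neBot, closure_Ico hs.ne]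
      exact Set.right_mem_Icc.2 hs.le
    exact le_of_tendsto hcw (eventually_nhdsWithin_of_forall fun t ht => (hbefore t ht).le)
  refine ⟨t₀, ⟨hs, h1.2⟩, le_antisymm hle h2, fun u hu => ?_⟩
  rcases hu.2.lt_or_eq with h | h
  · exact (hbefore u ⟨hu.1, h⟩).le
  · rw [h]; exact hle

theorem growth_of_hasDerivAt {V : ℝ → ℝ} {κ s T : ℝ} (hsT : s ≤ T)
    (hV : ∀ t ∈ Set.Icc s T, ∃ d ≥ κ, HasDerivAt V d t) : V s + κ * (T - s) ≤ V T := by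
  have hdiff : ∀ t ∈ Set.Icc s T, DifferentiableAt ℝ V t := fun t ht =>
    (hV t ht).choose_spec.2.differentiableAt
  have := (convex_Icc s T).mul_sub_le_image_sub_of_le_deriv (f := V) (C := κ)
    (fun t ht => (hdiff t ht).continuousAt.continuousWithinAt)
    (fun t ht => (hdiff t (interior_subset ht)).differentiableWithinAt)
    (fun t ht => by
      obtain ⟨d, hd, hd'⟩ := hV t (interior_subset ht)
      rw [hd'.deriv]; exact hd) s ⟨le_rfl, hsT⟩ T ⟨hsT, le_rfl⟩ hsT
  linarith

/-- A trajectory that gains at least `κ` per unit time of a bounded quantity, as long as it has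
not left through the level `f = c`, reaches that level. -/
theorem reach_level {f V : ℝ → ℝ} {c κ B s : ℝ} {P : ℝ → Prop} (hf : Continuous f) (hκ : 0 < κ)
    (h0 : f s < c)
    (hP : ∀ T, s ≤ T → (∀ t ∈ Set.Icc s T, f t ≤ c) → ∀ t ∈ Set.Icc s T, P t)
    (hV : ∀ t, s ≤ t → P t → f t ≤ c → ∃ d ≥ κ, HasDerivAt V d t)
    (hB : ∀ t, s ≤ t → P t → f t ≤ c → V t ≤ B) :
    ∃ t₁ > s, f t₁ = c ∧ ∀ t ∈ Set.Icc s t₁, f t ≤ c ∧ P t := by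
  by_cases hex : ∃ t ≥ s, c ≤ f t
  · obtain ⟨t, hst, ht⟩ := hex
    obtain ⟨t₁, h1, h2, h3⟩ := exists_first_eq hst hf.continuousOn h0 ht
    exact ⟨t₁, h1.1, h2, fun t ht => ⟨h3 t ht, hP t₁ h1.1.le h3 t ht⟩⟩
  · push Not at hex
    exfalso
    have hall : ∀ t, s ≤ t → P t := fun t ht =>
      hP t ht (fun u hu => (hex u hu.1).le) t ⟨ht, le_rfl⟩
    set T := s + (|B - V s| + 1) / κ
    have hT : s ≤ T := by
      have : 0 ≤ (|B - V s| + 1) / κ := by positivity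
      linarith
    have h1 := growth_of_hasDerivAt hT fun t ht => hV t ht.1 (hall t ht.1) (hex t ht.1).le
    have h2 := hB T hT (hall T hT) (hex T hT).le
    have h3 : κ * (T - s) = |B - V s| + 1 := by
      simp only [T]; field_simp; ring
    have := le_abs_self (B - V s)
    linarith

/-- Barbalat-type lemma. -/
theorem tendsto_zero_of_lyapunov {f W : ℝ → ℝ} {s B : ℝ} (hf0 : ∀ t, s ≤ t → 0 ≤ f t)
    (huc : UniformContinuousOn f (Set.Ici s)) (hW : ∀ t, s ≤ t → |W t| ≤ B)
    (hd : ∀ t, s ≤ t → ∃ d ≥ f t, HasDerivAt W d t) :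
    Tendsto f atTop (𝓝 0) := by
  have hmono : ∀ t u, s ≤ t → t ≤ u → W t ≤ W u := fun t u hst htu => by
    have := growth_of_hasDerivAt (V := W) (κ := 0) htu fun v hv => by
      obtain ⟨d, hd1, hd2⟩ := hd v (hst.trans hv.1)
      exact ⟨d, (hf0 v (hst.trans hv.1)).trans hd1, hd2⟩
    linarith
  rw [Metric.tendsto_atTop]
  intro ε hε
  rw [Metric.uniformContinuousOn_iff] at huc
  obtain ⟨δ, hδ, hδ'⟩ := huc (ε / 2) (by positivity)
  set g : ℝ → ℝ := fun t => W (max t s)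
  have hgm : Monotone g := fun t u htu =>
    hmono _ _ (le_max_right _ _) (max_le_max htu le_rfl)
  have hgb : BddAbove (Set.range g) := ⟨B, by
    rintro _ ⟨t, rfl⟩
    exact (le_abs_self _).trans (hW _ (le_max_right _ _))⟩
  have hlim := tendsto_atTop_ciSup hgm hgb
  obtain ⟨N, hN⟩ := Metric.tendsto_atTop.1 hlim (ε * δ / 8) (by positivity)
  refine ⟨max N s, fun t ht => ?_⟩
  have hst : s ≤ t := (le_max_right _ _).trans ht
  have hNt : N ≤ t := (le_max_left _ _).trans ht
  rw [Real.dist_eq, sub_zero, abs_of_nonneg (hf0 t hst)]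
  by_contra! hcon
  have hgrow := growth_of_hasDerivAt (V := W) (κ := ε / 2) (s := t) (T := t + δ / 2)
    (by linarith) fun u hu => by
      obtain ⟨d, hd1, hd2⟩ := hd u (hst.trans hu.1)
      refine ⟨d, ?_, hd2⟩
      have := hδ' u (hst.trans hu.1) t hst (by
        rw [Real.dist_eq, abs_of_nonneg (by linarith [hu.1])]; linarith [hu.2])
      rw [Real.dist_eq] at this
      have := (abs_lt.1 this).1
      linarith
  have e1 := hN t hNt
  have e2 := hN (t + δ / 2) (by linarith)
  simp only [g, max_eq_left hst, max_eq_left (show s ≤ t + δ / 2 by linarith),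
    Real.dist_eq] at e1 e2
  have := (abs_lt.1 e1).1
  have := (abs_lt.1 e2).2
  nlinarith

section GlobalFlow
variable {E : Type*} [NormedAddCommGroup E] [NormedSpace ℝ E]

theorem dist_le_exp_of_trajectories {v : E → E} {K : NNReal} (hv : LipschitzWith K v)
    {f g : ℝ → E} (hf : ∀ t, HasDerivAt f (v (f t)) t) (hg : ∀ t, HasDerivAt g (v (g t)) t)
    (t : ℝ) : dist (f t) (g t) ≤ dist (f 0) (g 0) * Real.exp (K * |t|) := by
  rcases le_total 0 t with ht | ht
  · have := dist_le_of_trajectories_ODE (v := fun _ => v) (K := K) (f := f) (g := g) (a := 0)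
      (b := t) (fun _ => hv) (fun x _ => (hf x).continuousAt.continuousWithinAt)
      (fun x _ => (hf x).hasDerivWithinAt)
      (fun x _ => (hg x).continuousAt.continuousWithinAt)
      (fun x _ => (hg x).hasDerivWithinAt) le_rfl t ⟨ht, le_rfl⟩
    simpa [abs_of_nonneg ht] using this
  · have hv' : LipschitzWith K (fun x => -v x) := hv.neg
    have key : ∀ {h : ℝ → E}, (∀ t, HasDerivAt h (v (h t)) t) → ∀ x,
        HasDerivAt (fun t => h (-t)) (-v (h (-x))) x := fun {h} hh x => by
      have := (hh (-x)).scomp x (hasDerivAt_neg x)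
      simpa [Function.comp_def] using this
    have := dist_le_of_trajectories_ODE (v := fun _ x => -v x) (K := K) (f := fun t => f (-t))
      (g := fun t => g (-t)) (a := 0)
      (b := -t) (fun _ => hv') (fun x _ => (key hf x).continuousAt.continuousWithinAt)
      (fun x _ => (key hf x).hasDerivWithinAt)
      (fun x _ => (key hg x).continuousAt.continuousWithinAt)
      (fun x _ => (key hg x).hasDerivWithinAt) le_rfl (-t) ⟨by linarith, le_rfl⟩
    simpa [abs_of_nonpos ht] using this

variable [CompleteSpace E]

theorem exists_hasDerivAt_Ioo {v : E → E} {K M : NNReal} (hv : LipschitzWith K v)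
    (hM : ∀ x, ‖v x‖ ≤ M) (x : E) {T : ℝ} (hT : 0 < T) :
    ∃ α : ℝ → E, α 0 = x ∧ ∀ t ∈ Set.Ioo (-T) T, HasDerivAt α (v (α t)) t := by
  have hPL : IsPicardLindelof (fun _ => v) (tmin := -T) (tmax := T)
      ⟨0, by constructor <;> linarith⟩ x (M * ⟨T, hT.le⟩) 0 M K := by
    refine IsPicardLindelof.of_time_independent (fun y _ => hM y) (hv.lipschitzOnWith) ?_
    simp only [sub_zero, zero_sub, neg_neg, max_self, NNReal.coe_zero]
    exact le_rfl
  obtain ⟨α, h0, h1⟩ := hPL.exists_eq_forall_mem_Icc_hasDerivWithinAt₀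
  exact ⟨α, h0, fun t ht => (h1 t (Set.Ioo_subset_Icc_self ht)).hasDerivAt
    (Icc_mem_nhds ht.1 ht.2)⟩

theorem exists_global_trajectory {v : E → E} {K M : NNReal} (hv : LipschitzWith K v)
    (hM : ∀ x, ‖v x‖ ≤ M) (x : E) :
    ∃ α : ℝ → E, α 0 = x ∧ ∀ t, HasDerivAt α (v (α t)) t := by
  choose β hβ0 hβ using fun n : ℕ =>
    exists_hasDerivAt_Ioo hv hM x (T := (n : ℝ) + 1) (by positivity)
  have hagree : ∀ m n : ℕ, m ≤ n → Set.EqOn (β m) (β n) (Set.Ioo (-((m:ℝ) + 1)) (m + 1)) := by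
    intro m n hmn
    have hmn' : (m : ℝ) ≤ n := by exact_mod_cast hmn
    refine ODE_solution_unique_of_mem_Ioo (v := fun _ => v) (s := fun _ => Set.univ) (K := K)
      (t₀ := 0) (fun _ _ => hv.lipschitzOnWith) ⟨?_, ?_⟩ (fun t ht => ⟨hβ m t ht, trivial⟩)
      (fun t ht => ⟨hβ n t ⟨?_, ?_⟩, trivial⟩) (by rw [hβ0, hβ0])
    · have : (0:ℝ) ≤ m := by positivity
      linarith
    · positivity
    · linarith [ht.1]
    · linarith [ht.2]
  have hbig : ∀ t : ℝ, ∀ n : ℕ, ⌈|t|⌉₊ ≤ n → t ∈ Set.Ioo (-((n:ℝ) + 1)) (n + 1) := by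
    intro t n hn
    have h1 : |t| ≤ n := (Nat.le_ceil _).trans (by exact_mod_cast hn)
    exact ⟨by linarith [neg_abs_le t], by linarith [le_abs_self t]⟩
  refine ⟨fun t => β ⌈|t|⌉₊ t, by simp [hβ0], fun t => ?_⟩
  have hev : ∀ᶠ u in 𝓝 t, β ⌈|u|⌉₊ u = β (⌈|t|⌉₊ + 1) u := by
    filter_upwards [Metric.ball_mem_nhds t zero_lt_one] with u hu
    refine hagree _ _ ?_ (hbig u _ le_rfl)
    rw [Metric.mem_ball, Real.dist_eq] at hu
    refine Nat.ceil_le.2 ?_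
    push_cast
    have := abs_sub_abs_le_abs_sub u t
    linarith [Nat.le_ceil |t|]
  have hd := hβ (⌈|t|⌉₊ + 1) t (hbig t _ (Nat.le_succ _))
  have := hd.congr_of_eventuallyEq hev
  simp only [← hev.self_of_nhds] at this
  exact this

/-- Global flow of a bounded Lipschitz vector field. -/
theorem exists_global_flow {v : E → E} {K M : NNReal} (hv : LipschitzWith K v)
    (hM : ∀ x, ‖v x‖ ≤ M) :
    ∃ Φ : E → ℝ → E, (∀ x, Φ x 0 = x) ∧ (∀ x t, HasDerivAt (Φ x) (v (Φ x t)) t) ∧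
      (∀ x s t, Φ (Φ x s) t = Φ x (s + t)) ∧ Continuous (Function.uncurry Φ) := by
  choose Φ h0 hΦ using exists_global_trajectory hv hM
  have hd := fun x y t => dist_le_exp_of_trajectories hv (hΦ x) (hΦ y) t
  refine ⟨Φ, h0, hΦ, fun x s t => ?_, ?_⟩
  · have hshift : ∀ t, HasDerivAt (fun t => Φ x (s + t)) (v (Φ x (s + t))) t := fun t =>
      (hΦ x (s + t)).comp_const_add s t
    have := dist_le_exp_of_trajectories hv (hΦ (Φ x s)) hshift t
    simp only [h0, add_zero, dist_self, zero_mul] at this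
    exact dist_le_zero.1 this
  · rw [continuous_iff_continuousAt]
    rintro ⟨x, t⟩
    have h1 : Tendsto (fun y : E × ℝ => dist y.1 x * Real.exp (K * |y.2|) + dist (Φ x y.2) (Φ x t))
        (𝓝 (x, t)) (𝓝 (dist x x * Real.exp (K * |t|) + dist (Φ x t) (Φ x t))) := by
      have hc : Continuous (Φ x) := continuous_iff_continuousAt.2 fun t => (hΦ x t).continuousAt
      have : Continuous (fun y : E × ℝ =>
        dist y.1 x * Real.exp (K * |y.2|) + dist (Φ x y.2) (Φ x t)) := by fun_prop
      exact this.tendsto (x, t)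
    simp only [dist_self, zero_mul, add_zero] at h1
    rw [ContinuousAt, tendsto_iff_dist_tendsto_zero]
    refine squeeze_zero (fun _ => dist_nonneg) (fun y => ?_) h1
    calc dist (Function.uncurry Φ y) (Function.uncurry Φ (x, t))
        ≤ dist (Φ y.1 y.2) (Φ x y.2) + dist (Φ x y.2) (Φ x t) := dist_triangle _ _ _
      _ ≤ _ := by
        gcongr
        have := hd y.1 x y.2
        rwa [h0, h0] at this
end GlobalFlow

theorem exists_separating_function {X : Type*} [PseudoMetricSpace X] {A B : Set X} (hA : IsOpen A)
    (hB : IsOpen B) (hAB : Disjoint A B) (hA' : A ≠ Set.univ) (hB' : B ≠ Set.univ) :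
    ∃ f : X → ℝ, Continuous f ∧ (∀ x ∈ A, 0 < f x) ∧ (∀ x ∈ B, f x < 0) := by
  have hAc : Aᶜ.Nonempty := Set.nonempty_compl.2 hA'
  have hBc : Bᶜ.Nonempty := Set.nonempty_compl.2 hB'
  have hpos : ∀ {C : Set X}, IsOpen C → Cᶜ.Nonempty → ∀ x ∈ C, 0 < Metric.infDist x Cᶜ :=
    fun {C} hC hCc x hx =>
      (hC.isClosed_compl.notMem_iff_infDist_pos hCc).1 (fun h => h hx)
  refine ⟨fun x => Metric.infDist x Aᶜ - Metric.infDist x Bᶜ,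
    (Metric.continuous_infDist_pt _).sub (Metric.continuous_infDist_pt _), fun x hx => ?_,
    fun x hx => ?_⟩
  · have h1 := hpos hA hAc x hx
    have h2 : Metric.infDist x Bᶜ = 0 :=
      Metric.infDist_zero_of_mem (Set.disjoint_left.1 hAB hx)
    simp only [h2]; linarith
  · have h1 := hpos hB hBc x hx
    have h2 : Metric.infDist x Aᶜ = 0 :=
      Metric.infDist_zero_of_mem (Set.disjoint_right.1 hAB hx)
    simp only [h2]; linarith

theorem exists_zero_of_square {f g : ℝ × ℝ → ℝ} (hf : Continuous f) (hg : Continuous g)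
    (h1 : ∀ y ∈ Set.Icc (-1:ℝ) 1, 0 < f (1, y)) (h2 : ∀ y ∈ Set.Icc (-1:ℝ) 1, f (-1, y) < 0)
    (h3 : ∀ x ∈ Set.Icc (-1:ℝ) 1, 0 < g (x, 1)) (h4 : ∀ x ∈ Set.Icc (-1:ℝ) 1, g (x, -1) < 0) :
    ∃ x ∈ Set.Icc (-1:ℝ) 1, ∃ y ∈ Set.Icc (-1:ℝ) 1, f (x, y) = 0 ∧ g (x, y) = 0 := by
  by_contra! hcon
  set c : ℝ → ℝ := fun x => max (-1) (min 1 x) with hc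
  have hcmem : ∀ x, c x ∈ Set.Icc (-1:ℝ) 1 := fun x =>
    ⟨le_max_left _ _, max_le (by norm_num) (min_le_left _ _)⟩
  have hceq : ∀ x ∈ Set.Icc (-1:ℝ) 1, c x = x := fun x hx => by
    simp only [hc, min_eq_right hx.2, max_eq_right hx.1]
  have hcc : Continuous c := by fun_prop
  let F : C(ℝ × ℝ, ℂ) := ⟨fun z => ⟨f (c z.1, c z.2), g (c z.1, c z.2)⟩, by
    have : Continuous fun z : ℝ × ℝ =>
      ((f (c z.1, c z.2) : ℝ) : ℂ) + ((g (c z.1, c z.2) : ℝ) : ℂ) * Complex.I := by fun_prop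
    convert this using 2 with z
    apply Complex.ext <;> simp⟩
  have hF0 : ∀ z, F z ≠ 0 := fun z h => by
    have hre := congrArg Complex.re h
    have him := congrArg Complex.im h
    exact hcon _ (hcmem z.1) _ (hcmem z.2) hre him
  obtain ⟨L, ⟨-, hL⟩, -⟩ := Complex.isCoveringMapOn_exp.existsUnique_continuousMap_lifts F
    (a₀ := (0, 0)) (e₀ := Complex.log (F (0, 0))) (Complex.exp_log (hF0 _)) (fun z => hF0 z)
  have hLz : ∀ z, Complex.exp (L z) = F z := fun z => congrFun hL z
  set T : ℝ × ℝ → ℝ := fun z => (L z).im with hT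
  have hTc : Continuous T := Complex.continuous_im.comp L.continuous
  have hcos : ∀ x ∈ Set.Icc (-1:ℝ) 1, ∀ y ∈ Set.Icc (-1:ℝ) 1,
      ∃ ρ > 0, f (x, y) = ρ * Real.cos (T (x, y)) ∧ g (x, y) = ρ * Real.sin (T (x, y)) := by
    intro x hx y hy
    refine ⟨Real.exp (L (x, y)).re, Real.exp_pos _, ?_, ?_⟩
    · rw [← Complex.exp_re, hLz]; simp [F, hceq x hx, hceq y hy]
    · rw [← Complex.exp_im, hLz]; simp [F, hceq x hx, hceq y hy]
  have m1 : (1:ℝ) ∈ Set.Icc (-1:ℝ) 1 := by norm_num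
  have m2 : (-1:ℝ) ∈ Set.Icc (-1:ℝ) 1 := by norm_num
  have edge : ∀ h : ℝ → ℝ, Continuous h → ∀ φ : ℝ,
      (∀ t ∈ Set.Icc (-1:ℝ) 1, 0 < Real.cos (h t + φ)) → Real.sin (h (-1) + φ) < 0 →
      0 < Real.sin (h 1 + φ) → h (-1) < h 1 := by
    intro h hh φ hpos hs1 hs2
    obtain ⟨k, hk⟩ : ∃ k : ℤ, h (-1) + φ - k * (2 * Real.pi) ∈ Set.Ico (-Real.pi) Real.pi := by
      refine ⟨toIcoDiv Real.two_pi_pos (-Real.pi) (h (-1) + φ), ?_⟩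
      have := sub_toIcoDiv_zsmul_mem_Ico Real.two_pi_pos (-Real.pi) (h (-1) + φ)
      rw [zsmul_eq_mul] at this
      exact ⟨this.1, by linarith [this.2]⟩
    have hcos' : ∀ t ∈ Set.Icc (-1:ℝ) 1, 0 < Real.cos (h t + φ - k * (2 * Real.pi)) := by
      intro t ht
      rw [Real.cos_sub_int_mul_two_pi]; exact hpos t ht
    rw [← Real.sin_sub_int_mul_two_pi _ k] at hs1 hs2
    have hstart : |h (-1) + φ - k * (2 * Real.pi)| < Real.pi / 2 := by
      by_contra! hge
      have := hcos' (-1) m2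
      rw [← Real.cos_abs] at this
      have hle : |h (-1) + φ - k * (2 * Real.pi)| ≤ Real.pi :=
        abs_le.2 ⟨hk.1, hk.2.le⟩
      have := Real.cos_nonpos_of_pi_div_two_le_of_le hge (by linarith [Real.pi_pos])
      linarith
    have hall : |h 1 + φ - k * (2 * Real.pi)| < Real.pi / 2 := by
      by_contra! hge
      obtain ⟨t, ht, hte, -⟩ := exists_first_eq
        (f := fun t => |h t + φ - k * (2 * Real.pi)|) (s := -1) (t := 1) (c := Real.pi / 2)
        (by norm_num) (by fun_prop) hstart hge
      have := hcos' t ⟨ht.1.le, ht.2⟩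
      rw [← Real.cos_abs, hte, Real.cos_pi_div_two] at this
      exact lt_irrefl _ this
    rw [abs_lt] at hstart hall
    have e1 : h (-1) + φ - k * (2 * Real.pi) < 0 := by
      by_contra! hge
      have := Real.sin_nonneg_of_nonneg_of_le_pi hge (by linarith)
      linarith
    have e2 : 0 < h 1 + φ - k * (2 * Real.pi) := by
      by_contra! hge
      have := Real.sin_nonpos_of_nonpos_of_neg_pi_le hge (by linarith)
      linarith
    linarith
  have fpos : ∀ x ∈ Set.Icc (-1:ℝ) 1, ∀ y ∈ Set.Icc (-1:ℝ) 1, 0 < f (x, y) →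
      0 < Real.cos (T (x, y)) := fun x hx y hy h => by
    obtain ⟨ρ, hρ, e, -⟩ := hcos x hx y hy
    rw [e] at h; exact pos_of_mul_pos_right h hρ.le
  have fneg : ∀ x ∈ Set.Icc (-1:ℝ) 1, ∀ y ∈ Set.Icc (-1:ℝ) 1, f (x, y) < 0 →
      Real.cos (T (x, y)) < 0 := fun x hx y hy h => by
    obtain ⟨ρ, hρ, e, -⟩ := hcos x hx y hy
    rw [e] at h; exact neg_of_mul_neg_right h hρ.le
  have gpos : ∀ x ∈ Set.Icc (-1:ℝ) 1, ∀ y ∈ Set.Icc (-1:ℝ) 1, 0 < g (x, y) →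
      0 < Real.sin (T (x, y)) := fun x hx y hy h => by
    obtain ⟨ρ, hρ, -, e⟩ := hcos x hx y hy
    rw [e] at h; exact pos_of_mul_pos_right h hρ.le
  have gneg : ∀ x ∈ Set.Icc (-1:ℝ) 1, ∀ y ∈ Set.Icc (-1:ℝ) 1, g (x, y) < 0 →
      Real.sin (T (x, y)) < 0 := fun x hx y hy h => by
    obtain ⟨ρ, hρ, -, e⟩ := hcos x hx y hy
    rw [e] at h; exact neg_of_mul_neg_right h hρ.le
  have neg_mem : ∀ t ∈ Set.Icc (-1:ℝ) 1, -t ∈ Set.Icc (-1:ℝ) 1 := fun t ht =>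
    ⟨by linarith [ht.2], by linarith [ht.1]⟩
  have r1 := edge (fun t => T (1, t)) (by fun_prop) 0
    (fun t ht => by simpa using fpos _ m1 _ ht (h1 t ht))
    (by simpa using gneg _ m1 _ m2 (h4 1 m1)) (by simpa using gpos _ m1 _ m1 (h3 1 m1))
  have r2 := edge (fun t => T (-t, 1)) (by fun_prop) (-(Real.pi / 2))
    (fun t ht => by
      simpa [← sub_eq_add_neg, Real.cos_sub_pi_div_two] using
        gpos _ (neg_mem t ht) _ m1 (h3 _ (neg_mem t ht)))
    (by simpa [← sub_eq_add_neg, Real.sin_sub_pi_div_two] using fpos _ m1 _ m1 (h1 1 m1))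
    (by simpa [← sub_eq_add_neg, Real.sin_sub_pi_div_two] using fneg _ m2 _ m1 (h2 1 m1))
  have r3 := edge (fun t => T (-1, -t)) (by fun_prop) Real.pi
    (fun t ht => by
      simpa [Real.cos_add_pi] using fneg _ m2 _ (neg_mem t ht) (h2 _ (neg_mem t ht)))
    (by simpa [Real.sin_add_pi] using gpos _ m2 _ m1 (h3 (-1) m2))
    (by simpa [Real.sin_add_pi] using gneg _ m2 _ m2 (h4 (-1) m2))
  have r4 := edge (fun t => T (t, -1)) (by fun_prop) (Real.pi / 2)
    (fun t ht => by
      simpa [Real.cos_add_pi_div_two] using gneg _ ht _ m2 (h4 t ht))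
    (by simpa [Real.sin_add_pi_div_two] using fneg _ m2 _ m2 (h2 (-1) m2))
    (by simpa [Real.sin_add_pi_div_two] using fpos _ m1 _ m2 (h1 (-1) m2))
  simp only [neg_neg] at r2 r3
  linarith

/-- Two-dimensional Poincaré–Miranda theorem for two pairs of disjoint open sets. -/
theorem exists_mem_square_notMem {A₁ A₂ B₁ B₂ : Set (ℝ × ℝ)} (hA₁ : IsOpen A₁) (hA₂ : IsOpen A₂)
    (hB₁ : IsOpen B₁) (hB₂ : IsOpen B₂) (hA : Disjoint A₁ A₂) (hB : Disjoint B₁ B₂)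
    (h1 : ∀ y ∈ Set.Icc (-1:ℝ) 1, (1, y) ∈ A₁) (h2 : ∀ y ∈ Set.Icc (-1:ℝ) 1, (-1, y) ∈ A₂)
    (h3 : ∀ x ∈ Set.Icc (-1:ℝ) 1, (x, 1) ∈ B₁) (h4 : ∀ x ∈ Set.Icc (-1:ℝ) 1, (x, -1) ∈ B₂) :
    ∃ x ∈ Set.Icc (-1:ℝ) 1, ∃ y ∈ Set.Icc (-1:ℝ) 1, (x, y) ∉ A₁ ∧ (x, y) ∉ A₂ ∧
      (x, y) ∉ B₁ ∧ (x, y) ∉ B₂ := by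
  have m1 : (1:ℝ) ∈ Set.Icc (-1:ℝ) 1 := by norm_num
  obtain ⟨f, hf, f1, f2⟩ := exists_separating_function hA₁ hA₂ hA
    (fun h => Set.disjoint_left.1 hA (h ▸ Set.mem_univ (-1, 1)) (h2 1 m1))
    (fun h => Set.disjoint_left.1 hA (h1 1 m1) (h ▸ Set.mem_univ (1, 1)))
  obtain ⟨g, hg, g1, g2⟩ := exists_separating_function hB₁ hB₂ hB
    (fun h => Set.disjoint_left.1 hB (h ▸ Set.mem_univ (1, -1)) (h4 1 m1))
    (fun h => Set.disjoint_left.1 hB (h3 1 m1) (h ▸ Set.mem_univ (1, 1)))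
  obtain ⟨x, hx, y, hy, e1, e2⟩ := exists_zero_of_square hf hg (fun y hy => f1 _ (h1 y hy))
    (fun y hy => f2 _ (h2 y hy)) (fun x hx => g1 _ (h3 x hx)) (fun x hx => g2 _ (h4 x hx))
  exact ⟨x, hx, y, hy, fun h => (f1 _ h).ne' e1, fun h => (f2 _ h).ne e1,
    fun h => (g1 _ h).ne' e2, fun h => (g2 _ h).ne e2⟩

/-- Data of one fast transition layer (a front or a back) of the travelling-wave system, written
in coordinates in which the layer starts at the equilibrium `(0, 0, ua)`. -/
structure Layer where
  (R a b e ua uT qT c₁ σ z₂ z₁ z₀ ν ζ : ℝ)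
  (q₂ q₃ ulo uhi kl kh μl μh : ℝ)
  (ρ₀ ω₀ ω₁ ζ₀ ζ₁ c₀ C₀ d₀ d₁ cm : ℝ)
  ω : ℝ → ℝ → ℝ
  hR : 0 < R
  hb : 0 < b
  hba : b < a
  hc₁ : 0 ≤ c₁
  hσ : |σ| ≤ 1
  hν₀ : 0 ≤ ν
  hν₁ : ν ≤ 1
  hq₂b : b < q₂
  hq₂ : q₂ < a
  hq₃ : a < q₃
  hulo : 1 ≤ ulo
  huhi : uhi ≤ 3
  hua : ua ∈ Set.Ioo ulo uhi
  huT : uT ∈ Set.Ioo ulo uhi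
  hkl : 0 < kl
  hkh : kl ≤ kh
  hd₀ : 0 < d₀
  hden : ∀ u ∈ Set.Icc ulo uhi, ∀ μ ∈ Set.Icc μl μh, d₀ < u + ζ + μ ∧ u + ζ + μ ≤ d₁
  hcm : ∀ u ∈ Set.Icc ulo uhi, ∀ μ ∈ Set.Icc μl μh, |u + μ| ≤ cm
  hρ₀ : 0 < ρ₀
  hω₀ : 0 < ω₀
  hζ₀ : 0 < ζ₀
  hc₀ : 0 < c₀
  hC₀ : 0 < C₀
  hF : ∀ q u, R * q * (q - b) * (a - q) + (q - e) * (u - ua) =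
    -ω q u * (z₂ * q ^ 2 + z₁ * q + z₀ - ν * u)
  hq : ∀ q ∈ Set.Icc q₂ q₃, ∀ u ∈ Set.Icc ulo uhi,
    |z₂ * q ^ 2 + z₁ * q + z₀ - ν * u| ≤ ρ₀ → q₂ < q ∧ q < q₃
  hω : ∀ q ∈ Set.Icc q₂ q₃, ∀ u ∈ Set.Icc ulo uhi,
    |z₂ * q ^ 2 + z₁ * q + z₀ - ν * u| ≤ ρ₀ → ω₀ ≤ ω q u ∧ ω q u ≤ ω₁
  hζ : ∀ q ∈ Set.Icc q₂ q₃, ζ₀ ≤ 2 * z₂ * q + z₁ ∧ 2 * z₂ * q + z₁ ≤ ζ₁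
  hZa : z₂ * a ^ 2 + z₁ * a + z₀ - ν * ua = 0
  hslow : ∀ q ∈ Set.Icc q₂ q₃, ∀ u ∈ Set.Icc ulo uhi,
    (u - uT) * (-c₁ * (u - ua) + 2 * σ * q * (1 - u)) ≤
      -c₀ * (u - uT) ^ 2 + C₀ * |z₂ * q ^ 2 + z₁ * q + z₀ - ν * u| * |u - uT| ∧
    |-c₁ * (u - ua) + 2 * σ * q * (1 - u)| ≤
      C₀ * (|u - uT| + |z₂ * q ^ 2 + z₁ * q + z₀ - ν * u|) ∧
    |q - qT| ≤ C₀ * (|z₂ * q ^ 2 + z₁ * q + z₀ - ν * u| + |u - uT|)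

namespace Layer
variable (H : Layer)

def F (q u : ℝ) : ℝ := H.R * q * (q - H.b) * (H.a - q) + (q - H.e) * (u - H.ua)
def gn (q u : ℝ) : ℝ := -H.c₁ * (u - H.ua) + 2 * H.σ * q * (1 - u)
def den (u μ : ℝ) : ℝ := max H.d₀ (u + H.ζ + μ)
def G (q u μ : ℝ) : ℝ := H.gn q u / H.den u μ
def Z (q u : ℝ) : ℝ := H.z₂ * q ^ 2 + H.z₁ * q + H.z₀ - H.ν * u
def dZ (q : ℝ) : ℝ := 2 * H.z₂ * q + H.z₁
def Y (ε μ q p u : ℝ) : ℝ := H.dZ q * p - H.ν * ε * H.G q u μ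
def α (k : ℝ) : ℝ := 2 * k ^ 2 / H.R
def pdot (k μ q p u : ℝ) : ℝ := H.α k * ((u + μ) * p - H.F q u)
/-- Mismatch between the wave speed seen by the layer and its Nagumo speed. -/
def s (k μ : ℝ) : ℝ := H.ua + μ - H.R * (H.a - 2 * H.b) / (2 * k)
def Par (k μ : ℝ) : Prop := k ∈ Set.Icc H.kl H.kh ∧ μ ∈ Set.Icc H.μl H.μh
def Box (P q p u : ℝ) : Prop :=
  q ∈ Set.Icc (-1) (H.q₃ + 1) ∧ p ∈ Set.Icc (-P) P ∧ u ∈ Set.Icc H.ulo H.uhi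

/-- Functions that solve the layer system as long as they stay in `Box P`. -/
structure Traj (ε k μ P : ℝ) (q p u : ℝ → ℝ) : Prop where
  par : H.Par k μ
  cq : Continuous q
  cp : Continuous p
  cu : Continuous u
  dq : ∀ t, H.Box P (q t) (p t) (u t) → HasDerivAt q (p t) t
  dp : ∀ t, H.Box P (q t) (p t) (u t) → HasDerivAt p (H.pdot k μ (q t) (p t) (u t)) t
  du : ∀ t, H.Box P (q t) (p t) (u t) → HasDerivAt u (ε * H.G (q t) (u t) μ) t

variable {H}

theorem ha : 0 < H.a := H.hb.trans H.hba
theorem q₂_pos : 0 < H.q₂ := H.hb.trans H.hq₂b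
theorem Par.k_pos {k μ : ℝ} (h : H.Par k μ) : 0 < k := H.hkl.trans_le h.1.1

theorem α_mul_R (k : ℝ) : H.α k * H.R = 2 * k ^ 2 := by
  have := H.hR.ne'
  unfold α; field_simp

theorem α_pos {k : ℝ} (hk : 0 < k) : 0 < H.α k := by
  have := H.hR
  unfold α; positivity

theorem α_le {k μ : ℝ} (h : H.Par k μ) : H.α k ≤ H.α H.kh := by
  have h0 := h.k_pos
  have h1 := h.1.2
  have := H.hR
  unfold α; gcongr

theorem α_mul_s {k : ℝ} (hk : 0 < k) (μ : ℝ) :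
    H.α k * H.s k μ = H.α k * (H.ua + μ) - k * (H.a - 2 * H.b) := by
  have := H.hR.ne'
  unfold α s; field_simp

theorem den_eq {k μ u : ℝ} (h : H.Par k μ) (hu : u ∈ Set.Icc H.ulo H.uhi) :
    H.den u μ = u + H.ζ + μ := max_eq_right (H.hden u hu μ h.2).1.le

theorem d₀_le_den (u μ : ℝ) : H.d₀ ≤ H.den u μ := le_max_left _ _

theorem den_pos (u μ : ℝ) : 0 < H.den u μ := H.hd₀.trans_le (H.d₀_le_den u μ)

/-- The acceleration in blow-up coordinates at the starting equilibrium. -/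
theorem pdot_blowup {k : ℝ} (hk : 0 < k) (μ q w n : ℝ) :
    H.pdot k μ q (q * (w + k * (H.a - q))) (H.ua + q * n) -
        k * (H.a - 2 * q) * (q * (w + k * (H.a - q))) =
      q * (H.α k * H.s k μ * (w + k * (H.a - q)) + 2 * k * (q - H.b) * w +
        H.α k * n * (q * (w + k * (H.a - q)) - q + H.e)) := by
  rw [H.α_mul_s hk]
  have hα := H.α_mul_R k
  unfold pdot F
  linear_combination (-(q * (q - H.b) * (H.a - q))) * hα

theorem abs_gn_le {q u n : ℝ} (hu : u ∈ Set.Icc H.ulo H.uhi) (hq : 0 ≤ q)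
    (hn : u = H.ua + q * n) : H.gn q u ≤ q * (4 - H.c₁ * n) ∧ q * (-4 - H.c₁ * n) ≤ H.gn q u := by
  have h1 := H.hulo
  have h2 := H.huhi
  have h3 : |2 * H.σ * (1 - u)| ≤ 4 := by
    have : |1 - u| ≤ 2 := abs_le.2 ⟨by linarith [hu.2], by linarith [hu.1]⟩
    have h5 := H.hσ
    rw [abs_mul, abs_mul, abs_two]
    nlinarith [abs_nonneg H.σ, abs_nonneg (1 - u)]
  have h4 : H.gn q u = q * (2 * H.σ * (1 - u) - H.c₁ * n) := by
    unfold gn; rw [hn]; ring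
  rw [h4]
  constructor
  · gcongr; exact (abs_le.1 h3).2
  · gcongr; exact (abs_le.1 h3).1

theorem abs_gn_le_const {q u : ℝ} (hu : u ∈ Set.Icc H.ulo H.uhi) (hq : 0 ≤ q) (hq' : q ≤ H.q₃) :
    |H.gn q u| ≤ 2 * H.c₁ + 4 * H.q₃ := by
  have h1 := H.hulo
  have h2 := H.huhi
  have h3 := H.hua
  have h5 := H.hσ
  have e1 : |u - H.ua| ≤ 2 := abs_le.2 ⟨by linarith [hu.1, h3.2], by linarith [hu.2, h3.1]⟩
  have e2 : |1 - u| ≤ 2 := abs_le.2 ⟨by linarith [hu.2], by linarith [hu.1]⟩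
  unfold gn
  refine (abs_add_le _ _).trans ?_
  rw [abs_mul, abs_neg, abs_of_nonneg H.hc₁, abs_mul, abs_mul, abs_mul, abs_two, abs_of_nonneg hq]
  have := hq.trans hq'
  have : |H.σ| * q * |1 - u| ≤ 1 * H.q₃ * 2 := by gcongr
  nlinarith [H.hc₁]

end Layer

namespace Layer
variable (H : Layer)

/-- Slope bound `|p| ≤ M q` in the wedge. -/
def M : ℝ := 2 * H.kh * H.a
/-- Smallness conditions under which the wedge around `p = k q (a - q)` is invariant. -/
structure WedgeHyp (ε P δ ρ₁ τ C : ℝ) : Prop where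
  hε : 0 < ε
  hδ : 0 ≤ δ
  hρ₁ : 0 < ρ₁
  hρ₁a : ρ₁ < H.a
  hτ₀ : 0 < τ
  hC₀ : 0 < C
  hτ : 6 * H.a * τ ≤ H.kl * ρ₁ ^ 4 * (H.a + 2 * H.b)
  hδτ : 2 * H.a ^ 3 * (H.α H.kh * (δ * H.M + C * ε * (H.M * H.a + H.a + |H.e|))) <
    τ * H.kl * (H.a + 2 * H.b)
  hC : 8 < C * H.kl * ρ₁ * H.d₀
  hlo : H.ulo ≤ H.ua - C * ε * H.a
  hhi : H.ua + C * ε * H.a ≤ H.uhi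
  hP : H.M * H.a ≤ P
  hstart : H.kh * δ * H.a ^ 3 < τ

def Wedge (k ρ₁ τ C ε q p u : ℝ) : Prop :=
  0 ≤ q ∧ q ≤ H.a - ρ₁ ∧ |p - k * q * (H.a - q)| * (H.a - q) ^ 3 ≤ τ * q ∧ |u - H.ua| ≤ C * ε * q

variable {H}

theorem M_pos : 0 < H.M := by
  have := H.ha
  have := H.hkl.trans_le H.hkh
  unfold M; positivity

/-- In the wedge, the trajectory is parametrised by blow-up coordinates with small `w`. -/
theorem WedgeHyp.abs_w_le {ε P δ ρ₁ τ C : ℝ} (h : H.WedgeHyp ε P δ ρ₁ τ C) {k μ q w : ℝ}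
    (hk : H.Par k μ) (hq : q ≤ H.a - ρ₁) (hw : |w| * (H.a - q) ^ 3 ≤ τ) :
    3 * H.a * |w| ≤ k * (H.a - q) * (H.a + 2 * H.b) / 2 ∧ |w| ≤ k * (H.a - q) / 2 := by
  have h1 : ρ₁ ≤ H.a - q := by linarith
  have hρ := h.hρ₁
  have hb := H.hb
  have ha := H.ha
  have hkl := H.hkl
  have hc : 0 < H.a - q := hρ.trans_le h1
  have hb3 : H.a + 2 * H.b ≤ 3 * H.a := by linarith [H.hba]
  have e1 : 6 * H.a * |w| * (H.a - q) ^ 3 ≤ k * (H.a - q) * (H.a + 2 * H.b) * (H.a - q) ^ 3 := by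
    calc 6 * H.a * |w| * (H.a - q) ^ 3 = 6 * H.a * (|w| * (H.a - q) ^ 3) := by ring
      _ ≤ 6 * H.a * τ := by gcongr
      _ ≤ H.kl * ρ₁ ^ 4 * (H.a + 2 * H.b) := h.hτ
      _ ≤ k * (H.a - q) ^ 4 * (H.a + 2 * H.b) := by
        have := hk.1.1
        have := hk.k_pos
        gcongr
      _ = _ := by ring
  have e2 := le_of_mul_le_mul_right e1 (by positivity)
  refine ⟨by linarith, ?_⟩
  have e3 : k * (H.a - q) * (H.a + 2 * H.b) ≤ k * (H.a - q) * (3 * H.a) := by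
    have := hk.k_pos
    gcongr
  have : (6 * H.a) * |w| ≤ (6 * H.a) * (k * (H.a - q) / 2) := by nlinarith
  exact le_of_mul_le_mul_left this (by positivity)

theorem WedgeHyp.slope {ε P δ ρ₁ τ C : ℝ} (h : H.WedgeHyp ε P δ ρ₁ τ C) {k μ q w : ℝ}
    (hk : H.Par k μ) (hq0 : 0 ≤ q) (hq : q ≤ H.a - ρ₁)
    (hw : |w| * (H.a - q) ^ 3 ≤ τ) :
    k * ρ₁ / 2 ≤ w + k * (H.a - q) ∧ k * (H.a - q) / 2 ≤ w + k * (H.a - q) ∧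
      w + k * (H.a - q) ≤ 3 / 2 * k * (H.a - q) ∧ w + k * (H.a - q) ≤ H.M := by
  obtain ⟨-, e⟩ := h.abs_w_le hk hq hw
  obtain ⟨e1, e2⟩ := abs_le.1 e
  have hk0 := hk.k_pos
  have h1 : k * ρ₁ ≤ k * (H.a - q) := by gcongr; linarith
  have h2 : k * (H.a - q) ≤ H.kh * H.a := by
    have := hk.1.2
    have ha := H.ha
    have hkh := hk0.trans_le this
    have : H.a - q ≤ H.a := by linarith
    have : 0 ≤ H.a - q := by linarith [h.hρ₁]
    gcongr
  have h3 : 0 ≤ k * (H.a - q) := by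
    have : 0 ≤ H.a - q := by linarith [h.hρ₁]
    positivity
  unfold M
  refine ⟨by linarith, by linarith, by linarith, by linarith⟩

theorem abs_blowup_err {ε P δ ρ₁ τ C : ℝ} (h : H.WedgeHyp ε P δ ρ₁ τ C) {k μ q m n : ℝ}
    (hk : H.Par k μ) (hs : |H.s k μ| ≤ δ) (hq0 : 0 ≤ q) (hq : q ≤ H.a)
    (hm0 : 0 ≤ m) (hmM : m ≤ H.M) (hn : |n| ≤ C * ε) :
    2 * H.a ^ 3 * |H.α k * H.s k μ * m + H.α k * n * (q * m - q + H.e)| <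
      τ * H.kl * (H.a + 2 * H.b) := by
  have hα := H.α_le hk
  have hα0 := H.α_pos hk.k_pos
  have ha := H.ha
  have hδ := h.hδ
  have hε := h.hε
  have hC := h.hC₀
  have hM := M_pos (H := H)
  have hαh := hα0.trans_le hα
  have e1 : |q * m - q + H.e| ≤ H.M * H.a + H.a + |H.e| := by
    have : |q * m| ≤ H.M * H.a := by
      rw [abs_of_nonneg (by positivity), mul_comm]; gcongr
    have : |q| ≤ H.a := by rwa [abs_of_nonneg hq0]
    calc |q * m - q + H.e| ≤ |q * m - q| + |H.e| := abs_add_le _ _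
      _ ≤ |q * m| + |q| + |H.e| := by gcongr; exact abs_sub _ _
      _ ≤ _ := by linarith
  have e2 : |H.α k * H.s k μ * m + H.α k * n * (q * m - q + H.e)| ≤
      H.α H.kh * (δ * H.M + C * ε * (H.M * H.a + H.a + |H.e|)) := by
    have : H.α k * H.s k μ * m + H.α k * n * (q * m - q + H.e) =
      H.α k * (H.s k μ * m + n * (q * m - q + H.e)) := by ring
    rw [this, abs_mul, abs_of_pos hα0]
    have : |H.s k μ * m + n * (q * m - q + H.e)| ≤ δ * H.M + C * ε * (H.M * H.a + H.a + |H.e|) := by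
      refine (abs_add_le _ _).trans ?_
      rw [abs_mul, abs_mul, abs_of_nonneg hm0]
      gcongr
    have := M_pos (H := H)
    gcongr
  refine lt_of_le_of_lt ?_ h.hδτ
  gcongr

theorem wedge_upper {ε P δ ρ₁ τ C : ℝ} (h : H.WedgeHyp ε P δ ρ₁ τ C) {k μ q w n : ℝ}
    (hk : H.Par k μ) (hs : |H.s k μ| ≤ δ) (hq0 : 0 < q) (hq : q ≤ H.a - ρ₁)
    (hw : w * (H.a - q) ^ 3 = τ) (hn : |n| ≤ C * ε) :
    0 < τ * (q * (w + k * (H.a - q))) -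
      (H.pdot k μ q (q * (w + k * (H.a - q))) (H.ua + q * n) -
        k * (H.a - 2 * q) * (q * (w + k * (H.a - q)))) * (H.a - q) ^ 3 +
      3 * (q * w) * (H.a - q) ^ 2 * (q * (w + k * (H.a - q))) := by
  have hρ := h.hρ₁
  have hτ := h.hτ₀
  have hb := H.hb
  have ha := H.ha
  have hkl := H.hkl
  have hk0 := hk.k_pos
  have hc : 0 < H.a - q := by linarith
  have hw0 : 0 < w := pos_of_mul_pos_left (hw.symm ▸ hτ) (by positivity)
  have hw' : |w| * (H.a - q) ^ 3 ≤ τ := by rw [abs_of_pos hw0, hw]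
  obtain ⟨hm1, -, -, hm2⟩ := h.slope hk hq0.le hq hw'
  have herr := abs_blowup_err h hk hs hq0.le (by linarith) (m := w + k * (H.a - q))
    (by have : 0 < k * ρ₁ := by positivity
        linarith) hm2 hn
  rw [pdot_blowup hk0]
  set X := H.α k * H.s k μ * (w + k * (H.a - q)) +
    H.α k * n * (q * (w + k * (H.a - q)) - q + H.e) with hX
  have hτw : τ ≤ w * H.a ^ 3 := by rw [← hw]; gcongr; linarith
  have key : 0 < w * ((H.a + 2 * q) * w + k * (H.a - q) * (H.a + 2 * H.b)) - (H.a - q) * X := by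
    have e1 : H.a ^ 3 * |X| < H.a ^ 3 * (w * (k * (H.a + 2 * H.b))) := by
      calc H.a ^ 3 * |X| ≤ 2 * H.a ^ 3 * |X| := by
            have : 0 ≤ H.a ^ 3 * |X| := by positivity
            linarith
        _ < τ * H.kl * (H.a + 2 * H.b) := herr
        _ ≤ (w * H.a ^ 3) * k * (H.a + 2 * H.b) := by
          have := hk.1.1
          gcongr
        _ = _ := by ring
    have e2 := lt_of_mul_lt_mul_left e1 (by positivity)
    have e3 : X ≤ |X| := le_abs_self X
    have e4 : 0 ≤ w * ((H.a + 2 * q) * w) := by positivity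
    nlinarith
  have : τ * (q * (w + k * (H.a - q))) -
      q * (H.α k * H.s k μ * (w + k * (H.a - q)) + 2 * k * (q - H.b) * w +
        H.α k * n * (q * (w + k * (H.a - q)) - q + H.e)) * (H.a - q) ^ 3 +
      3 * (q * w) * (H.a - q) ^ 2 * (q * (w + k * (H.a - q))) =
      q * (H.a - q) ^ 2 * (w * ((H.a + 2 * q) * w + k * (H.a - q) * (H.a + 2 * H.b)) -
        (H.a - q) * X) := by
    rw [hX, ← hw]; ring
  rw [this]
  positivity

theorem wedge_lower {ε P δ ρ₁ τ C : ℝ} (h : H.WedgeHyp ε P δ ρ₁ τ C) {k μ q w n : ℝ}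
    (hk : H.Par k μ) (hs : |H.s k μ| ≤ δ) (hq0 : 0 < q) (hq : q ≤ H.a - ρ₁)
    (hw : -w * (H.a - q) ^ 3 = τ) (hn : |n| ≤ C * ε) :
    0 < τ * (q * (w + k * (H.a - q))) +
      (H.pdot k μ q (q * (w + k * (H.a - q))) (H.ua + q * n) -
        k * (H.a - 2 * q) * (q * (w + k * (H.a - q)))) * (H.a - q) ^ 3 -
      3 * (q * w) * (H.a - q) ^ 2 * (q * (w + k * (H.a - q))) := by
  have hρ := h.hρ₁
  have hτ := h.hτ₀
  have hb := H.hb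
  have ha := H.ha
  have hkl := H.hkl
  have hk0 := hk.k_pos
  have hc : 0 < H.a - q := by linarith
  have hw0 : 0 < -w := pos_of_mul_pos_left (hw.symm ▸ hτ) (by positivity)
  have hw' : |w| * (H.a - q) ^ 3 ≤ τ := by rw [abs_of_neg (by linarith), hw]
  obtain ⟨hm1, -, -, hm2⟩ := h.slope hk hq0.le hq hw'
  obtain ⟨hx, -⟩ := h.abs_w_le hk hq hw'
  have herr := abs_blowup_err h hk hs hq0.le (by linarith) (m := w + k * (H.a - q))
    (by have : 0 < k * ρ₁ := by positivity
        linarith) hm2 hn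
  rw [pdot_blowup hk0]
  set X := H.α k * H.s k μ * (w + k * (H.a - q)) +
    H.α k * n * (q * (w + k * (H.a - q)) - q + H.e) with hX
  have hτw : τ ≤ -w * H.a ^ 3 := by rw [← hw]; gcongr; linarith
  rw [abs_of_neg (by linarith)] at hx
  have key : 0 < -w * ((H.a + 2 * q) * w + k * (H.a - q) * (H.a + 2 * H.b)) + (H.a - q) * X := by
    have e1 : 2 * H.a ^ 3 * |X| < 2 * H.a ^ 3 * (-w * (k * (H.a + 2 * H.b) / 2)) := by
      calc 2 * H.a ^ 3 * |X| < τ * H.kl * (H.a + 2 * H.b) := herr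
        _ ≤ (-w * H.a ^ 3) * k * (H.a + 2 * H.b) := by
          have := hk.1.1
          gcongr
        _ = _ := by ring
    have e2 := lt_of_mul_lt_mul_left e1 (by positivity)
    have e3 : -|X| ≤ X := neg_abs_le X
    have e5 : (H.a + 2 * q) * (-w) ≤ k * (H.a - q) * (H.a + 2 * H.b) / 2 := by
      refine le_trans ?_ hx
      have : H.a + 2 * q ≤ 3 * H.a := by linarith
      nlinarith
    have e6 : -w * (k * (H.a - q) * (H.a + 2 * H.b) / 2) ≤
        -w * ((H.a + 2 * q) * w + k * (H.a - q) * (H.a + 2 * H.b)) := by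
      gcongr; linarith
    nlinarith
  have : τ * (q * (w + k * (H.a - q))) +
      q * (H.α k * H.s k μ * (w + k * (H.a - q)) + 2 * k * (q - H.b) * w +
        H.α k * n * (q * (w + k * (H.a - q)) - q + H.e)) * (H.a - q) ^ 3 -
      3 * (q * w) * (H.a - q) ^ 2 * (q * (w + k * (H.a - q))) =
      q * (H.a - q) ^ 2 * (-w * ((H.a + 2 * q) * w + k * (H.a - q) * (H.a + 2 * H.b)) +
        (H.a - q) * X) := by
    rw [hX, ← hw]; ring
  rw [this]
  positivity

/-- The faces `u - ua = ± C ε q` are repelling wherever `C m` dominates `4 / d₀`. -/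
theorem u_face {ε C m q n u μ : ℝ} (hε : 0 < ε) (hC : 0 < C) (hq0 : 0 < q)
    (hu : u ∈ Set.Icc H.ulo H.uhi) (hun : u = H.ua + q * n) (hm : 4 < C * m * H.d₀)
    (hn : |n| = C * ε) :
    (n = C * ε → 0 < C * ε * (q * m) - ε * H.G q u μ) ∧
    (n = -(C * ε) → 0 < C * ε * (q * m) + ε * H.G q u μ) := by
  obtain ⟨g1, g2⟩ := H.abs_gn_le hu hq0.le hun
  have hd := H.den_pos u μ
  have hdd := H.d₀_le_den u μ
  have hc₁ := H.hc₁
  have hCm : 0 < C * m := pos_of_mul_pos_left (lt_trans (by norm_num) hm) H.hd₀.le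
  have hm' : 4 < C * m * H.den u μ := hm.trans_le (by gcongr)
  have hCε : 0 < C * ε := by positivity
  constructor
  · rintro rfl
    have : H.G q u μ < C * (q * m) := by
      unfold G
      rw [div_lt_iff₀ hd]
      have : q * (4 - H.c₁ * (C * ε)) ≤ q * 4 := by
        gcongr; linarith [mul_nonneg hc₁ hCε.le]
      nlinarith
    nlinarith
  · rintro rfl
    have : -(C * (q * m)) < H.G q u μ := by
      unfold G
      rw [lt_div_iff₀ hd]
      have : q * (-4) ≤ q * (-4 - H.c₁ * -(C * ε)) := by
        gcongr; linarith [mul_nonneg hc₁ hCε.le]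
      nlinarith
    nlinarith

end Layer

namespace Layer
variable {H : Layer}

theorem exists_blowup (H : Layer) {q : ℝ} (hq : q ≠ 0) (k p u : ℝ) :
    ∃ w n, p = q * (w + k * (H.a - q)) ∧ u = H.ua + q * n :=
  ⟨p / q - k * (H.a - q), (u - H.ua) / q, by field_simp; ring, by field_simp; ring⟩

theorem abs_le_of_abs_mul_le {q n C : ℝ} (hq : 0 < q) (h : |q * n| ≤ C * q) : |n| ≤ C := by
  rw [abs_mul, abs_of_pos hq] at h
  nlinarith

theorem Wedge.bounds {ε P δ ρ₁ τ C : ℝ} (h : H.WedgeHyp ε P δ ρ₁ τ C) {k μ q p u : ℝ}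
    (hk : H.Par k μ) (hw : H.Wedge k ρ₁ τ C ε q p u) :
    k * ρ₁ / 2 * q ≤ p ∧ k * (H.a - q) / 2 * q ≤ p ∧ p ≤ 3 / 2 * k * (H.a - q) * q ∧
      p ≤ H.M * q ∧ u ∈ Set.Icc H.ulo H.uhi ∧ H.Box P q p u := by
  obtain ⟨hq0, hq1, hy, hu⟩ := hw
  have hkρ : 0 < k * ρ₁ := mul_pos hk.k_pos h.hρ₁
  have ha := H.ha
  have hu' : u ∈ Set.Icc H.ulo H.uhi := by
    have h1 := h.hlo
    have h2 := h.hhi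
    have h3 : C * ε * q ≤ C * ε * H.a := by
      have := h.hC₀
      have := h.hε
      have := h.hρ₁
      gcongr; linarith
    obtain ⟨h4, h5⟩ := abs_le.1 hu
    constructor <;> linarith
  have main : k * ρ₁ / 2 * q ≤ p ∧ k * (H.a - q) / 2 * q ≤ p ∧ p ≤ 3 / 2 * k * (H.a - q) * q ∧
      p ≤ H.M * q := by
    rcases hq0.eq_or_lt with rfl | hq0
    · have : p = 0 := by
        simp only [mul_zero, zero_mul, sub_zero] at hy
        have : 0 < H.a ^ 3 := by positivity
        exact abs_nonpos_iff.1 (by nlinarith [abs_nonneg p])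
      simp [this]
    · obtain ⟨w, n, hp, -⟩ := H.exists_blowup hq0.ne' k p u
      have hw : |w| * (H.a - q) ^ 3 ≤ τ := by
        have : p - k * q * (H.a - q) = q * w := by rw [hp]; ring
        rw [this, abs_mul, abs_of_pos hq0] at hy
        nlinarith
      obtain ⟨e1, e2, e3, e4⟩ := h.slope hk hq0.le hq1 hw
      rw [hp]
      refine ⟨by nlinarith, by nlinarith, by nlinarith, by nlinarith⟩
  refine ⟨main.1, main.2.1, main.2.2.1, main.2.2.2, hu', ⟨by linarith, ?_⟩, ⟨?_, ?_⟩, hu'⟩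
  · linarith [H.hq₃, h.hρ₁]
  · have : 0 ≤ p := le_trans (by positivity) main.1
    have : 0 ≤ H.M * H.a := mul_nonneg M_pos.le ha.le
    linarith [h.hP]
  · have : H.M * q ≤ H.M * H.a := by
      have := M_pos (H := H)
      gcongr; linarith [h.hρ₁]
    linarith [h.hP, main.2.2.2]

structure Start (H : Layer) (k μ q p u : ℝ) : Prop where
  q_pos : 0 < q
  p_eq : p = q * (k * (H.a - q) + k * H.s k μ)
  u_eq : u = H.ua

theorem Traj.hasDerivAt_y {ε k μ P : ℝ} {q p u : ℝ → ℝ} (T : H.Traj ε k μ P q p u) {t : ℝ}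
    (ht : H.Box P (q t) (p t) (u t)) :
    HasDerivAt (fun t => p t - k * q t * (H.a - q t))
      (H.pdot k μ (q t) (p t) (u t) - k * (H.a - 2 * q t) * p t) t := by
  exact ((T.dp t ht).sub (((T.dq t ht).const_mul k).mul ((T.dq t ht).const_sub H.a))).congr_deriv
    (by ring)

theorem Traj.wedge {ε k μ P δ ρ₁ τ C : ℝ} {q p u : ℝ → ℝ} (T : H.Traj ε k μ P q p u)
    (h : H.WedgeHyp ε P δ ρ₁ τ C) (hs : |H.s k μ| ≤ δ) (h0 : H.Start k μ (q 0) (p 0) (u 0))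
    (hq0 : q 0 < H.a - ρ₁) :
    ∃ t₁ > 0, q t₁ = H.a - ρ₁ ∧ ∀ t ∈ Set.Icc 0 t₁, H.Wedge k ρ₁ τ C ε (q t) (p t) (u t) := by
  have hε := h.hε
  have hC := h.hC₀
  have hρ := h.hρ₁
  have hτ := h.hτ₀
  have hk := T.par
  have hk0 := hk.k_pos
  have ha := H.ha
  have hq00 := h0.q_pos
  have hcq := T.cq
  have hcp := T.cp
  have hcu := T.cu
  suffices hP : ∀ S, 0 ≤ S → (∀ t ∈ Set.Icc 0 S, q t ≤ H.a - ρ₁) → ∀ t ∈ Set.Icc 0 S,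
      q 0 / 2 ≤ q t ∧ H.Wedge k ρ₁ τ C ε (q t) (p t) (u t) by
    obtain ⟨t₁, ht₁, he, hall⟩ := reach_level (f := q) (V := q) (c := H.a - ρ₁)
      (κ := k * ρ₁ / 2 * (q 0 / 2)) (B := H.a - ρ₁) (s := 0)
      (P := fun t => q 0 / 2 ≤ q t ∧ H.Wedge k ρ₁ τ C ε (q t) (p t) (u t)) hcq (by positivity) hq0
      hP (fun t _ hw _ => by
        obtain ⟨e1, -, -, -, -, e2⟩ := hw.2.bounds h hk
        refine ⟨p t, le_trans ?_ e1, T.dq t e2⟩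
        gcongr; exact hw.1) (fun t _ _ h => h)
    exact ⟨t₁, ht₁, he, fun t ht => (hall t ht).2.2⟩
  intro S hS hqS
  have hw_of : ∀ t ∈ Set.Icc 0 S, (0 ≤ q t - q 0 / 2 ∧
      0 ≤ τ * q t - (p t - k * q t * (H.a - q t)) * (H.a - q t) ^ 3 ∧
      0 ≤ τ * q t + (p t - k * q t * (H.a - q t)) * (H.a - q t) ^ 3 ∧
      0 ≤ C * ε * q t - (u t - H.ua) ∧ 0 ≤ C * ε * q t + (u t - H.ua)) →
      H.Wedge k ρ₁ τ C ε (q t) (p t) (u t) := by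
    rintro t ht ⟨e0, e1, e2, e3, e4⟩
    have hc : 0 ≤ H.a - q t := by linarith [hqS t ht]
    refine ⟨by linarith, hqS t ht, ?_, abs_le.2 ⟨by linarith, by linarith⟩⟩
    rw [← abs_of_nonneg (pow_nonneg hc 3), ← abs_mul]
    exact abs_le.2 ⟨by linarith, by linarith⟩
  have key := barrier_pos (n := 5) ![fun t => q t - q 0 / 2,
    fun t => τ * q t - (p t - k * q t * (H.a - q t)) * (H.a - q t) ^ 3,
    fun t => τ * q t + (p t - k * q t * (H.a - q t)) * (H.a - q t) ^ 3,
    fun t => C * ε * q t - (u t - H.ua), fun t => C * ε * q t + (u t - H.ua)]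
    (s := 0) (T := S) ?_ ?_ ?_
  · intro t ht
    have := key t ht
    simp [Fin.forall_fin_succ] at this
    obtain ⟨e0, e1, e2, e3, e4⟩ := this
    exact ⟨by linarith,
      hw_of t ht ⟨by linarith, by linarith, by linarith, by linarith, by linarith⟩⟩
  · simp only [Fin.forall_fin_succ, Matrix.cons_val_zero, Matrix.cons_val_succ, IsEmpty.forall_iff,
      and_true]
    refine ⟨?_, ?_, ?_, ?_, ?_⟩ <;> exact Continuous.continuousOn (by fun_prop)
  · have hy0 : p 0 - k * q 0 * (H.a - q 0) = q 0 * (k * H.s k μ) := by rw [h0.p_eq]; ring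
    have hks : |k * H.s k μ| * (H.a - q 0) ^ 3 < τ := by
      refine lt_of_le_of_lt ?_ h.hstart
      rw [abs_mul, abs_of_pos hk0]
      have := hk.1.2
      have : 0 < H.a - q 0 := by linarith
      have : H.a - q 0 ≤ H.a := by linarith
      have := hk0.trans_le hk.1.2
      have := h.hδ
      gcongr
    have hks' : |k * H.s k μ * (H.a - q 0) ^ 3| < τ := by
      rwa [abs_mul, abs_of_pos (show 0 < (H.a - q 0) ^ 3 by
        have : 0 < H.a - q 0 := by linarith
        positivity)]
    obtain ⟨e1, e2⟩ := abs_lt.1 hks'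
    simp only [Fin.forall_fin_succ, Matrix.cons_val_zero, Matrix.cons_val_succ, IsEmpty.forall_iff,
      and_true]
    rw [hy0, h0.u_eq]
    have : 0 < C * ε * q 0 := by positivity
    exact ⟨by linarith, by nlinarith, by nlinarith, by linarith, by linarith⟩
  · intro t ht hall
    have ht' : t ∈ Set.Icc 0 S := Set.Ioc_subset_Icc_self ht
    simp only [Fin.forall_fin_succ, Matrix.cons_val_zero, Matrix.cons_val_succ, IsEmpty.forall_iff,
      and_true] at hall
    have hw := hw_of t ht' hall
    obtain ⟨e1, e1', e2, e3, hu, hbox⟩ := hw.bounds h hk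
    have hqt : 0 < q t := by linarith [hall.1]
    have dq := T.dq t hbox
    have du := T.du t hbox
    have dy := T.hasDerivAt_y hbox
    obtain ⟨-, hq1, hy, hun⟩ := hw
    obtain ⟨w, n, hp, hn⟩ := H.exists_blowup hqt.ne' k (p t) (u t)
    have hn' : |n| ≤ C * ε := abs_le_of_abs_mul_le hqt (by
      have : u t - H.ua = q t * n := by rw [hn]; ring
      rwa [this] at hun)
    have hyw : p t - k * q t * (H.a - q t) = q t * w := by rw [hp]; ring
    have dc3 : HasDerivAt (fun t => (p t - k * q t * (H.a - q t)) * (H.a - q t) ^ 3)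
        ((H.pdot k μ (q t) (p t) (u t) - k * (H.a - 2 * q t) * p t) * (H.a - q t) ^ 3 -
          3 * (q t * w) * (H.a - q t) ^ 2 * p t) t := by
      refine (dy.mul ((dq.const_sub H.a).pow 3)).congr_deriv ?_
      simp only [Pi.pow_apply, hyw]; push_cast; ring
    simp only [Fin.forall_fin_succ, Matrix.cons_val_zero, Matrix.cons_val_succ, IsEmpty.forall_iff,
      and_true]
    have hm : 4 < C * (w + k * (H.a - q t)) * H.d₀ := by
      have := h.hC
      have h1 : H.kl * ρ₁ / 2 ≤ w + k * (H.a - q t) := by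
        have : k * ρ₁ / 2 * q t ≤ (w + k * (H.a - q t)) * q t := by rw [hp] at e1; linarith
        have := le_of_mul_le_mul_right this hqt
        have : H.kl * ρ₁ ≤ k * ρ₁ := by gcongr; exact hk.1.1
        linarith
      have := H.hd₀
      calc 4 < C * (H.kl * ρ₁ / 2) * H.d₀ := by linarith
        _ ≤ _ := by gcongr
    refine ⟨fun _ => ⟨p t, lt_of_lt_of_le (by positivity) e1, dq.sub_const _⟩, fun hz => ?_,
      fun hz => ?_, fun hz => ?_, fun hz => ?_⟩
    · have hw1 : w * (H.a - q t) ^ 3 = τ := by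
        rw [hyw] at hz
        exact mul_left_cancel₀ hqt.ne' (by linarith)
      have := wedge_upper h hk hs hqt hq1 hw1 hn'
      rw [← hp, ← hn] at this
      refine ⟨_, this, ?_⟩
      exact ((dq.const_mul τ).sub dc3).congr_deriv (by ring)
    · have hw1 : -w * (H.a - q t) ^ 3 = τ := by
        rw [hyw] at hz
        exact mul_left_cancel₀ hqt.ne' (by linarith)
      have := wedge_lower h hk hs hqt hq1 hw1 hn'
      rw [← hp, ← hn] at this
      refine ⟨_, this, ?_⟩
      exact ((dq.const_mul τ).add dc3).congr_deriv (by ring)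
    · have hn1 : n = C * ε := mul_left_cancel₀ hqt.ne' (by linarith)
      have := (u_face hε hC hqt hu hn hm (μ := μ) (by rw [hn1, abs_of_pos (by positivity)])).1 hn1
      rw [← hp] at this
      exact ⟨_, this, (dq.const_mul _).sub (du.sub_const _)⟩
    · have hn1 : n = -(C * ε) := mul_left_cancel₀ hqt.ne' (by linarith)
      have := (u_face hε hC hqt hu hn hm (μ := μ)
        (by rw [hn1, abs_neg, abs_of_pos (by positivity)])).2 hn1
      rw [← hp] at this
      exact ⟨_, this, (dq.const_mul _).add (du.sub_const _)⟩

end Layer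

namespace Layer
variable (H : Layer)

def A₀ : ℝ := H.α H.kl * H.ω₀ * H.ζ₀
def A₁ : ℝ := H.α H.kh * H.ω₁ * H.ζ₁
def B₁ : ℝ := H.α H.kh * H.cm
/-- Bound for the slow vector field `G`. -/
def Cg : ℝ := (2 * H.c₁ + 4 * H.q₃) / H.d₀
/-- Bound for the error terms in the equation for `Y`. -/
def Ce : ℝ := H.B₁ + 2 * |H.z₂| / H.ζ₀ + 4 / (H.d₀ * H.ζ₀) + (H.c₁ + 2 * H.q₃ + H.Cg) / H.d₀

variable {H}

theorem q₃_pos : 0 < H.q₃ := H.ha.trans H.hq₃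

theorem A₀_pos : 0 < H.A₀ := mul_pos (mul_pos (H.α_pos H.hkl) H.hω₀) H.hζ₀

theorem Cg_pos : 0 < H.Cg := by
  have := H.hc₁
  have := H.q₃_pos
  have := H.hd₀
  unfold Cg; positivity

theorem α_kl_le {k μ : ℝ} (h : H.Par k μ) : H.α H.kl ≤ H.α k := by
  have h0 := h.k_pos
  have h1 := h.1.1
  have := H.hR
  have := H.hkl
  unfold α; gcongr

theorem abs_B_le {k μ u : ℝ} (h : H.Par k μ) (hu : u ∈ Set.Icc H.ulo H.uhi) :
    |H.α k * (u + μ)| ≤ H.B₁ := by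
  have h0 := H.α_pos h.k_pos
  have h2 := H.α_le h
  have h3 := H.hcm u hu μ h.2
  rw [abs_mul, abs_of_pos h0]
  have := h0.trans_le h2
  unfold B₁; gcongr

theorem B₁_nonneg {k μ u : ℝ} (h : H.Par k μ) (hu : u ∈ Set.Icc H.ulo H.uhi) : 0 ≤ H.B₁ :=
  (abs_nonneg _).trans (abs_B_le h hu)

theorem abs_G_le {q u : ℝ} (hu : u ∈ Set.Icc H.ulo H.uhi) (hq : 0 ≤ q) (hq' : q ≤ H.q₃) (μ : ℝ) :
    |H.G q u μ| ≤ H.Cg := by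
  have h0 := H.den_pos u μ
  have h1 := H.abs_gn_le_const hu hq hq'
  have h2 := H.d₀_le_den u μ
  have := H.hd₀
  unfold G Cg
  rw [abs_div, abs_of_pos h0]
  have : 0 ≤ 2 * H.c₁ + 4 * H.q₃ := (abs_nonneg _).trans h1
  gcongr

theorem Traj.hasDerivAt_Z {ε k μ P : ℝ} {q p u : ℝ → ℝ} (T : H.Traj ε k μ P q p u) {t : ℝ}
    (ht : H.Box P (q t) (p t) (u t)) :
    HasDerivAt (fun t => H.Z (q t) (u t)) (H.Y ε μ (q t) (p t) (u t)) t := by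
  have h1 := T.dq t ht
  have h2 := T.du t ht
  refine (((((h1.pow 2).const_mul H.z₂).add (h1.const_mul H.z₁)).add_const H.z₀).sub
    (h2.const_mul H.ν)).congr_deriv ?_
  unfold Y dZ
  simp only [Nat.cast_ofNat, Nat.add_one_sub_one, pow_one]
  ring

theorem Traj.hasDerivAt_G {ε k μ P : ℝ} {q p u : ℝ → ℝ} (T : H.Traj ε k μ P q p u) {t : ℝ}
    (ht : H.Box P (q t) (p t) (u t)) (hq : 0 ≤ q t) (hq' : q t ≤ H.q₃) :
    ∃ g₁ g₂, |g₁| ≤ 4 / H.d₀ ∧ |g₂| ≤ (H.c₁ + 2 * H.q₃ + H.Cg) / H.d₀ ∧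
      HasDerivAt (fun t => H.G (q t) (u t) μ)
        (g₁ * p t + g₂ * (ε * H.G (q t) (u t) μ)) t := by
  have h1 := T.dq t ht
  have h2 := T.du t ht
  have hu := ht.2.2
  have hd := H.den_pos (u t) μ
  have hdd := H.d₀_le_den (u t) μ
  have hd₀ := H.hd₀
  have hden := H.den_eq T.par hu
  have hG := H.abs_G_le hu hq hq' μ
  refine ⟨2 * H.σ * (1 - u t) / H.den (u t) μ,
    (-H.c₁ - 2 * H.σ * q t - H.G (q t) (u t) μ) / H.den (u t) μ, ?_, ?_, ?_⟩
  · have : |2 * H.σ * (1 - u t)| ≤ 4 := by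
      have : |1 - u t| ≤ 2 :=
        abs_le.2 ⟨by linarith [hu.2, H.huhi], by linarith [hu.1, H.hulo]⟩
      have h5 := H.hσ
      rw [abs_mul, abs_mul, abs_two]
      nlinarith [abs_nonneg H.σ, abs_nonneg (1 - u t)]
    rw [abs_div, abs_of_pos hd]
    gcongr
  · rw [abs_div, abs_of_pos hd]
    have : |-H.c₁ - 2 * H.σ * q t - H.G (q t) (u t) μ| ≤ H.c₁ + 2 * H.q₃ + H.Cg := by
      refine (abs_sub _ _).trans ?_
      have : |-H.c₁ - 2 * H.σ * q t| ≤ H.c₁ + 2 * H.q₃ := by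
        refine (abs_sub _ _).trans ?_
        rw [abs_neg, abs_of_nonneg H.hc₁, abs_mul, abs_mul, abs_two, abs_of_nonneg hq]
        have := H.hσ
        nlinarith [abs_nonneg H.σ]
      linarith
    have := (abs_nonneg _).trans this
    gcongr
  · have hev : (fun t => H.G (q t) (u t) μ) =ᶠ[𝓝 t]
        fun t => H.gn (q t) (u t) / (u t + H.ζ + μ) := by
      have : ∀ᶠ s in 𝓝 t, H.d₀ < u s + H.ζ + μ := by
        refine ContinuousAt.eventually_lt (by fun_prop) ?_ (H.hden _ hu μ T.par.2).1
        exact ((T.cu.add_const _).add_const _).continuousAt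
      filter_upwards [this] with s hs
      unfold G den
      rw [max_eq_right hs.le]
    refine HasDerivAt.congr_of_eventuallyEq ?_ hev
    have hne : u t + H.ζ + μ ≠ 0 := by rw [← hden]; exact hd.ne'
    refine HasDerivAt.congr_deriv ((((h2.sub_const H.ua).const_mul (-H.c₁)).add
      ((h1.const_mul (2 * H.σ)).mul (h2.const_sub 1))).div
      ((h2.add_const H.ζ).add_const μ) hne) ?_
    unfold G gn
    rw [hden]
    field_simp
    simp only [Pi.add_apply, Pi.mul_apply]
    ring

theorem Traj.abs_p_le {ε μ q p u : ℝ} (hε : 0 ≤ ε)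
    (hq : q ∈ Set.Icc H.q₂ H.q₃) :
    H.ζ₀ * |p| ≤ |H.Y ε μ q p u| + ε * |H.G q u μ| := by
  have h1 := (H.hζ q hq).1
  have h0 := H.hζ₀
  have h2 : H.dZ q * p = H.Y ε μ q p u + H.ν * ε * H.G q u μ := by unfold Y; ring
  have h3 : |H.dZ q * p| ≤ |H.Y ε μ q p u| + ε * |H.G q u μ| := by
    rw [h2]
    refine (abs_add_le _ _).trans ?_
    rw [abs_mul, abs_mul, abs_of_nonneg H.hν₀, abs_of_nonneg hε]
    have := H.hν₁
    have : H.ν * ε * |H.G q u μ| ≤ 1 * ε * |H.G q u μ| := by gcongr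
    linarith
  refine le_trans ?_ h3
  rw [abs_mul]
  have : H.ζ₀ ≤ |H.dZ q| := h1.trans (le_abs_self _)
  gcongr

theorem Traj.hasDerivAt_Y {ε k μ P : ℝ} {q p u : ℝ → ℝ} (T : H.Traj ε k μ P q p u) {t : ℝ}
    (hε : 0 ≤ ε) (hε1 : ε ≤ 1) (ht : H.Box P (q t) (p t) (u t)) (hq : q t ∈ Set.Icc H.q₂ H.q₃)
    (hp : |p t| ≤ 1) :
    ∃ E, |E| ≤ H.Ce * (|p t| + ε) * |H.Y ε μ (q t) (p t) (u t)| +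
        H.Ce * ε * |H.G (q t) (u t) μ| ∧
      HasDerivAt (fun t => H.Y ε μ (q t) (p t) (u t))
        (H.α k * H.ω (q t) (u t) * H.dZ (q t) * H.Z (q t) (u t) +
          H.α k * (u t + μ) * H.Y ε μ (q t) (p t) (u t) + E) t := by
  have hq0 : 0 ≤ q t := H.q₂_pos.le.trans hq.1
  obtain ⟨g₁, g₂, hg₁, hg₂, dG⟩ := T.hasDerivAt_G ht hq0 hq.2
  have h1 := T.dq t ht
  have h2 := T.dp t ht
  have hB := abs_B_le T.par ht.2.2
  have hB0 := B₁_nonneg T.par ht.2.2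
  have hpY := Traj.abs_p_le (H := H) (μ := μ) (p := p t) (u := u t) hε hq
  have hζ₀ := H.hζ₀
  have hd₀ := H.hd₀
  have hν₀ := H.hν₀
  have hν₁ := H.hν₁
  set y := H.Y ε μ (q t) (p t) (u t) with hy
  set g := H.G (q t) (u t) μ with hg
  refine ⟨H.α k * (u t + μ) * H.ν * ε * g + 2 * H.z₂ * p t ^ 2 -
    H.ν * ε * (g₁ * p t + g₂ * (ε * g)), ?_, ?_⟩
  · have hp' : |p t| ≤ (|y| + ε * |g|) / H.ζ₀ := by rw [le_div_iff₀ hζ₀]; linarith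
    have e1 : |H.α k * (u t + μ) * H.ν * ε * g| ≤ H.B₁ * (ε * |g|) := by
      rw [abs_mul, abs_mul, abs_mul, abs_of_nonneg hν₀, abs_of_nonneg hε]
      calc |H.α k * (u t + μ)| * H.ν * ε * |g| ≤ H.B₁ * 1 * ε * |g| := by gcongr
        _ = _ := by ring
    have e2 : |2 * H.z₂ * p t ^ 2| ≤ 2 * |H.z₂| / H.ζ₀ * (|p t| * |y| + ε * |g|) := by
      rw [abs_mul, abs_mul, abs_two, abs_pow]
      calc 2 * |H.z₂| * |p t| ^ 2 = 2 * |H.z₂| * (|p t| * |p t|) := by ring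
        _ ≤ 2 * |H.z₂| * (|p t| * ((|y| + ε * |g|) / H.ζ₀)) := by gcongr
        _ = 2 * |H.z₂| / H.ζ₀ * (|p t| * |y| + |p t| * (ε * |g|)) := by ring
        _ ≤ 2 * |H.z₂| / H.ζ₀ * (|p t| * |y| + 1 * (ε * |g|)) := by gcongr
        _ = _ := by ring
    have e3 : |g₁ * p t| ≤ 4 / (H.d₀ * H.ζ₀) * (|y| + |g|) := by
      rw [abs_mul]
      calc |g₁| * |p t| ≤ 4 / H.d₀ * ((|y| + ε * |g|) / H.ζ₀) := by gcongr
        _ ≤ 4 / H.d₀ * ((|y| + 1 * |g|) / H.ζ₀) := by gcongr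
        _ = _ := by field_simp
    have e4 : |g₂ * (ε * g)| ≤ (H.c₁ + 2 * H.q₃ + H.Cg) / H.d₀ * |g| := by
      rw [abs_mul, abs_mul, abs_of_nonneg hε]
      have := (abs_nonneg _).trans hg₂
      calc |g₂| * (ε * |g|) ≤ (H.c₁ + 2 * H.q₃ + H.Cg) / H.d₀ * (1 * |g|) := by gcongr
        _ = _ := by ring
    have e5 : |H.ν * ε * (g₁ * p t + g₂ * (ε * g))| ≤ ε * (4 / (H.d₀ * H.ζ₀) * (|y| + |g|) +
        (H.c₁ + 2 * H.q₃ + H.Cg) / H.d₀ * |g|) := by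
      rw [abs_mul, abs_mul, abs_of_nonneg hν₀, abs_of_nonneg hε]
      calc H.ν * ε * |g₁ * p t + g₂ * (ε * g)| ≤ 1 * ε * (|g₁ * p t| + |g₂ * (ε * g)|) := by
            gcongr; exact abs_add_le _ _
        _ ≤ 1 * ε * (4 / (H.d₀ * H.ζ₀) * (|y| + |g|) +
            (H.c₁ + 2 * H.q₃ + H.Cg) / H.d₀ * |g|) := by gcongr
        _ = _ := by ring
    have e6 := (abs_sub (H.α k * (u t + μ) * H.ν * ε * g + 2 * H.z₂ * p t ^ 2)
      (H.ν * ε * (g₁ * p t + g₂ * (ε * g)))).trans (add_le_add_left (abs_add_le _ _) _)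
    have n1 : 0 ≤ 2 * |H.z₂| / H.ζ₀ := by positivity
    have n2 : 0 ≤ 4 / (H.d₀ * H.ζ₀) := by positivity
    have n3 : 0 ≤ (H.c₁ + 2 * H.q₃ + H.Cg) / H.d₀ := (abs_nonneg _).trans hg₂
    unfold Ce
    set c2 := 2 * |H.z₂| / H.ζ₀
    set c3 := 4 / (H.d₀ * H.ζ₀)
    set c4 := (H.c₁ + 2 * H.q₃ + H.Cg) / H.d₀
    have m1 : 0 ≤ |p t| * |y| := by positivity
    have m2 : 0 ≤ ε * |y| := by positivity
    have m3 : 0 ≤ ε * |g| := by positivity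
    have k1 := mul_nonneg hB0 m1
    have k2 := mul_nonneg hB0 m2
    have k4 := mul_nonneg n1 m2
    have k6 := mul_nonneg n2 m1
    have k8 := mul_nonneg n3 m1
    have k9 := mul_nonneg n3 m2
    linarith
  · refine (((((h1.const_mul (2 * H.z₂)).add_const H.z₁).mul h2)).sub
      (dG.const_mul (H.ν * ε))).congr_deriv ?_
    have hF : H.F (q t) (u t) = -H.ω (q t) (u t) * H.Z (q t) (u t) := H.hF _ _
    unfold pdot
    rw [hF, hy]
    unfold Y dZ
    ring

end Layer

theorem HasDerivAt.eventually_gt {f : ℝ → ℝ} {d t : ℝ} (h : HasDerivAt f d t) (hd : 0 < d) :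
    ∀ᶠ s in 𝓝[>] t, f t < f s := by
  have h1 : ∀ᶠ s in 𝓝[≠] t, 0 < slope f t s := h.tendsto_slope.eventually (lt_mem_nhds hd)
  filter_upwards [h1.filter_mono (nhdsWithin_mono t fun x (hx : t < x) => hx.ne'),
    self_mem_nhdsWithin] with s hs hts
  have hts : 0 < s - t := sub_pos.2 hts
  rw [slope_def_field] at hs
  exact sub_pos.1 (pos_of_mul_pos_left (by rwa [div_eq_mul_inv] at hs) (by positivity))

namespace Layer
variable (H : Layer)

/-- Smallness conditions for the isolating block around the slow manifold. -/
structure BlockHyp (ε P ρ η L zs : ℝ) : Prop where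
  hε : 0 < ε
  hε1 : ε ≤ 1
  hP : 1 ≤ P
  hρ : 0 < ρ
  hρ₀ : ρ ≤ H.ρ₀
  hzs : H.Ce * H.Cg < H.A₀ * zs
  hzρ : zs * ε ≤ ρ
  hL : H.B₁ + 2 * H.Ce + H.A₁ + 1 ≤ L
  hη : 2 * L * ρ + ε * H.Cg ≤ H.ζ₀ * η
  hη1 : η ≤ 1
  hA : (H.Ce * (η + ε)) ^ 2 ≤ H.A₀ / 4
  hεA : ε * (((H.Ce + 1) * (H.C₀ / H.d₀)) ^ 2 / (H.c₀ / H.d₁) + 2 * H.Ce * (H.C₀ / H.d₀) +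
    H.α H.kh * H.Cg) ≤ H.A₀ / 2
  huhi : H.C₀ * ρ < H.c₀ * (H.uhi - H.uT)
  hulo : H.C₀ * ρ < H.c₀ * (H.uT - H.ulo)

/-- The closed isolating block. -/
def Blk (L ρ ε μ q p u : ℝ) : Prop :=
  q ∈ Set.Icc H.q₂ H.q₃ ∧ u ∈ Set.Icc H.ulo H.uhi ∧ |H.Z q u| ≤ ρ ∧ |H.Y ε μ q p u| ≤ 2 * L * ρ

/-- The closed exit region on the side `s = ±1`. -/
def Touch (L zs ε μ s q p u : ℝ) : Prop :=
  H.q₂ ≤ q ∧ 0 ≤ s * H.Y ε μ q p u ∧ L * (zs * ε) ≤ s * (H.Y ε μ q p u + L * H.Z q u)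

/-- The open exit region on the side `s = ±1`. -/
def Exit (L zs ε μ s q p u : ℝ) : Prop :=
  H.q₂ < q ∧ 0 < s * H.Y ε μ q p u ∧ L * (zs * ε) < s * (H.Y ε μ q p u + L * H.Z q u)

variable {H}

theorem Ce_nonneg (h : 0 ≤ H.B₁) : 0 ≤ H.Ce := by
  have := H.hd₀
  have := H.hζ₀
  have := H.hc₁
  have := H.q₃_pos
  have := H.Cg_pos
  unfold Ce; positivity

theorem continuous_G (μ : ℝ) : Continuous fun x : ℝ × ℝ × ℝ => H.G x.1 x.2.2 μ := by
  unfold G gn den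
  refine Continuous.div (by fun_prop) (by fun_prop) fun x => ?_
  exact (H.den_pos x.2.2 μ).ne'

theorem continuous_Z : Continuous fun x : ℝ × ℝ × ℝ => H.Z x.1 x.2.2 := by
  unfold Z; fun_prop

theorem continuous_Y (ε μ : ℝ) : Continuous fun x : ℝ × ℝ × ℝ => H.Y ε μ x.1 x.2.1 x.2.2 := by
  have := H.continuous_G μ
  unfold Y dZ; fun_prop

theorem Traj.continuous {ε k μ P : ℝ} {q p u : ℝ → ℝ} (T : H.Traj ε k μ P q p u) :
    Continuous fun t => (q t, p t, u t) := T.cq.prodMk (T.cp.prodMk T.cu)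

theorem Traj.cY {ε k μ P : ℝ} {q p u : ℝ → ℝ} (T : H.Traj ε k μ P q p u) :
    Continuous fun t => H.Y ε μ (q t) (p t) (u t) := (H.continuous_Y ε μ).comp T.continuous

theorem Traj.cZ {ε k μ P : ℝ} {q p u : ℝ → ℝ} (T : H.Traj ε k μ P q p u) :
    Continuous fun t => H.Z (q t) (u t) := H.continuous_Z.comp T.continuous

section block
variable {ε k μ P ρ η L zs : ℝ} {q p u : ℝ → ℝ}

theorem BlockHyp.abs_p_le (h : H.BlockHyp ε P ρ η L zs) {q p u : ℝ}
    (hb : H.Blk L ρ ε μ q p u) : |p| ≤ η := by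
  have h1 := Traj.abs_p_le (H := H) (μ := μ) (p := p) (u := u) h.hε.le hb.1
  have h2 := H.abs_G_le hb.2.1 (H.q₂_pos.le.trans hb.1.1) hb.1.2 μ
  have h3 := h.hη
  have : ε * |H.G q u μ| ≤ ε * H.Cg := by
    have := h.hε
    gcongr
  exact le_of_mul_le_mul_left (by linarith [hb.2.2.2]) H.hζ₀

theorem BlockHyp.box (h : H.BlockHyp ε P ρ η L zs) {q p u : ℝ}
    (hb : H.Blk L ρ ε μ q p u) : H.Box P q p u := by
  have h1 := h.abs_p_le hb
  have h2 := h.hη1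
  have h3 := h.hP
  have := H.q₂_pos
  exact ⟨⟨by linarith [hb.1.1], by linarith [hb.1.2]⟩, abs_le.1 (by linarith), hb.2.1⟩

theorem A_bounds (hk : H.Par k μ) {q u : ℝ} (hq : q ∈ Set.Icc H.q₂ H.q₃)
    (hu : u ∈ Set.Icc H.ulo H.uhi) (hZ : |H.Z q u| ≤ H.ρ₀) :
    H.A₀ ≤ H.α k * H.ω q u * H.dZ q ∧ H.α k * H.ω q u * H.dZ q ≤ H.A₁ := by
  have h1 := H.hω q hq u hu hZ
  have h2 := H.hζ q hq
  have h3 := H.α_le hk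
  have h4 := α_kl_le hk
  have := H.α_pos H.hkl
  have := H.α_pos hk.k_pos
  have := H.hω₀
  have := H.hζ₀
  have : 0 < H.ω q u := by linarith
  have : 0 < 2 * H.z₂ * q + H.z₁ := by linarith
  unfold A₀ A₁ dZ
  constructor
  · gcongr
    · exact h1.1
    · exact h2.1
  · have : 0 < H.α H.kh := by linarith
    have : 0 ≤ H.ω₁ := by linarith
    gcongr
    · exact h1.2
    · exact h2.2

theorem BlockHyp.L_pos (h : H.BlockHyp ε P ρ η L zs) (hk : H.Par k μ) {q p u : ℝ}
    (hb : H.Blk L ρ ε μ q p u) : 1 ≤ L := by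
  have h1 := A_bounds hk hb.1 hb.2.1 (hb.2.2.1.trans h.hρ₀)
  have h2 := H.A₀_pos
  have h3 := B₁_nonneg hk hb.2.1
  have := Ce_nonneg h3
  have := h.hL
  linarith [h1.1.trans h1.2]

theorem Traj.enter (T : H.Traj ε k μ P q p u) (h : H.BlockHyp ε P ρ η L zs) {s t : ℝ}
    (hs : s = 1 ∨ s = -1) (hb : H.Blk L ρ ε μ (q t) (p t) (u t))
    (ht : H.Touch L zs ε μ s (q t) (p t) (u t)) :
    ∀ᶠ t' in 𝓝[>] t, H.Exit L zs ε μ s (q t') (p t') (u t') := by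
  have hbox := h.box hb
  have hpη := h.abs_p_le hb
  have hp1 := hpη.trans h.hη1
  have hε := h.hε
  obtain ⟨E, hE, dY⟩ := T.hasDerivAt_Y h.hε.le h.hε1 hbox hb.1 hp1
  have dZ := T.hasDerivAt_Z hbox
  have hL1 := h.L_pos T.par hb
  have hB := B₁_nonneg T.par hb.2.1
  have hCe := Ce_nonneg hB
  have hBb := abs_B_le T.par hb.2.1
  have hG := H.abs_G_le hb.2.1 (H.q₂_pos.le.trans hb.1.1) hb.1.2 μ
  obtain ⟨hA0, hA1⟩ := A_bounds T.par hb.1 hb.2.1 (hb.2.2.1.trans h.hρ₀)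
  have hAp := H.A₀_pos
  have hss : s * s = 1 := by rcases hs with rfl | rfl <;> norm_num
  have hsa : |s| = 1 := by rcases hs with rfl | rfl <;> norm_num
  obtain ⟨-, t2, t3⟩ := ht
  have hq : H.q₂ < q t := (H.hq _ hb.1 _ hb.2.1 (hb.2.2.1.trans h.hρ₀)).1
  have cY := T.cY
  have cZ := T.cZ
  set A := H.α k * H.ω (q t) (u t) * H.dZ (q t) with hA
  set B := H.α k * (u t + μ) with hBdef
  have hzs := h.hzs
  have hCg : H.Ce * ε * |H.G (q t) (u t) μ| ≤ H.Ce * ε * H.Cg := by gcongr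
  have hsE : -|E| ≤ s * E := by
    have := neg_abs_le (s * E); rwa [abs_mul, hsa, one_mul] at this
  have evq : ∀ᶠ t' in 𝓝[>] t, H.q₂ < q t' :=
    (T.cq.tendsto t).mono_left nhdsWithin_le_nhds |>.eventually (lt_mem_nhds hq)
  have dsY := dY.const_mul s
  have dsW := (dY.add (dZ.const_mul L)).const_mul s
  have yabs : |H.Y ε μ (q t) (p t) (u t)| = s * H.Y ε μ (q t) (p t) (u t) := by
    rw [← abs_of_nonneg t2, abs_mul, hsa, one_mul]
  set y := H.Y ε μ (q t) (p t) (u t) with hy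
  set z := H.Z (q t) (u t) with hz
  rcases t2.eq_or_lt with t2 | t2
  · have hy0 : y = 0 := by
      have : |y| = 0 := by rw [yabs, ← t2]
      exact abs_eq_zero.1 this
    have hsz : zs * ε ≤ s * z := by
      rw [hy0, zero_add] at t3
      have : L * (zs * ε) ≤ L * (s * z) := by linarith
      exact le_of_mul_le_mul_left this (by linarith)
    have pos : 0 < s * (A * z + B * y + E) := by
      have e1 : A * (zs * ε) ≤ A * (s * z) := by
        gcongr; linarith
      have hzs0 : 0 < zs := by
        have : 0 < H.A₀ * zs := lt_of_le_of_lt (mul_nonneg hCe H.Cg_pos.le) hzs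
        exact pos_of_mul_pos_right this hAp.le
      have e2 : H.A₀ * (zs * ε) ≤ A * (zs * ε) := by gcongr
      rw [hy0]
      rw [hy0, abs_zero, mul_zero, zero_add] at hE
      have e3 : H.Ce * H.Cg * ε < H.A₀ * zs * ε := by gcongr
      nlinarith
    have pos2 : 0 < s * (A * z + B * y + E + L * y) := by rw [hy0] at pos ⊢; linarith
    filter_upwards [evq, dsY.eventually_gt pos, dsW.eventually_gt pos2] with t' h1 h2 h3
    refine ⟨h1, ?_, ?_⟩
    · rw [← hy, hy0, mul_zero] at h2; exact h2
    · exact t3.trans_lt h3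
  · have evY : ∀ᶠ t' in 𝓝[>] t, 0 < s * H.Y ε μ (q t') (p t') (u t') :=
      ((continuous_const.mul cY).tendsto t).mono_left nhdsWithin_le_nhds |>.eventually
        (lt_mem_nhds t2)
    rcases t3.eq_or_lt with t3 | t3
    · have hsz : L * (s * z) = L * (zs * ε) - s * y := by linarith
      have pos2 : 0 < s * (A * z + B * y + E + L * y) := by
        have hA1' : 0 ≤ H.A₁ := by linarith
        have e0 : s * z = zs * ε - s * y / L := by
          have : L ≠ 0 := by linarith
          field_simp; linarith
        have e1 : H.A₀ * (zs * ε) - H.A₁ * (s * y) ≤ A * (s * z) := by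
          have hzs0 : 0 < zs := by
            have : 0 < H.A₀ * zs := lt_of_le_of_lt (mul_nonneg hCe H.Cg_pos.le) hzs
            exact pos_of_mul_pos_right this hAp.le
          have e2 : H.A₀ * (zs * ε) ≤ A * (zs * ε) := by gcongr
          have e3 : A * (s * y / L) ≤ H.A₁ * (s * y) := by
            have : s * y / L ≤ s * y := div_le_self t2.le hL1
            gcongr
          rw [e0, mul_sub]; linarith
        have e2 : -(H.B₁ * (s * y)) ≤ B * (s * y) := by
          have : -H.B₁ ≤ B := (abs_le.1 hBb).1
          have := mul_le_mul_of_nonneg_right this t2.le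
          linarith
        have e3 : |E| ≤ H.Ce * 2 * (s * y) + H.Ce * ε * H.Cg := by
          refine hE.trans (add_le_add ?_ hCg)
          rw [yabs]
          have := h.hε1
          gcongr
          linarith
        have e4 : (H.B₁ + 2 * H.Ce + H.A₁ + 1) * (s * y) ≤ L * (s * y) := by
          have := h.hL
          gcongr
        have e5 : H.Ce * H.Cg * ε < H.A₀ * zs * ε := by gcongr
        nlinarith
      filter_upwards [evq, evY, dsW.eventually_gt pos2] with t' h1 h2 h3
      exact ⟨h1, h2, t3.trans_lt h3⟩
    · have : ∀ᶠ t' in 𝓝[>] t, L * (zs * ε) <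
          s * (H.Y ε μ (q t') (p t') (u t') + L * H.Z (q t') (u t')) :=
        ((continuous_const.mul (cY.add (continuous_const.mul cZ))).tendsto t).mono_left
          nhdsWithin_le_nhds |>.eventually (lt_mem_nhds t3)
      filter_upwards [evq, evY, this] with t' h1 h2 h3
      exact ⟨h1, h2, h3⟩

/-- Outside both exit regions `|Y|` is controlled by `|Z|`. -/
theorem abs_Y_le_of_not_touch {L zs ε μ q p u ρ : ℝ} (hL : 0 < L) (hq : H.q₂ ≤ q)
    (hz : zs * ε ≤ ρ) (hZ : |H.Z q u| ≤ ρ) (h1 : ¬H.Touch L zs ε μ 1 q p u)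
    (h2 : ¬H.Touch L zs ε μ (-1) q p u) : |H.Y ε μ q p u| ≤ 2 * L * ρ := by
  obtain ⟨z1, z2⟩ := abs_le.1 hZ
  have e1 : L * (-ρ) ≤ L * H.Z q u := by gcongr
  have e2 : L * H.Z q u ≤ L * ρ := by gcongr
  have e3 : L * (zs * ε) ≤ L * ρ := by gcongr
  unfold Touch at h1 h2
  push Not at h1 h2
  have h1 := h1 hq
  have h2 := h2 hq
  rw [abs_le]
  constructor
  · by_contra! hc
    have : 0 ≤ -1 * H.Y ε μ q p u := by nlinarith
    linarith [h2 this]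
  · by_contra! hc
    have : 0 ≤ 1 * H.Y ε μ q p u := by nlinarith
    linarith [h1 this]

theorem Traj.stay (T : H.Traj ε k μ P q p u) (h : H.BlockHyp ε P ρ η L zs) {t₁ S : ℝ}
    (hL : 0 < L) (hq : H.q₂ < q t₁) (hq' : q t₁ < H.q₃) (hZ : |H.Z (q t₁) (u t₁)| < ρ)
    (hu : u t₁ ∈ Set.Ioo H.ulo H.uhi)
    (hT : ∀ t ∈ Set.Icc t₁ S, ¬H.Touch L zs ε μ 1 (q t) (p t) (u t) ∧
      ¬H.Touch L zs ε μ (-1) (q t) (p t) (u t)) :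
    ∀ t ∈ Set.Icc t₁ S, H.Blk L ρ ε μ (q t) (p t) (u t) := by
  have cq := T.cq
  have cu := T.cu
  have cZ := T.cZ
  have hblk : ∀ t ∈ Set.Icc t₁ S, 0 ≤ q t - H.q₂ → 0 ≤ H.q₃ - q t → 0 ≤ ρ - H.Z (q t) (u t) →
      0 ≤ ρ + H.Z (q t) (u t) → 0 ≤ H.uhi - u t → 0 ≤ u t - H.ulo →
      H.Blk L ρ ε μ (q t) (p t) (u t) := by
    intro t ht e1 e2 e3 e4 e5 e6
    have hZ' : |H.Z (q t) (u t)| ≤ ρ := abs_le.2 ⟨by linarith, by linarith⟩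
    exact ⟨⟨by linarith, by linarith⟩, ⟨by linarith, by linarith⟩, hZ',
      abs_Y_le_of_not_touch hL (by linarith) h.hzρ hZ' (hT t ht).1 (hT t ht).2⟩
  have key := barrier_pos (n := 6) ![fun t => q t - H.q₂, fun t => H.q₃ - q t,
    fun t => ρ - H.Z (q t) (u t), fun t => ρ + H.Z (q t) (u t),
    fun t => H.uhi - u t, fun t => u t - H.ulo] (s := t₁) (T := S) ?_ ?_ ?_
  · intro t ht
    have := key t ht
    simp only [Fin.forall_fin_succ, Matrix.cons_val_zero, Matrix.cons_val_succ, IsEmpty.forall_iff,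
      and_true] at this
    obtain ⟨e1, e2, e3, e4, e5, e6⟩ := this
    exact hblk t ht e1.le e2.le e3.le e4.le e5.le e6.le
  · simp only [Fin.forall_fin_succ, Matrix.cons_val_zero, Matrix.cons_val_succ, IsEmpty.forall_iff,
      and_true]
    refine ⟨?_, ?_, ?_, ?_, ?_, ?_⟩ <;> exact Continuous.continuousOn (by fun_prop)
  · obtain ⟨z1, z2⟩ := abs_lt.1 hZ
    simp only [Fin.forall_fin_succ, Matrix.cons_val_zero, Matrix.cons_val_succ, IsEmpty.forall_iff,
      and_true]
    exact ⟨by linarith, by linarith, by linarith, by linarith, by linarith [hu.2],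
      by linarith [hu.1]⟩
  · intro t ht hall
    have ht' := Set.Ioc_subset_Icc_self ht
    simp only [Fin.forall_fin_succ, Matrix.cons_val_zero, Matrix.cons_val_succ, IsEmpty.forall_iff,
      and_true] at hall
    obtain ⟨e1, e2, e3, e4, e5, e6⟩ := hall
    have hb := hblk t ht' e1 e2 e3 e4 e5 e6
    have hbox := h.box hb
    have hint := H.hq _ hb.1 _ hb.2.1 (hb.2.2.1.trans h.hρ₀)
    have dZ := T.hasDerivAt_Z hbox
    have du := T.du t hbox
    obtain ⟨n1, n2⟩ := hT t ht'
    have hzL : L * (zs * ε) ≤ L * ρ := by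
      have := h.hzρ
      gcongr
    obtain ⟨sl, -, -⟩ := H.hslow _ hb.1 _ hb.2.1
    have hden := H.den_pos (u t) μ
    have hZle : H.C₀ * |H.Z (q t) (u t)| * |u t - H.uT| ≤ H.C₀ * ρ * |u t - H.uT| := by
      have := H.hC₀
      have := hb.2.2.1
      gcongr
    have hsl := sl.trans (add_le_add_right hZle _)
    have hε := h.hε
    simp only [Fin.forall_fin_succ, Matrix.cons_val_zero, Matrix.cons_val_succ, IsEmpty.forall_iff,
      and_true]
    refine ⟨fun hz => absurd hz (by linarith [hint.1]), fun hz => absurd hz (by linarith [hint.2]),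
      fun hz => ?_, fun hz => ?_, fun hz => ?_, fun hz => ?_⟩
    · have : H.Y ε μ (q t) (p t) (u t) < 0 := by
        by_contra! hc
        refine n1 ⟨hb.1.1, by linarith, ?_⟩
        rw [show H.Z (q t) (u t) = ρ by linarith]; linarith
      exact ⟨_, neg_pos.2 this, dZ.const_sub ρ⟩
    · have : 0 < H.Y ε μ (q t) (p t) (u t) := by
        by_contra! hc
        refine n2 ⟨hb.1.1, by linarith, ?_⟩
        rw [show H.Z (q t) (u t) = -ρ by linarith]; linarith
      exact ⟨_, this, dZ.const_add ρ⟩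
    · have hv : 0 < u t - H.uT := by linarith [H.huT.2]
      have hg : H.gn (q t) (u t) < 0 := by
        rw [abs_of_pos hv] at hsl
        have := h.huhi
        have h7 : (u t - H.uT) * H.gn (q t) (u t) < 0 := by
          refine lt_of_le_of_lt hsl ?_
          rw [show H.uhi = u t by linarith] at this
          nlinarith
        exact neg_of_mul_neg_right h7 hv.le
      have : H.G (q t) (u t) μ < 0 := div_neg_of_neg_of_pos hg hden
      exact ⟨_, neg_pos.2 (mul_neg_of_pos_of_neg hε this), du.const_sub _⟩
    · have hv : u t - H.uT < 0 := by linarith [H.huT.1]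
      have hg : 0 < H.gn (q t) (u t) := by
        rw [abs_of_neg hv] at hsl
        have := h.hulo
        have h7 : (u t - H.uT) * H.gn (q t) (u t) < 0 := by
          refine lt_of_le_of_lt hsl ?_
          rw [show H.ulo = u t by linarith] at this
          nlinarith
        exact pos_of_mul_neg_right h7 hv.le
      have : 0 < H.G (q t) (u t) μ := div_pos hg hden
      exact ⟨_, mul_pos hε this, du.sub_const _⟩

end block

end Layer

namespace Layer
variable {H : Layer} {ε k μ P ρ η L zs : ℝ} {q p u : ℝ → ℝ}

theorem Touch.not_exit {s q p u : ℝ} (hL : 0 < L) (hz : 0 < zs * ε)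
    (ht : H.Touch L zs ε μ s q p u) : ¬H.Touch L zs ε μ (-s) q p u := by
  rintro ⟨-, h2, h3⟩
  obtain ⟨-, t2, t3⟩ := ht
  have := mul_pos hL hz
  nlinarith

theorem Exit.touch {s q p u : ℝ} (ht : H.Exit L zs ε μ s q p u) : H.Touch L zs ε μ s q p u :=
  ⟨ht.1.le, ht.2.1.le, ht.2.2.le⟩

theorem Traj.isClosed_touch (T : H.Traj ε k μ P q p u) (L zs s : ℝ) :
    IsClosed {t | H.Touch L zs ε μ s (q t) (p t) (u t)} := by
  have h1 := T.cq
  have h2 := T.cY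
  have h3 := T.cZ
  exact (isClosed_le continuous_const h1).inter
    ((isClosed_le continuous_const (continuous_const.mul h2)).inter
      (isClosed_le continuous_const (continuous_const.mul (h2.add (continuous_const.mul h3)))))

theorem Traj.isClosed_blk (T : H.Traj ε k μ P q p u) (L ρ : ℝ) :
    IsClosed {t | H.Blk L ρ ε μ (q t) (p t) (u t)} := by
  have h1 := T.cq
  have h2 := T.cY
  have h3 := T.cZ
  have h4 := T.cu
  exact (isClosed_Icc.preimage h1).inter ((isClosed_Icc.preimage h4).inter
    ((isClosed_le h3.abs continuous_const).inter (isClosed_le h2.abs continuous_const)))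

/-- An orbit which enters the block and never exits first through one side stays there. -/
theorem Traj.stay_forever (T : H.Traj ε k μ P q p u) (h : H.BlockHyp ε P ρ η L zs) {t₁ : ℝ}
    (hL : 0 < L) (hzs : 0 < zs) (ht₁ : 0 ≤ t₁) (hq : H.q₂ < q t₁) (hq' : q t₁ < H.q₃)
    (hZ : |H.Z (q t₁) (u t₁)| < ρ) (hu : u t₁ ∈ Set.Ioo H.ulo H.uhi)
    (h0 : ∀ t ∈ Set.Icc 0 t₁, ∀ s, s = 1 ∨ s = -1 → ¬H.Touch L zs ε μ s (q t) (p t) (u t))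
    (hE : ∀ s, s = 1 ∨ s = -1 → ∀ t ≥ 0, H.Exit L zs ε μ s (q t) (p t) (u t) →
      ∃ t' ∈ Set.Icc 0 t, H.Touch L zs ε μ (-s) (q t') (p t') (u t')) :
    ∀ t ≥ t₁, H.Blk L ρ ε μ (q t) (p t) (u t) := by
  have hz : 0 < zs * ε := mul_pos hzs h.hε
  suffices hno : ∀ t ≥ t₁, ∀ s, s = 1 ∨ s = -1 → ¬H.Touch L zs ε μ s (q t) (p t) (u t) by
    intro t ht
    exact T.stay h hL hq hq' hZ hu (S := t)
      (fun t ht => ⟨hno t ht.1 1 (by simp), hno t ht.1 (-1) (by simp)⟩) t ⟨ht, le_rfl⟩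
  by_contra! hc
  obtain ⟨t₂, ht₂, s₂, hs₂, hT₂⟩ := hc
  set K := Set.Icc t₁ t₂ ∩ ({t | H.Touch L zs ε μ 1 (q t) (p t) (u t)} ∪
    {t | H.Touch L zs ε μ (-1) (q t) (p t) (u t)}) with hK
  have hKc : IsCompact K :=
    isCompact_Icc.inter_right ((T.isClosed_touch L zs 1).union (T.isClosed_touch L zs (-1)))
  have hKne : K.Nonempty :=
    ⟨t₂, ⟨ht₂, le_rfl⟩, by rcases hs₂ with rfl | rfl; exacts [.inl hT₂, .inr hT₂]⟩
  obtain ⟨t₀, ⟨ht₀, hT₀⟩, hmin⟩ := hKc.exists_isLeast hKne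
  obtain ⟨s, hs, hT⟩ : ∃ s, (s = 1 ∨ s = -1) ∧ H.Touch L zs ε μ s (q t₀) (p t₀) (u t₀) := by
    rcases hT₀ with h | h
    exacts [⟨1, by simp, h⟩, ⟨-1, by simp, h⟩]
  have hbefore : ∀ t ∈ Set.Ico 0 t₀, ∀ s, s = 1 ∨ s = -1 →
      ¬H.Touch L zs ε μ s (q t) (p t) (u t) := by
    intro t ht s hs hT'
    rcases le_or_gt t t₁ with h1 | h1
    · exact h0 t ⟨ht.1, h1⟩ s hs hT'
    · have : t ∈ K := ⟨⟨h1.le, ht.2.le.trans ht₀.2⟩, by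
        rcases hs with rfl | rfl; exacts [.inl hT', .inr hT']⟩
      exact absurd (hmin this) (not_le.2 ht.2)
  have hlt : t₁ < t₀ := by
    rcases ht₀.1.eq_or_lt with h | h
    · exact absurd hT (h0 t₀ ⟨by linarith, h.ge⟩ s hs)
    · exact h
  have hblk0 : ∀ t ∈ Set.Ico t₁ t₀, H.Blk L ρ ε μ (q t) (p t) (u t) := fun t ht =>
    T.stay h hL hq hq' hZ hu (S := t)
      (fun t' ht' => ⟨hbefore t' ⟨ht₁.trans ht'.1, ht'.2.trans_lt ht.2⟩ 1 (by simp),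
        hbefore t' ⟨ht₁.trans ht'.1, ht'.2.trans_lt ht.2⟩ (-1) (by simp)⟩) t ⟨ht.1, le_rfl⟩
  have hblk : H.Blk L ρ ε μ (q t₀) (p t₀) (u t₀) := by
    have h1 := closure_minimal (show Set.Ico t₁ t₀ ⊆ {t | H.Blk L ρ ε μ (q t) (p t) (u t)} from
      hblk0) (T.isClosed_blk L ρ)
    rw [closure_Ico hlt.ne] at h1
    exact h1 ⟨hlt.le, le_rfl⟩
  obtain ⟨t₃, ht₃, hsub⟩ := mem_nhdsGT_iff_exists_Ioc_subset.1 (T.enter h hs hblk hT)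
  have hs' : -s = 1 ∨ -s = -1 := by rcases hs with rfl | rfl <;> simp
  obtain ⟨t', ht', hT'⟩ := hE s hs t₃ (by linarith [show t₀ < t₃ from ht₃]) (hsub ⟨ht₃, le_rfl⟩)
  rcases lt_trichotomy t' t₀ with h1 | h1 | h1
  · exact hbefore t' ⟨ht'.1, h1⟩ _ hs' hT'
  · subst h1; exact hT.not_exit hL hz hT'
  · exact (hsub ⟨h1, ht'.2⟩).touch.not_exit hL hz hT'

/-- The algebraic inequality behind the Lyapunov function of the block. -/
theorem lyapunov_ineq {ε A₀ A Y Z E v g Ce C c Ca κ αg : ℝ} (hε : 0 ≤ ε) (hA : A₀ ≤ A)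
    (hCe : 0 ≤ Ce) (hc : 0 < c) (hE : |E| ≤ κ * |Y| + Ce * ε * |g|)
    (hg : |g| ≤ C * (|v| + |Z|)) (hκ : κ ^ 2 ≤ A₀ / 4) (hα : |αg| ≤ Ca)
    (hsmall : ε * (((Ce + 1) * C) ^ 2 / c + 2 * Ce * C + Ca) ≤ A₀ / 2)
    (hv : v * g ≤ -c * v ^ 2 + C * |Z| * |v|) :
    Y ^ 2 + A₀ * Z ^ 2 + ε * c * v ^ 2 ≤
      2 * Y ^ 2 + 2 * A * Z ^ 2 + 2 * Z * E - ε * αg * Z ^ 2 - 2 * ε * (v * g) := by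
  have hz2 : |Z| ^ 2 = Z ^ 2 := sq_abs Z
  have hv2 : |v| ^ 2 = v ^ 2 := sq_abs v
  have hy2 : |Y| ^ 2 = Y ^ 2 := sq_abs Y
  have h1 : -(|Z| * (κ * |Y| + Ce * ε * (C * (|v| + |Z|)))) ≤ Z * E := by
    have : |Z * E| ≤ |Z| * (κ * |Y| + Ce * ε * (C * (|v| + |Z|))) := by
      rw [abs_mul]
      gcongr
      exact hE.trans (by gcongr)
    linarith [neg_abs_le (Z * E)]
  have h1' : |Z| * (κ * |Y| + Ce * ε * (C * (|v| + |Z|))) =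
      |Z| * (κ * |Y|) + ε * Ce * C * (|Z| * |v|) + ε * Ce * C * Z ^ 2 := by rw [← hz2]; ring
  rw [h1'] at h1
  have h2 : 2 * (|Z| * (κ * |Y|)) ≤ Y ^ 2 + A₀ / 4 * Z ^ 2 := by
    have : κ ^ 2 * Z ^ 2 ≤ A₀ / 4 * Z ^ 2 := by gcongr
    nlinarith [sq_nonneg (|Y| - κ * |Z|)]
  have h3 : 2 * ((Ce + 1) * C) * (|Z| * |v|) ≤ c * v ^ 2 + ((Ce + 1) * C) ^ 2 / c * Z ^ 2 := by
    have e : c * v ^ 2 + ((Ce + 1) * C) ^ 2 / c * Z ^ 2 - 2 * ((Ce + 1) * C) * (|Z| * |v|) =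
      (c * |v| - (Ce + 1) * C * |Z|) ^ 2 / c := by
      rw [← hz2, ← hv2]; field_simp; ring
    have : 0 ≤ (c * |v| - (Ce + 1) * C * |Z|) ^ 2 / c := by positivity
    linarith
  have h4 : αg * Z ^ 2 ≤ Ca * Z ^ 2 := by
    gcongr; exact (le_abs_self _).trans hα
  have h5 : A₀ * Z ^ 2 ≤ A * Z ^ 2 := by gcongr
  have h6 := mul_le_mul_of_nonneg_right hsmall (sq_nonneg Z)
  have h7 := mul_le_mul_of_nonneg_left h3 hε
  have h8 := mul_le_mul_of_nonneg_left h4 hε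
  have h9 := mul_le_mul_of_nonneg_left hv hε
  have h10 : 0 ≤ A₀ * Z ^ 2 := mul_nonneg (by nlinarith [sq_nonneg κ]) (sq_nonneg Z)
  linarith

theorem isCompact_box (H : Layer) (P : ℝ) :
    IsCompact {x : ℝ × ℝ × ℝ | H.Box P x.1 x.2.1 x.2.2} := by
  have : {x : ℝ × ℝ × ℝ | H.Box P x.1 x.2.1 x.2.2} =
      Set.Icc (-1) (H.q₃ + 1) ×ˢ (Set.Icc (-P) P ×ˢ Set.Icc H.ulo H.uhi) := by
    ext x; rfl
  rw [this]
  exact isCompact_Icc.prod (isCompact_Icc.prod isCompact_Icc)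

theorem continuous_pdot (H : Layer) (k μ : ℝ) :
    Continuous fun x : ℝ × ℝ × ℝ => H.pdot k μ x.1 x.2.1 x.2.2 := by
  unfold pdot F; fun_prop

/-- A function of the state is uniformly continuous along a trajectory that stays in the box. -/
theorem Traj.uniformContinuousOn (T : H.Traj ε k μ P q p u) {s : ℝ}
    (hb : ∀ t ≥ s, H.Box P (q t) (p t) (u t)) {f : ℝ × ℝ × ℝ → ℝ} (hf : Continuous f) :
    UniformContinuousOn (fun t => f (q t, p t, u t)) (Set.Ici s) := by
  have hK := H.isCompact_box P
  have hG := H.continuous_G μ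
  have hp := H.continuous_pdot k μ
  have hV : Continuous fun x : ℝ × ℝ × ℝ =>
    (x.2.1, H.pdot k μ x.1 x.2.1 x.2.2, ε * H.G x.1 x.2.2 μ) := by fun_prop
  obtain ⟨C, hC⟩ := hK.exists_bound_of_continuousOn hV.continuousOn
  have hC0 : 0 ≤ C := (norm_nonneg _).trans (hC (q s, p s, u s) (hb s le_rfl))
  have hlip : LipschitzOnWith C.toNNReal (fun t => (q t, p t, u t)) (Set.Ici s) := by
    refine (convex_Ici s).lipschitzOnWith_of_nnnorm_hasDerivWithin_le
      (f' := fun t => (p t, H.pdot k μ (q t) (p t) (u t), ε * H.G (q t) (u t) μ))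
      (fun t ht => ?_) (fun t ht => ?_)
    · have := hb t ht
      exact ((T.dq t this).prodMk ((T.dp t this).prodMk (T.du t this))).hasDerivWithinAt
    · rw [← NNReal.coe_le_coe, coe_nnnorm, Real.coe_toNNReal C hC0]
      exact hC (q t, p t, u t) (hb t ht)
  exact (hK.uniformContinuousOn_of_continuous hf.continuousOn).comp hlip.uniformContinuousOn
    (fun t ht => hb t ht)

theorem Traj.tendsto (T : H.Traj ε k μ P q p u) (h : H.BlockHyp ε P ρ η L zs) {t₁ : ℝ}
    (hb : ∀ t ≥ t₁, H.Blk L ρ ε μ (q t) (p t) (u t)) :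
    Tendsto q atTop (𝓝 H.qT) ∧ Tendsto p atTop (𝓝 0) ∧ Tendsto u atTop (𝓝 H.uT) := by
  have hε := h.hε
  have hA₀ := H.A₀_pos
  have hd₀ := H.hd₀
  have hbt₁ := hb t₁ le_rfl
  have hB := B₁_nonneg T.par hbt₁.2.1
  have hCe := Ce_nonneg hB
  have hd₁ : 0 < H.d₁ := by
    have := H.hden _ hbt₁.2.1 _ T.par.2
    linarith
  have hc₀ := H.hc₀
  have hC₀ := H.hC₀
  have cY := H.continuous_Y ε μ
  have cZ := H.continuous_Z
  have hgb : ∀ t ≥ t₁, |H.G (q t) (u t) μ| ≤ H.C₀ / H.d₀ * (|u t - H.uT| + |H.Z (q t) (u t)|) := by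
    intro t ht
    obtain ⟨-, sl, -⟩ := H.hslow _ (hb t ht).1 _ (hb t ht).2.1
    have := H.d₀_le_den (u t) μ
    have hden := H.den_pos (u t) μ
    unfold G
    rw [abs_div, abs_of_pos hden]
    calc |H.gn (q t) (u t)| / H.den (u t) μ ≤
        (H.C₀ * (|u t - H.uT| + |H.Z (q t) (u t)|)) / H.d₀ := by
          gcongr; exact sl
      _ = _ := by ring
  have hf : Tendsto (fun t => H.Y ε μ (q t) (p t) (u t) ^ 2 +
      H.A₀ * H.Z (q t) (u t) ^ 2 + ε * (H.c₀ / H.d₁) * (u t - H.uT) ^ 2) atTop (𝓝 0) := by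
    set Wf : ℝ × ℝ × ℝ → ℝ := fun x => 2 * H.Z x.1 x.2.2 * H.Y ε μ x.1 x.2.1 x.2.2 -
      H.α k * (x.2.2 + μ) * H.Z x.1 x.2.2 ^ 2 - (x.2.2 - H.uT) ^ 2 with hWf
    have cW : Continuous Wf := by fun_prop
    obtain ⟨B, hBW⟩ := (H.isCompact_box P).exists_bound_of_continuousOn cW.continuousOn
    refine tendsto_zero_of_lyapunov (W := fun t => Wf (q t, p t, u t)) (s := t₁) (B := B)
      (fun t _ => by positivity)
      (T.uniformContinuousOn (f := fun x => H.Y ε μ x.1 x.2.1 x.2.2 ^ 2 +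
        H.A₀ * H.Z x.1 x.2.2 ^ 2 + ε * (H.c₀ / H.d₁) * (x.2.2 - H.uT) ^ 2)
        (fun t ht => h.box (hb t ht)) (by fun_prop))
      (fun t ht => hBW _ (h.box (hb t ht))) (fun t ht => ?_)
    have hbt := hb t ht
    have hbox := h.box hbt
    have hpη := h.abs_p_le hbt
    obtain ⟨E, hE, dY⟩ := T.hasDerivAt_Y h.hε.le h.hε1 hbox hbt.1 (hpη.trans h.hη1)
    have dZ := T.hasDerivAt_Z hbox
    have du := T.du t hbox
    obtain ⟨hA, -⟩ := A_bounds T.par hbt.1 hbt.2.1 (hbt.2.2.1.trans h.hρ₀)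
    have hG := H.abs_G_le hbt.2.1 (H.q₂_pos.le.trans hbt.1.1) hbt.1.2 μ
    obtain ⟨sl, -, -⟩ := H.hslow _ hbt.1 _ hbt.2.1
    have hα0 := H.α_pos T.par.k_pos
    have hα := H.α_le T.par
    refine ⟨_, lyapunov_ineq (E := E) (g := H.G (q t) (u t) μ) (κ := H.Ce * (η + ε))
      (αg := H.α k * H.G (q t) (u t) μ) (Ca := H.α H.kh * H.Cg) (C := H.C₀ / H.d₀)
      hε.le hA hCe (by positivity) ?_ (hgb t ht) h.hA ?_ h.hεA ?_, ?_⟩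
    · refine hE.trans ?_
      gcongr
    · rw [abs_mul, abs_of_pos hα0]
      have := hα0.trans_le hα
      gcongr
    · have hden := H.den_pos (u t) μ
      have hdd := H.d₀_le_den (u t) μ
      have hdd' : H.den (u t) μ ≤ H.d₁ := by
        rw [H.den_eq T.par hbt.2.1]; exact (H.hden _ hbt.2.1 _ T.par.2).2
      have e1 : H.c₀ / H.d₁ * (u t - H.uT) ^ 2 ≤ H.c₀ / H.den (u t) μ * (u t - H.uT) ^ 2 := by
        gcongr
      have e2 : H.C₀ / H.den (u t) μ * |H.Z (q t) (u t)| * |u t - H.uT| ≤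
          H.C₀ / H.d₀ * |H.Z (q t) (u t)| * |u t - H.uT| := by gcongr
      have e3 : (u t - H.uT) * H.G (q t) (u t) μ ≤ (-H.c₀ * (u t - H.uT) ^ 2 +
          H.C₀ * |H.Z (q t) (u t)| * |u t - H.uT|) / H.den (u t) μ := by
        unfold G
        rw [mul_div_assoc']
        gcongr
        exact sl
      have e4 : (-H.c₀ * (u t - H.uT) ^ 2 +
          H.C₀ * |H.Z (q t) (u t)| * |u t - H.uT|) / H.den (u t) μ =
          -(H.c₀ / H.den (u t) μ * (u t - H.uT) ^ 2) +
          H.C₀ / H.den (u t) μ * |H.Z (q t) (u t)| * |u t - H.uT| := by ring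
      linarith
    · refine ((((dZ.const_mul 2).mul dY).sub
        (((du.add_const μ).const_mul (H.α k)).mul (dZ.pow 2))).sub
        ((du.sub_const H.uT).pow 2)).congr_deriv ?_
      simp only [Nat.cast_ofNat, Nat.add_one_sub_one, pow_one, Pi.pow_apply]
      ring
  have hY : Tendsto (fun t => H.Y ε μ (q t) (p t) (u t)) atTop (𝓝 0) := by
    have h1 : Tendsto (fun t => H.Y ε μ (q t) (p t) (u t) ^ 2) atTop (𝓝 0) :=
      squeeze_zero (fun t => sq_nonneg _) (fun t => by
        have : 0 ≤ H.A₀ * H.Z (q t) (u t) ^ 2 := by positivity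
        have : 0 ≤ ε * (H.c₀ / H.d₁) * (u t - H.uT) ^ 2 := by positivity
        linarith) hf
    have h2 := h1.sqrt
    simp only [Real.sqrt_sq_eq_abs, Real.sqrt_zero] at h2
    exact (tendsto_zero_iff_abs_tendsto_zero _).2 h2
  have hZ : Tendsto (fun t => H.Z (q t) (u t)) atTop (𝓝 0) := by
    have h1 : Tendsto (fun t => H.Z (q t) (u t) ^ 2) atTop (𝓝 0) := by
      have h0 := hf.div_const H.A₀
      rw [zero_div] at h0
      refine squeeze_zero (fun t => sq_nonneg _) (fun t => ?_) h0
      rw [le_div_iff₀ hA₀]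
      have : 0 ≤ H.Y ε μ (q t) (p t) (u t) ^ 2 := by positivity
      have : 0 ≤ ε * (H.c₀ / H.d₁) * (u t - H.uT) ^ 2 := by positivity
      linarith
    have h2 := h1.sqrt
    simp only [Real.sqrt_sq_eq_abs, Real.sqrt_zero] at h2
    exact (tendsto_zero_iff_abs_tendsto_zero _).2 h2
  have hv : Tendsto (fun t => u t - H.uT) atTop (𝓝 0) := by
    have h1 : Tendsto (fun t => (u t - H.uT) ^ 2) atTop (𝓝 0) := by
      have h0 := hf.div_const (ε * (H.c₀ / H.d₁))
      rw [zero_div] at h0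
      refine squeeze_zero (fun t => sq_nonneg _) (fun t => ?_) h0
      rw [le_div_iff₀ (by positivity)]
      have : 0 ≤ H.Y ε μ (q t) (p t) (u t) ^ 2 := by positivity
      have : 0 ≤ H.A₀ * H.Z (q t) (u t) ^ 2 := by positivity
      linarith
    have h2 := h1.sqrt
    simp only [Real.sqrt_sq_eq_abs, Real.sqrt_zero] at h2
    exact (tendsto_zero_iff_abs_tendsto_zero _).2 h2
  have hZa := (tendsto_zero_iff_abs_tendsto_zero _).1 hZ
  have hva := (tendsto_zero_iff_abs_tendsto_zero _).1 hv
  have hYa := (tendsto_zero_iff_abs_tendsto_zero _).1 hY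
  have ev : ∀ᶠ t in atTop, t₁ ≤ t := eventually_ge_atTop t₁
  refine ⟨?_, ?_, by simpa using hv.add_const H.uT⟩
  · rw [tendsto_iff_dist_tendsto_zero]
    have h0 := (hZa.add hva).const_mul H.C₀
    simp only [add_zero, mul_zero] at h0
    refine squeeze_zero' (.of_forall fun t => dist_nonneg) ?_ h0
    filter_upwards [ev] with t ht
    exact (H.hslow _ (hb t ht).1 _ (hb t ht).2.1).2.2
  · rw [tendsto_zero_iff_abs_tendsto_zero]
    have h0 := (hYa.add ((hva.add hZa).const_mul (ε * (H.C₀ / H.d₀)))).div_const H.ζ₀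
    simp only [add_zero, mul_zero, zero_div] at h0
    refine squeeze_zero' (.of_forall fun t => abs_nonneg _) ?_ h0
    filter_upwards [ev] with t ht
    have h1 := Traj.abs_p_le (H := H) (μ := μ) (p := p t) (u := u t) h.hε.le (hb t ht).1
    rw [le_div_iff₀ H.hζ₀, mul_comm]
    refine h1.trans ?_
    have := mul_le_mul_of_nonneg_left (hgb t ht) hε.le
    simp only [Function.comp_apply]
    linarith

end Layer

namespace Layer
variable (H : Layer)

/-- Bound for `F q u / q` in blow-up coordinates. -/
def CF : ℝ := H.R * H.q₃ ^ 2 + H.q₃ + |H.e|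
/-- Slope such that `p < K q` is forward invariant. -/
def K : ℝ := H.B₁ + H.α H.kh * H.CF + H.M + 1

variable {H}

theorem CF_pos : 0 < H.CF := by
  have := H.hR
  have := H.q₃_pos
  unfold CF; positivity

theorem M_lt_K (hB : 0 ≤ H.B₁) : H.M + 1 ≤ H.K := by
  have := H.CF_pos
  have := H.α_pos (H.hkl.trans_le H.hkh)
  have : 0 ≤ H.α H.kh * H.CF := by positivity
  unfold K; linarith

theorem Par.B₁_nonneg {k μ : ℝ} (hk : H.Par k μ) : 0 ≤ H.B₁ :=
  Layer.B₁_nonneg hk (Set.Ioo_subset_Icc_self H.hua)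

theorem abs_F_le {q n : ℝ} (hq : 0 ≤ q) (hq' : q ≤ H.q₃) (hn : |n| ≤ 1) :
    |H.F q (H.ua + q * n)| ≤ q * H.CF := by
  have hb := H.hb
  have hba := H.hba
  have hq₃ := H.hq₃
  have hR := H.hR
  have : H.F q (H.ua + q * n) = q * (H.R * ((q - H.b) * (H.a - q)) + (q - H.e) * n) := by
    unfold F; ring
  rw [this, abs_mul, abs_of_nonneg hq]
  have e1 : |q - H.b| ≤ H.q₃ := abs_le.2 ⟨by linarith, by linarith⟩
  have e2 : |H.a - q| ≤ H.q₃ := abs_le.2 ⟨by linarith, by linarith⟩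
  have e3 : |q - H.e| ≤ H.q₃ + |H.e| := by
    refine (abs_sub _ _).trans ?_
    rw [abs_of_nonneg hq]; linarith
  have e4 : |H.R * ((q - H.b) * (H.a - q)) + (q - H.e) * n| ≤ H.CF := by
    refine (abs_add_le _ _).trans ?_
    rw [abs_mul, abs_mul, abs_mul, abs_of_pos hR]
    have hq0 := H.q₃_pos
    have f1 : H.R * (|q - H.b| * |H.a - q|) ≤ H.R * (H.q₃ * H.q₃) := by gcongr
    have f2 : |q - H.e| * |n| ≤ (H.q₃ + |H.e|) * 1 := by gcongr
    unfold CF; linarith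
  gcongr

theorem K_face {k μ q p u n : ℝ} (hk : H.Par k μ) (hq : 0 < q) (hq' : q ≤ H.q₃)
    (hu : u ∈ Set.Icc H.ulo H.uhi) (hn : |n| ≤ 1) (hun : u = H.ua + q * n) (hp : p = H.K * q) :
    0 < H.K * p - H.pdot k μ q p u := by
  have hF := (abs_F_le hq.le hq' hn)
  rw [← hun] at hF
  have hB := (abs_le.1 (abs_B_le hk hu)).2
  have hα := H.α_le hk
  have hα0 := H.α_pos hk.k_pos
  have hB0 := hk.B₁_nonneg
  have hK := M_lt_K hB0
  have hM := H.M_pos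
  have hCF := H.CF_pos
  have hK0 : 0 < H.K := by linarith
  have e1 : -(H.α k * H.F q u) ≤ H.α H.kh * (q * H.CF) := by
    have : |H.α k * H.F q u| ≤ H.α H.kh * (q * H.CF) := by
      rw [abs_mul, abs_of_pos hα0]
      have := hα0.trans_le hα
      gcongr
    linarith [neg_abs_le (H.α k * H.F q u)]
  have e2 : H.α k * (u + μ) * p ≤ H.B₁ * p := by
    have : 0 ≤ p := by rw [hp]; positivity
    gcongr
  have : 0 < H.K * p - H.B₁ * p - H.α H.kh * (q * H.CF) := by
    have : H.K * p - H.B₁ * p - H.α H.kh * (q * H.CF) =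
        q * ((H.K - 1) * (H.α H.kh * H.CF) + H.K * (H.M + 1)) := by
      rw [hp]
      have : H.K - H.B₁ = H.α H.kh * H.CF + (H.M + 1) := by unfold K; ring
      linear_combination (H.K * q) * this
    rw [this]
    have : 0 ≤ (H.K - 1) * (H.α H.kh * H.CF) := by
      have := hα0.trans_le hα
      have : 0 ≤ H.K - 1 := by linarith
      positivity
    have : 0 < H.K * (H.M + 1) := mul_pos hK0 (by linarith)
    positivity
  unfold pdot
  linarith

theorem Z_le {q u : ℝ} (hq : q ∈ Set.Icc H.q₂ H.q₃) (hqa : q ≤ H.a) :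
    H.Z q u ≤ -(H.ζ₀ * (H.a - q)) + |u - H.ua| := by
  have h1 := (H.hζ q hq).1
  have h2 := (H.hζ H.a ⟨H.hq₂.le, H.hq₃.le⟩).1
  have h3 : H.Z q u = -((H.a - q) * (H.z₂ * (q + H.a) + H.z₁)) - H.ν * (u - H.ua) := by
    unfold Z; linear_combination H.hZa
  have h4 : (H.a - q) * H.ζ₀ ≤ (H.a - q) * (H.z₂ * (q + H.a) + H.z₁) := by
    gcongr
    linarith
  have h5 : |H.ν * (u - H.ua)| ≤ 1 * |u - H.ua| := by
    rw [abs_mul, abs_of_nonneg H.hν₀]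
    have := H.hν₁
    gcongr
  rw [h3]
  linarith [neg_abs_le (H.ν * (u - H.ua))]

theorem le_Z {q u : ℝ} (hq : q ∈ Set.Icc H.q₂ H.q₃) (hqa : H.a ≤ q) :
    H.ζ₀ * (q - H.a) - |u - H.ua| ≤ H.Z q u := by
  have h1 := (H.hζ q hq).1
  have h2 := (H.hζ H.a ⟨H.hq₂.le, H.hq₃.le⟩).1
  have h3 : H.Z q u = (q - H.a) * (H.z₂ * (q + H.a) + H.z₁) - H.ν * (u - H.ua) := by
    unfold Z; linear_combination H.hZa
  have h4 : (q - H.a) * H.ζ₀ ≤ (q - H.a) * (H.z₂ * (q + H.a) + H.z₁) := by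
    gcongr
    linarith
  have h5 : |H.ν * (u - H.ua)| ≤ 1 * |u - H.ua| := by
    rw [abs_mul, abs_of_nonneg H.hν₀]
    have := H.hν₁
    gcongr
  rw [h3]
  linarith [le_abs_self (H.ν * (u - H.ua))]

/-- Lower bound for `Y` when `p` is bounded below. -/
theorem le_Y {ε μ q p u p₀ : ℝ} (hε : 0 ≤ ε) (hq : q ∈ Set.Icc H.q₂ H.q₃)
    (hu : u ∈ Set.Icc H.ulo H.uhi) (hp₀ : 0 ≤ p₀) (hp : p₀ ≤ p) :
    H.ζ₀ * p₀ - ε * H.Cg ≤ H.Y ε μ q p u := by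
  have h1 := (H.hζ q hq).1
  have hG := abs_G_le hu (H.q₂_pos.le.trans hq.1) hq.2 μ
  have hζ := H.hζ₀
  have e1 : H.ζ₀ * p₀ ≤ H.dZ q * p := by
    unfold dZ
    gcongr
    linarith
  have e2 : |H.ν * ε * H.G q u μ| ≤ 1 * ε * H.Cg := by
    rw [abs_mul, abs_mul, abs_of_nonneg H.hν₀, abs_of_nonneg hε]
    have := H.hν₁
    gcongr
  unfold Y
  linarith [le_abs_self (H.ν * ε * H.G q u μ)]

/-- Upper bound for `Y` when `p` is bounded above. -/
theorem Y_le {ε μ q p u p₀ : ℝ} (hε : 0 ≤ ε) (hq : q ∈ Set.Icc H.q₂ H.q₃)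
    (hu : u ∈ Set.Icc H.ulo H.uhi) (hp₀ : 0 ≤ p₀) (hp : p ≤ p₀) :
    H.Y ε μ q p u ≤ H.ζ₁ * p₀ + ε * H.Cg := by
  have h1 := H.hζ q hq
  have hG := abs_G_le hu (H.q₂_pos.le.trans hq.1) hq.2 μ
  have hζ := H.hζ₀
  have e1 : H.dZ q * p ≤ H.ζ₁ * p₀ := by
    have : 0 ≤ H.dZ q := by unfold dZ; linarith
    calc H.dZ q * p ≤ H.dZ q * p₀ := by gcongr
      _ ≤ H.ζ₁ * p₀ := by gcongr; exact h1.2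
  have e2 : |H.ν * ε * H.G q u μ| ≤ 1 * ε * H.Cg := by
    rw [abs_mul, abs_mul, abs_of_nonneg H.hν₀, abs_of_nonneg hε]
    have := H.hν₁
    gcongr
  unfold Y
  linarith [neg_abs_le (H.ν * ε * H.G q u μ)]

theorem Y_neg {ε μ q p u p₁ : ℝ} (hε : 0 ≤ ε) (hq : q ∈ Set.Icc H.q₂ H.q₃)
    (hu : u ∈ Set.Icc H.ulo H.uhi) (hp₀ : 0 ≤ p₁) (hp : p ≤ -p₁) :
    H.Y ε μ q p u ≤ -(H.ζ₀ * p₁) + ε * H.Cg := by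
  have h1 := (H.hζ q hq).1
  have hG := abs_G_le hu (H.q₂_pos.le.trans hq.1) hq.2 μ
  have hζ := H.hζ₀
  have e1 : H.ζ₀ * p₁ ≤ H.dZ q * -p := by
    unfold dZ
    gcongr
    · linarith
    · linarith
  have e2 : |H.ν * ε * H.G q u μ| ≤ 1 * ε * H.Cg := by
    rw [abs_mul, abs_mul, abs_of_nonneg H.hν₀, abs_of_nonneg hε]
    have := H.hν₁
    gcongr
  unfold Y
  linarith [neg_abs_le (H.ν * ε * H.G q u μ)]

variable (H) in
/-- Smallness conditions for overshooting when the wave-speed mismatch is `δ`. -/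
structure OverHyp (ε P δ σ C L zs : ℝ) : Prop where
  hε : 0 < ε
  hσ : 0 < σ
  hC₀ : 0 < C
  hL : 0 < L
  hσδ : σ < δ
  hδa : δ ≤ H.a
  hσq : H.a + σ / 2 ≤ H.q₃
  hRσ : 3 * H.R * σ ≤ 2 * H.kl * δ
  hC : 8 < C * H.kl * σ * H.d₀
  hCε : C * ε ≤ 1
  hlo : C * H.q₃ * ε < H.ua - H.ulo
  hhi : C * H.q₃ * ε < H.uhi - H.ua
  hP : H.K * H.q₃ ≤ P
  herr : H.α H.kh * C * (H.K * H.q₃ + H.q₃ + |H.e|) * ε < 2 * H.kl ^ 2 * σ * (H.a - H.b)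
  hY : H.Cg * ε < H.ζ₀ * (H.kl * σ / 2 * H.q₂)
  hz : (zs + C * H.q₃) * ε < H.ζ₀ * (σ / 2)

theorem Traj.overshoot {ε k μ P δ σ C L zs : ℝ} {q p u : ℝ → ℝ} (T : H.Traj ε k μ P q p u)
    (h : H.OverHyp ε P δ σ C L zs) (hs : H.s k μ = δ)
    (h0 : H.Start k μ (q 0) (p 0) (u 0)) (hq0 : q 0 < H.a) :
    ∃ t ≥ 0, H.Exit L zs ε μ 1 (q t) (p t) (u t) ∧
      ∀ t' ∈ Set.Icc 0 t, ¬H.Touch L zs ε μ (-1) (q t') (p t') (u t') := by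
  have hε := h.hε
  have hσ := h.hσ
  have hC := h.hC₀
  have hk := T.par
  have hk0 := hk.k_pos
  have hkl := H.hkl
  have hklk := hk.1.1
  have hkhk := hk.1.2
  have ha := H.ha
  have hq00 := h0.q_pos
  have hcq := T.cq
  have hcp := T.cp
  have hcu := T.cu
  have hMK := M_lt_K hk.B₁_nonneg
  have hM := H.M_pos
  have hK0 : 0 < H.K := by linarith
  have hα := H.α_le hk
  have hα0 := H.α_pos hk0
  set c := H.a + σ / 2 with hc
  have hgood : ∀ q p u : ℝ, q ≤ c → 0 < q → 0 ≤ p - k * q * (H.a - q) - k * σ * q →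
      0 ≤ H.K * q - p → 0 ≤ C * ε * q - (u - H.ua) → 0 ≤ C * ε * q + (u - H.ua) →
      k * σ / 2 * q ≤ p ∧ H.Box P q p u ∧ |u - H.ua| ≤ C * ε * q ∧
      ∃ w n, p = q * (w + k * (H.a - q)) ∧ u = H.ua + q * n ∧ |n| ≤ C * ε ∧
        k * σ / 2 ≤ w + k * (H.a - q) := by
    intro q p u hqc hq e1 e2 e3 e4
    have hq₃ := hqc.trans h.hσq
    have hp : k * σ / 2 * q ≤ p := by
      have : 0 ≤ k * q * (q - H.a + σ) - k * q * (q - H.a + σ) := by linarith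
      have : k * q * (q - H.a) ≤ k * q * (σ / 2) := by gcongr; linarith
      linarith
    have hp0 : 0 ≤ k * σ / 2 * q := by positivity
    have hCq : C * ε * q ≤ C * ε * H.q₃ := by gcongr
    have hun : |u - H.ua| ≤ C * ε * q := abs_le.2 ⟨by linarith, by linarith⟩
    have hKq : H.K * q ≤ H.K * H.q₃ := by gcongr
    obtain ⟨w, n, hw, hn⟩ := H.exists_blowup hq.ne' k p u
    refine ⟨hp, ⟨⟨by linarith, by linarith⟩, ⟨by linarith [h.hP], by linarith [h.hP]⟩,
      ⟨by linarith [h.hlo], by linarith [h.hhi]⟩⟩, hun, w, n, hw, hn, ?_, ?_⟩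
    · refine abs_le_of_abs_mul_le hq ?_
      rwa [show q * n = u - H.ua by rw [hn]; ring]
    · rw [hw] at hp
      exact le_of_mul_le_mul_left (by linarith) hq
  have hP : ∀ S, 0 ≤ S → (∀ t ∈ Set.Icc 0 S, q t ≤ c) → ∀ t ∈ Set.Icc 0 S, q 0 / 2 ≤ q t ∧
      k * σ / 2 * q t ≤ p t ∧ H.Box P (q t) (p t) (u t) ∧ |u t - H.ua| ≤ C * ε * q t := by
    intro S _ hqS
    have key := barrier_pos (n := 5) ![fun t => q t - q 0 / 2,
      fun t => p t - k * q t * (H.a - q t) - k * σ * q t, fun t => H.K * q t - p t,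
      fun t => C * ε * q t - (u t - H.ua), fun t => C * ε * q t + (u t - H.ua)]
      (s := 0) (T := S) ?_ ?_ ?_
    · intro t ht
      have := key t ht
      simp only [Fin.forall_fin_succ, Matrix.cons_val_zero, Matrix.cons_val_succ,
        IsEmpty.forall_iff,
        and_true] at this
      obtain ⟨e0, e1, e2, e3, e4⟩ := this
      obtain ⟨g1, g2, g3, -⟩ := hgood (q t) (p t) (u t) (hqS t ht) (by linarith) e1.le e2.le e3.le
        e4.le
      exact ⟨by linarith, g1, g2, g3⟩
    · simp only [Fin.forall_fin_succ, Matrix.cons_val_zero, Matrix.cons_val_succ,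
        IsEmpty.forall_iff,
        and_true]
      refine ⟨?_, ?_, ?_, ?_, ?_⟩ <;> exact Continuous.continuousOn (by fun_prop)
    · simp only [Fin.forall_fin_succ, Matrix.cons_val_zero, Matrix.cons_val_succ,
        IsEmpty.forall_iff,
        and_true]
      rw [h0.u_eq, h0.p_eq, hs]
      have e0 : 0 < C * ε * q 0 := by positivity
      have e1 : 0 < q 0 * (k * (δ - σ)) := by
        have : 0 < δ - σ := by linarith [h.hσδ]
        positivity
      have e2 : 0 < q 0 * (H.K - k * (H.a - q 0) - k * δ) := by
        have f1 : k * (H.a - q 0) ≤ H.kh * H.a := by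
          have := hk0.trans_le hkhk
          gcongr
          · linarith
        have f2 : k * δ ≤ H.kh * H.a := by
          have := hk0.trans_le hkhk
          have := h.hδa
          have := hσ.trans h.hσδ
          gcongr
        have : 0 < H.K - k * (H.a - q 0) - k * δ := by unfold M at hMK; linarith
        positivity
      exact ⟨by linarith, by linarith, by linarith, by linarith, by linarith⟩
    · intro t ht hall
      have ht' : t ∈ Set.Icc 0 S := Set.Ioc_subset_Icc_self ht
      simp only [Fin.forall_fin_succ, Matrix.cons_val_zero, Matrix.cons_val_succ,
        IsEmpty.forall_iff,
        and_true] at hall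
      obtain ⟨e0, e1, e2, e3, e4⟩ := hall
      have hqt : 0 < q t := by linarith
      obtain ⟨g1, hbox, g3, w, n, hp, hn, hn', hm⟩ :=
        hgood (q t) (p t) (u t) (hqS t ht') hqt e1 e2 e3 e4
      have hu := hbox.2.2
      have hq₃ := (hqS t ht').trans h.hσq
      have dq := T.dq t hbox
      have dp := T.dp t hbox
      have du := T.du t hbox
      have dy := T.hasDerivAt_y hbox
      have hpp : 0 < k * σ / 2 * q t := by positivity
      have hm4 : 4 < C * (w + k * (H.a - q t)) * H.d₀ := by
        have := h.hC
        have := H.hd₀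
        have h1 : H.kl * σ / 2 ≤ k * σ / 2 := by gcongr
        calc 4 < C * (H.kl * σ / 2) * H.d₀ := by linarith
          _ ≤ C * (w + k * (H.a - q t)) * H.d₀ := by gcongr; linarith
      simp only [Fin.forall_fin_succ, Matrix.cons_val_zero, Matrix.cons_val_succ,
        IsEmpty.forall_iff,
        and_true]
      refine ⟨fun _ => ⟨p t, by linarith, dq.sub_const _⟩, fun hz => ?_, fun hz => ?_, fun hz => ?_,
        fun hz => ?_⟩
      · refine ⟨_, ?_, dy.sub (dq.const_mul (k * σ))⟩
        have hw : w = k * σ := by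
          rw [hp] at hz
          have : q t * (w - k * σ) = 0 := by linarith
          rcases mul_eq_zero.1 this with h | h
          · exact absurd h hqt.ne'
          · linarith
        have hbl := H.pdot_blowup hk0 μ (q t) w n
        rw [← hp, ← hn] at hbl
        rw [hbl, hs, hw]
        have herr : |H.α k * n * (p t - q t + H.e)| < 2 * k ^ 2 * σ * (H.a - H.b) := by
          rw [abs_mul, abs_mul, abs_of_pos hα0]
          have f1 : |p t - q t + H.e| ≤ H.K * H.q₃ + H.q₃ + |H.e| := by
            refine (abs_add_le _ _).trans ?_
            have : |p t - q t| ≤ |p t| + |q t| := abs_sub _ _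
            rw [abs_of_pos hqt, abs_of_pos (by linarith : 0 < p t)] at this
            have : H.K * q t ≤ H.K * H.q₃ := by gcongr
            linarith
          have := hα0.trans_le hα
          calc H.α k * |n| * |p t - q t + H.e| ≤
              H.α H.kh * (C * ε) * (H.K * H.q₃ + H.q₃ + |H.e|) := by gcongr
            _ < 2 * H.kl ^ 2 * σ * (H.a - H.b) := by linarith [h.herr]
            _ ≤ _ := by
              have : 0 < H.a - H.b := by linarith [H.hba]
              gcongr
        have hm' : 0 ≤ (k * σ + k * (H.a - q t)) * (H.α k * δ - 3 * k * σ) := by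
          have : 0 ≤ k * σ + k * (H.a - q t) := by
            rw [← hw]; exact le_trans (by positivity) hm
          have h3 : 0 ≤ H.α k * δ - 3 * k * σ := by
            have hR := H.hR
            have f : H.R * (3 * k * σ) ≤ H.R * (H.α k * δ) := by
              have e : H.R * (H.α k * δ) = k * (2 * k * δ) := by
                rw [show H.R * (H.α k * δ) = H.α k * H.R * δ by ring, H.α_mul_R]; ring
              rw [e]
              have := hσ.trans h.hσδ
              calc H.R * (3 * k * σ) = k * (3 * H.R * σ) := by ring
                _ ≤ k * (2 * H.kl * δ) := by have := h.hRσ; gcongr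
                _ ≤ k * (2 * k * δ) := by gcongr
            linarith [le_of_mul_le_mul_left f hR]
          positivity
        have hfin : q t * (H.α k * δ * (k * σ + k * (H.a - q t)) + 2 * k * (q t - H.b) * (k * σ) +
            H.α k * n * (p t - q t + H.e)) - k * σ * p t =
            q t * ((k * σ + k * (H.a - q t)) * (H.α k * δ - 3 * k * σ) +
              2 * k ^ 2 * σ * (H.a - H.b) + 2 * k ^ 2 * σ ^ 2 + H.α k * n * (p t - q t + H.e)) := by
          have : p t = q t * (k * σ + k * (H.a - q t)) := by rw [hp, hw]
          linear_combination (-(k * σ)) * this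
        rw [hfin]
        have : 0 < 2 * k ^ 2 * σ ^ 2 := by positivity
        exact mul_pos hqt (by linarith [neg_abs_le (H.α k * n * (p t - q t + H.e))])
      · exact ⟨_, K_face hk hqt hq₃ hu (hn'.trans h.hCε) hn (by linarith),
          (dq.const_mul H.K).sub dp⟩
      · have hn1 : n = C * ε := mul_left_cancel₀ hqt.ne' (by linarith)
        have := (u_face hε hC hqt hu hn hm4 (μ := μ)
          (by rw [hn1, abs_of_pos (by positivity)])).1 hn1
        rw [← hp] at this
        exact ⟨_, this, (dq.const_mul _).sub (du.sub_const _)⟩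
      · have hn1 : n = -(C * ε) := mul_left_cancel₀ hqt.ne' (by linarith)
        have := (u_face hε hC hqt hu hn hm4 (μ := μ)
          (by rw [hn1, abs_neg, abs_of_pos (by positivity)])).2 hn1
        rw [← hp] at this
        exact ⟨_, this, (dq.const_mul _).add (du.sub_const _)⟩
  obtain ⟨t₁, ht₁, he, hall⟩ := reach_level (f := q) (V := q) (c := c)
      (κ := k * σ / 2 * (q 0 / 2)) (B := c) (s := 0)
      (P := fun t => q 0 / 2 ≤ q t ∧ k * σ / 2 * q t ≤ p t ∧ H.Box P (q t) (p t) (u t) ∧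
        |u t - H.ua| ≤ C * ε * q t) hcq (by positivity) (by linarith)
      hP (fun t _ hw _ => ⟨p t, le_trans (by gcongr; exact hw.1) hw.2.1,
        T.dq t hw.2.2.1⟩) (fun t _ _ h => h)
  refine ⟨t₁, ht₁.le, ?_, ?_⟩
  · obtain ⟨-, -, hp, hbox, hun⟩ := hall t₁ ⟨ht₁.le, le_rfl⟩
    rw [he] at hp hbox hun ⊢
    have hq : c ∈ Set.Icc H.q₂ H.q₃ := ⟨by linarith [H.hq₂], h.hσq⟩
    have hp₀ : 0 ≤ H.kl * σ / 2 * H.q₂ := by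
      have := H.q₂_pos
      positivity
    have hp' : H.kl * σ / 2 * H.q₂ ≤ p t₁ := by
      refine le_trans ?_ hp
      have := H.q₂_pos
      have := hq.1
      gcongr
    have hY := H.le_Y (μ := μ) hε.le hq hbox.2.2 hp₀ hp'
    have hZ := H.le_Z (u := u t₁) hq (by linarith)
    have hCq : C * ε * c ≤ C * ε * H.q₃ := by
      have := h.hσq
      gcongr
    have hYpos : 0 < H.Y ε μ c (p t₁) (u t₁) := by linarith [h.hY]
    refine ⟨by linarith [H.hq₂], by linarith, ?_⟩
    have : zs * ε < H.Z c (u t₁) := by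
      have : c - H.a = σ / 2 := by rw [hc]; ring
      rw [this] at hZ
      linarith [h.hz]
    have := mul_lt_mul_of_pos_left this h.hL
    linarith
  · rintro t ht ⟨hq, hT, -⟩
    obtain ⟨hqc, -, hp, hbox, hun⟩ := hall t ht
    have hp₀ : 0 ≤ H.kl * σ / 2 * H.q₂ := by
      have := H.q₂_pos
      positivity
    have hp' : H.kl * σ / 2 * H.q₂ ≤ p t := by
      refine le_trans ?_ hp
      have := H.q₂_pos
      gcongr
    have hY := H.le_Y (μ := μ) hε.le ⟨hq, hqc.trans h.hσq⟩ hbox.2.2 hp₀ hp'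
    linarith [h.hY]

end Layer

namespace Layer
variable (H : Layer)

/-- Conditions under which the wedge does not meet the exit regions. -/
structure AvoidHyp (ε ρ₁ C L zs : ℝ) : Prop where
  hL : 2 * H.ζ₁ * H.kh * H.a + 1 ≤ L * H.ζ₀
  hL₀ : 0 < L
  hzs : 0 < zs
  hup : (H.Cg + L * C * H.a) * ε < ρ₁
  hlow : H.Cg * ε < H.ζ₀ * (H.kl * ρ₁ / 2 * H.q₂)

/-- Smallness conditions for undershooting when the wave-speed mismatch is `-δ`. -/
structure UnderHyp (ε P δ ρ₁ C σ p₁ c C₂ L zs : ℝ) : Prop where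
  hδ : 0 < δ
  hσ : 0 < σ
  hp₁ : 0 < p₁
  hc : 0 < c
  hσδ : σ < δ
  hσρ : σ < 2 * ρ₁
  hσb : 4 * σ ≤ H.a - H.b
  hRσ : 3 * H.R * σ ≤ 2 * H.kl * δ
  hδb : H.α H.kh * δ ≤ H.kl * (H.a - H.b)
  hρq : H.q₂ < H.a - 2 * ρ₁
  hp₁' : p₁ ≤ 1
  hp₁P : p₁ ≤ P
  hp₁ρ : 8 * p₁ ≤ ρ₁ * H.K
  hcσ : 4 * c ≤ H.α H.kl * H.R * H.q₂ * (H.q₂ - H.b) * σ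
  hp₁c : (H.K + H.B₁) * p₁ ≤ c / 2
  hC₂ : C < C₂
  hC₂c : H.Cg < C₂ * c
  herr : H.α H.kh * C * (H.M * H.a + 1 + H.q₃ + |H.e|) * ε < H.kl ^ 2 * σ * (H.a - H.b)
  herr₂ : H.α H.kh * (C₂ * (H.K * H.a + 1)) * (H.M * H.a + 1 + H.q₃ + |H.e|) * ε <
    H.kl ^ 2 * σ * (H.a - H.b) * H.q₂
  hV : H.α H.kh * (H.q₃ + |H.e|) * (C₂ * (H.K * H.a + 1)) * ε ≤ c / 2
  hlo : C₂ * (H.K * H.a + 1) * ε ≤ H.ua - H.ulo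
  hhi : C₂ * (H.K * H.a + 1) * ε ≤ H.uhi - H.ua
  hY : H.Cg * ε < H.ζ₀ * p₁
  hz : (zs + C₂ * (H.K * H.a + 1)) * ε < H.ζ₀ * (σ / 2)
  hup : (H.Cg + L * (C₂ * (H.K * H.a + 1))) * ε < σ / 2

variable {H}

theorem ζ₁_pos : 0 < H.ζ₁ := by
  have := H.hζ H.a ⟨H.hq₂.le, H.hq₃.le⟩
  linarith [H.hζ₀]

/-- A state close to, but left of, the slow manifold with small positive velocity is not in the
right exit region. -/
theorem not_touch_right {ε μ q p u p₀ v L zs : ℝ} (hε : 0 < ε) (hL : 0 < L) (hzs : 0 < zs)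
    (hq : q ≤ H.a) (hu : u ∈ Set.Icc H.ulo H.uhi) (hp₀ : 0 ≤ p₀) (hp : p ≤ p₀)
    (hv : |u - H.ua| ≤ v)
    (h : H.ζ₁ * p₀ + ε * H.Cg + L * v ≤ L * H.ζ₀ * (H.a - q)) :
    ¬H.Touch L zs ε μ 1 q p u := by
  rintro ⟨hq₂, -, hT⟩
  have hqq : q ∈ Set.Icc H.q₂ H.q₃ := ⟨hq₂, hq.trans H.hq₃.le⟩
  have hY := Y_le (μ := μ) hε.le hqq hu hp₀ hp
  have hZ := Z_le (u := u) hqq hq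
  have : L * H.Z q u ≤ L * (-(H.ζ₀ * (H.a - q)) + v) := by gcongr; linarith
  have : 0 < L * (zs * ε) := by positivity
  linarith

theorem Wedge.not_touch {ε P δ ρ₁ τ C L zs : ℝ} (h : H.WedgeHyp ε P δ ρ₁ τ C)
    (h' : H.AvoidHyp ε ρ₁ C L zs) {k μ q p u : ℝ} (hk : H.Par k μ)
    (hw : H.Wedge k ρ₁ τ C ε q p u) {s : ℝ} (hs : s = 1 ∨ s = -1) :
    ¬H.Touch L zs ε μ s q p u := by
  obtain ⟨e1, -, e2, -, hu, -⟩ := hw.bounds h hk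
  obtain ⟨hq0, hq1, -, hn⟩ := hw
  have hε := h.hε
  have hρ := h.hρ₁
  have hC := h.hC₀
  have hk0 := hk.k_pos
  have hL := h'.hL₀
  have hkh := hk0.trans_le hk.1.2
  have haq : ρ₁ ≤ H.a - q := by linarith
  rcases hs with rfl | rfl
  · have hp₀ : 3 / 2 * k * (H.a - q) * q ≤ 3 / 2 * H.kh * (H.a - q) * H.a := by
      have := hk.1.2
      have : 0 ≤ H.a - q := by linarith
      gcongr
      linarith
    have ha := H.ha
    have haq0 : 0 ≤ H.a - q := by linarith
    refine not_touch_right hε hL h'.hzs (by linarith) hu (by positivity) (e2.trans hp₀) hn ?_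
    have h1 : L * (C * ε * q) ≤ L * (C * ε * H.a) := by gcongr; linarith
    have h2 : (H.a - q) * (2 * H.ζ₁ * H.kh * H.a + 1) ≤ (H.a - q) * (L * H.ζ₀) := by
      gcongr; exact h'.hL
    have h3 : 0 ≤ H.ζ₁ * H.kh * (H.a - q) * H.a := by
      have := H.ζ₁_pos
      positivity
    linarith [h'.hup]
  · rintro ⟨hq₂, hT, -⟩
    have hq₂0 := H.q₂_pos
    have hkl := H.hkl
    have hY := le_Y (μ := μ) hε.le ⟨hq₂, by linarith [H.hq₃]⟩ hu
      (p₀ := H.kl * ρ₁ / 2 * H.q₂) (by positivity) (le_trans (by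
        have := hk.1.1
        gcongr) e1)
    linarith [h'.hlow]

theorem under_face {k μ δ σ q p u Θ : ℝ} (hk : H.Par k μ) (hs : H.s k μ = -δ) (hδ : 0 < δ)
    (hσ : 0 < σ) (hσb : 4 * σ ≤ H.a - H.b) (hRσ : 3 * H.R * σ ≤ 2 * H.kl * δ)
    (hδb : H.α H.kh * δ ≤ H.kl * (H.a - H.b)) (hq : 0 < q) (hqa : q ≤ H.a - σ / 2)
    (hp : p = k * q * (H.a - q) - k * σ * q) (hΘ : |p - q + H.e| ≤ Θ)
    (herr : H.α H.kh * |u - H.ua| * Θ < H.kl ^ 2 * σ * (H.a - H.b) * q) :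
    0 < -(H.pdot k μ q p u - k * (H.a - 2 * q) * p) - k * σ * p := by
  have hk0 := hk.k_pos
  have hklk := hk.1.1
  have hkl := H.hkl
  have hα := H.α_le hk
  have hα0 := H.α_pos hk0
  have hba : 0 < H.a - H.b := by linarith [H.hba]
  have hbl := H.pdot_blowup hk0 μ q (-(k * σ)) ((u - H.ua) / q)
  have hpe : q * (-(k * σ) + k * (H.a - q)) = p := by rw [hp]; ring
  have hue : H.ua + q * ((u - H.ua) / q) = u := by field_simp; ring
  rw [hpe, hue, hs] at hbl
  rw [hbl]
  have e1 : |H.α k * (u - H.ua) * (p - q + H.e)| < H.kl ^ 2 * σ * (H.a - H.b) * q := by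
    rw [abs_mul, abs_mul, abs_of_pos hα0]
    have := hα0.trans_le hα
    exact lt_of_le_of_lt (by gcongr) herr
  have e2 : H.kl ^ 2 * σ * (H.a - H.b) * q ≤ k ^ 2 * σ * (H.a - H.b) * q := by gcongr
  have e3 : -(q * (H.α k * -δ * (-(k * σ) + k * (H.a - q)) + 2 * k * (q - H.b) * -(k * σ) +
      H.α k * ((u - H.ua) / q) * (p - q + H.e))) - k * σ * p =
      q * (k * (H.a - q - σ) * (H.α k * δ - 3 * k * σ) + 2 * k ^ 2 * σ * (H.a - H.b - σ)) -
        H.α k * (u - H.ua) * (p - q + H.e) := by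
    rw [← hpe]; field_simp; ring
  rw [e3]
  have h3 : 0 ≤ H.α k * δ - 3 * k * σ := by
    have hR := H.hR
    have f : H.R * (3 * k * σ) ≤ H.R * (H.α k * δ) := by
      have e : H.R * (H.α k * δ) = k * (2 * k * δ) := by
        rw [show H.R * (H.α k * δ) = H.α k * H.R * δ by ring, H.α_mul_R]; ring
      rw [e]
      calc H.R * (3 * k * σ) = k * (3 * H.R * σ) := by ring
        _ ≤ k * (2 * H.kl * δ) := by gcongr
        _ ≤ k * (2 * k * δ) := by gcongr
    linarith [le_of_mul_le_mul_left f hR]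
  have h4 : H.α k * δ - 3 * k * σ ≤ k * (H.a - H.b) := by
    have f1 : H.α k * δ ≤ H.α H.kh * δ := by gcongr
    have f2 : H.kl * (H.a - H.b) ≤ k * (H.a - H.b) := by gcongr
    have : 0 < 3 * k * σ := by positivity
    linarith
  have h5 : -(k * σ / 2) * (k * (H.a - H.b)) ≤
      k * (H.a - q - σ) * (H.α k * δ - 3 * k * σ) := by
    have f1 : -(k * σ / 2) * (H.α k * δ - 3 * k * σ) ≤
        k * (H.a - q - σ) * (H.α k * δ - 3 * k * σ) := by
      refine mul_le_mul_of_nonneg_right ?_ h3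
      have : k * (-(σ / 2)) ≤ k * (H.a - q - σ) := by gcongr; linarith
      linarith
    have f2 : k * σ / 2 * (H.α k * δ - 3 * k * σ) ≤ k * σ / 2 * (k * (H.a - H.b)) := by gcongr
    linarith
  have h6 : k ^ 2 * σ * (4 * σ) ≤ k ^ 2 * σ * (H.a - H.b) := by gcongr
  have h7 : q * (k ^ 2 * σ * (H.a - H.b)) ≤
      q * (k * (H.a - q - σ) * (H.α k * δ - 3 * k * σ) + 2 * k ^ 2 * σ * (H.a - H.b - σ)) := by
    gcongr
    linarith
  linarith [le_abs_self (H.α k * (u - H.ua) * (p - q + H.e))]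

theorem Traj.undershoot_wedge {ε k μ P δ ρ₁ τ C σ p₁ c C₂ L zs : ℝ} {q p u : ℝ → ℝ}
    (T : H.Traj ε k μ P q p u) (h : H.WedgeHyp ε P δ ρ₁ τ C)
    (h' : H.UnderHyp ε P δ ρ₁ C σ p₁ c C₂ L zs) (hs : H.s k μ = -δ)
    (h0 : H.Start k μ (q 0) (p 0) (u 0)) {t₁ : ℝ} (ht₁ : 0 < t₁)
    (hw : ∀ t ∈ Set.Icc 0 t₁, H.Wedge k ρ₁ τ C ε (q t) (p t) (u t)) :
    0 < k * q t₁ * (H.a - q t₁) - k * σ * q t₁ - p t₁ := by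
  have hk := T.par
  have hk0 := hk.k_pos
  have hσ := h'.hσ
  have hρ := h.hρ₁
  have hcq := T.cq
  have hcp := T.cp
  have hq0 := h0.q_pos
  have key := barrier_pos (n := 2) ![fun t => q t - q 0 / 2,
    fun t => -(p t - k * q t * (H.a - q t)) - k * σ * q t] (s := 0) (T := t₁) ?_ ?_ ?_
  · have := key t₁ ⟨ht₁.le, le_rfl⟩ 1
    simp only [Matrix.cons_val_one, Matrix.cons_val_fin_one] at this
    linarith
  · simp only [Fin.forall_fin_succ, Matrix.cons_val_zero, Matrix.cons_val_succ, IsEmpty.forall_iff,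
      and_true]
    constructor <;> exact Continuous.continuousOn (by fun_prop)
  · simp only [Fin.forall_fin_succ, Matrix.cons_val_zero, Matrix.cons_val_succ, IsEmpty.forall_iff,
      and_true]
    rw [h0.p_eq, hs]
    have : 0 < q 0 * (k * (δ - σ)) := by
      have : 0 < δ - σ := by linarith [h'.hσδ]
      positivity
    exact ⟨by linarith, by linarith⟩
  · intro t ht hall
    simp only [Fin.forall_fin_succ, Matrix.cons_val_zero, Matrix.cons_val_succ, IsEmpty.forall_iff,
      and_true] at hall ⊢
    obtain ⟨b1, -, b3, b4, -, hbox⟩ := (hw t (Set.Ioc_subset_Icc_self ht)).bounds h hk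
    obtain ⟨-, hq1, -, hn⟩ := hw t (Set.Ioc_subset_Icc_self ht)
    have hqt : 0 < q t := by linarith [hall.1]
    have dq := T.dq t hbox
    refine ⟨fun _ => ⟨p t, lt_of_lt_of_le (by positivity) b1, dq.sub_const _⟩, fun hz => ?_⟩
    refine ⟨_, ?_, (T.hasDerivAt_y hbox).neg.sub (dq.const_mul (k * σ))⟩
    have hC := h.hC₀
    have hε := h.hε
    have hα := H.α_pos (H.hkl.trans_le H.hkh)
    refine under_face hk hs h'.hδ hσ h'.hσb h'.hRσ h'.hδb hqt (by linarith [h'.hσρ]) (by linarith)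
      (Θ := H.M * H.a + 1 + H.q₃ + |H.e|) ?_ ?_
    · have hMq : H.M * q t ≤ H.M * H.a := by
        have := H.M_pos
        gcongr; linarith
      have hp0 : 0 ≤ p t := le_trans (by positivity) b1
      have hq₃ := H.hq₃
      refine (abs_add_le _ _).trans ?_
      have : |p t - q t| ≤ |p t| + |q t| := abs_sub _ _
      rw [abs_of_pos hqt, abs_of_nonneg hp0] at this
      linarith
    · have hΘ : 0 < H.M * H.a + 1 + H.q₃ + |H.e| := by
        have := H.M_pos
        have := H.ha
        have := H.q₃_pos
        positivity
      calc H.α H.kh * |u t - H.ua| * (H.M * H.a + 1 + H.q₃ + |H.e|) ≤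
          H.α H.kh * (C * ε * q t) * (H.M * H.a + 1 + H.q₃ + |H.e|) := by gcongr
        _ = q t * (H.α H.kh * C * (H.M * H.a + 1 + H.q₃ + |H.e|) * ε) := by ring
        _ < q t * (H.kl ^ 2 * σ * (H.a - H.b)) := by have := h'.herr; gcongr
        _ = _ := by ring

end Layer

namespace Layer
variable {H : Layer}

/-- States seen while undershooting, right of the section `q = a - ρ₁`. -/
def Under (H : Layer) (k ρ₁ σ p₁ v : ℝ) (q p u : ℝ) : Prop :=
  H.a - 2 * ρ₁ ≤ q ∧ q ≤ H.a - σ / 2 ∧ p ≤ k * q * (H.a - q) - k * σ * q ∧ -p₁ ≤ p ∧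
    |u - H.ua| ≤ v

theorem Under.bounds {ε P δ ρ₁ C σ p₁ c C₂ L zs : ℝ}
    (h : H.UnderHyp ε P δ ρ₁ C σ p₁ c C₂ L zs) (hP : H.M * H.a ≤ P) {k μ q p u : ℝ}
    (hk : H.Par k μ) (hw : H.Under k ρ₁ σ p₁ (C₂ * (H.K * H.a + 1) * ε) q p u) :
    H.q₂ < q ∧ 0 < H.a - q ∧ p ≤ H.kh * H.a * (H.a - q) ∧ p ≤ H.M * H.a ∧ H.Box P q p u := by
  obtain ⟨h1, h2, h3, h4, h5⟩ := hw
  have hq₂ : H.q₂ < q := by linarith [h.hρq]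
  have hσ := h.hσ
  have haq : 0 < H.a - q := by linarith
  have hq₂0 := H.q₂_pos
  have hq0 : 0 < q := by linarith
  have hk0 := hk.k_pos
  have ha := H.ha
  have hkh := hk0.trans_le hk.1.2
  have e1 : p ≤ H.kh * H.a * (H.a - q) := by
    have : k * q * (H.a - q) ≤ H.kh * H.a * (H.a - q) := by
      have := hk.1.2
      gcongr
      linarith
    have : 0 < k * σ * q := by positivity
    linarith
  have e2 : p ≤ H.M * H.a := by
    refine e1.trans ?_
    have : H.kh * H.a * (H.a - q) ≤ H.kh * H.a * (H.a + H.a) := by gcongr; linarith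
    unfold M; linarith
  obtain ⟨h6, h7⟩ := abs_le.1 h5
  refine ⟨hq₂, haq, e1, e2, ⟨by linarith, by linarith [H.hq₃]⟩, ⟨by linarith [h.hp₁P],
    e2.trans hP⟩, by linarith [h.hlo], by linarith [h.hhi]⟩

/-- Growth of `K q - p` while undershooting. -/
theorem Under.growth {ε P δ ρ₁ C σ p₁ c C₂ L zs : ℝ}
    (h : H.UnderHyp ε P δ ρ₁ C σ p₁ c C₂ L zs) (hP : H.M * H.a ≤ P) {k μ q p u : ℝ}
    (hk : H.Par k μ) (hw : H.Under k ρ₁ σ p₁ (C₂ * (H.K * H.a + 1) * ε) q p u) :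
    c ≤ H.K * p - H.pdot k μ q p u := by
  obtain ⟨b1, b2, -, -, hbox⟩ := hw.bounds h hP hk
  obtain ⟨h1, h2, h3, h4, h5⟩ := hw
  have hk0 := hk.k_pos
  have hB := abs_le.1 (abs_B_le hk hbox.2.2)
  have hB0 := hk.B₁_nonneg
  have hK := M_lt_K hB0
  have hM := H.M_pos
  have hα := H.α_le hk
  have hα' := α_kl_le hk
  have hα0 := H.α_pos H.hkl
  have hα1 := H.α_pos hk0
  have hR := H.hR
  have hq₂0 := H.q₂_pos
  have hσ := h.hσ
  have hqb : 0 < H.q₂ - H.b := by linarith [H.hq₂b]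
  have hKB : H.B₁ ≤ H.K := by
    have := H.CF_pos
    have := hα1.trans_le hα
    have : 0 ≤ H.α H.kh * H.CF := by positivity
    unfold K; linarith
  have e1 : -((H.K + H.B₁) * p₁) ≤ (H.K - H.α k * (u + μ)) * p := by
    have f1 : 0 ≤ H.K - H.α k * (u + μ) := by linarith
    have f2 : (H.K - H.α k * (u + μ)) * -p₁ ≤ (H.K - H.α k * (u + μ)) * p := by gcongr
    have f3 : (H.K - H.α k * (u + μ)) * p₁ ≤ (H.K + H.B₁) * p₁ := by
      have := h.hp₁
      gcongr; linarith
    linarith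
  have e2 : H.α H.kl * H.R * H.q₂ * (H.q₂ - H.b) * (σ / 2) ≤
      H.α k * H.R * q * (q - H.b) * (H.a - q) := by
    have : 0 < q := by linarith
    have : 0 < q - H.b := by linarith
    gcongr
    linarith
  have e3 : |H.α k * ((q - H.e) * (u - H.ua))| ≤
      H.α H.kh * ((H.q₃ + |H.e|) * (C₂ * (H.K * H.a + 1) * ε)) := by
    rw [abs_mul, abs_mul, abs_of_pos hα1]
    have f1 : |q - H.e| ≤ H.q₃ + |H.e| := by
      refine (abs_sub _ _).trans ?_
      rw [abs_of_pos (by linarith)]; linarith [H.hq₃]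
    have := hα1.trans_le hα
    have := H.q₃_pos
    gcongr
  have e4 : H.K * p - H.pdot k μ q p u = (H.K - H.α k * (u + μ)) * p +
      H.α k * H.R * q * (q - H.b) * (H.a - q) + H.α k * ((q - H.e) * (u - H.ua)) := by
    unfold pdot F; ring
  rw [e4]
  linarith [h.hcσ, h.hV, h.hp₁c, neg_abs_le (H.α k * ((q - H.e) * (u - H.ua)))]

theorem Traj.undershoot {ε k μ P δ ρ₁ τ C σ p₁ c C₂ L zs : ℝ} {q p u : ℝ → ℝ}
    (T : H.Traj ε k μ P q p u) (h : H.WedgeHyp ε P δ ρ₁ τ C) (ha' : H.AvoidHyp ε ρ₁ C L zs)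
    (h' : H.UnderHyp ε P δ ρ₁ C σ p₁ c C₂ L zs) (hs : H.s k μ = -δ)
    (h0 : H.Start k μ (q 0) (p 0) (u 0)) (hq0 : q 0 < H.a - ρ₁) :
    ∃ t ≥ 0, H.Exit L zs ε μ (-1) (q t) (p t) (u t) ∧
      ∀ t' ∈ Set.Icc 0 t, ¬H.Touch L zs ε μ 1 (q t') (p t') (u t') := by
  have hε := h.hε
  have hk := T.par
  have hk0 := hk.k_pos
  have hkh := hk.1.2
  have hρ := h.hρ₁
  have hσ := h'.hσ
  have hσρ := h'.hσρ
  have hC := h.hC₀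
  have hC₂ : 0 < C₂ := hC.trans h'.hC₂
  have hp₁ := h'.hp₁
  have hc := h'.hc
  have ha := H.ha
  have hM := H.M_pos
  have hMK := M_lt_K hk.B₁_nonneg
  have hK0 : 0 < H.K := by linarith
  have hcq := T.cq
  have hcp := T.cp
  have hcu := T.cu
  have hL := ha'.hL₀
  obtain ⟨t₁, ht₁, hqt₁, hwedge⟩ := T.wedge h
    (by rw [hs, abs_neg, abs_of_pos h'.hδ]) h0 hq0
  have hU := T.undershoot_wedge h h' hs h0 ht₁ hwedge
  obtain ⟨w1, w2, w3, w4, w5, w6⟩ := (hwedge t₁ ⟨ht₁.le, le_rfl⟩).bounds h hk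
  obtain ⟨-, -, -, hn⟩ := hwedge t₁ ⟨ht₁.le, le_rfl⟩
  have hq₁ : 0 < q t₁ := by rw [hqt₁]; linarith [h.hρ₁a]
  have hpt₁ : 0 < p t₁ := lt_of_lt_of_le (by positivity) w1
  set v := C₂ * (H.K * H.a + 1) * ε with hv
  have hP : ∀ S, t₁ ≤ S → (∀ t ∈ Set.Icc t₁ S, -p t ≤ p₁) → ∀ t ∈ Set.Icc t₁ S,
      H.Under k ρ₁ σ p₁ v (q t) (p t) (u t) := by
    intro S _ hpS
    have hunder : ∀ t ∈ Set.Icc t₁ S,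
        0 ≤ H.K * q t - p t - (H.K * q t₁ - p t₁) + p₁ →
        0 ≤ k * q t * (H.a - q t) - k * σ * q t - p t → 0 ≤ H.a - σ / 2 - q t →
        0 ≤ C₂ * ε * (H.K * q t - p t) - (u t - H.ua) →
        0 ≤ C₂ * ε * (H.K * q t - p t) + (u t - H.ua) →
        H.Under k ρ₁ σ p₁ v (q t) (p t) (u t) := by
      intro t ht e0 e1 e2 e3 e4
      have hp := hpS t ht
      have f1 : C₂ * ε * (H.K * q t - p t) ≤ v := by
        have : H.K * q t ≤ H.K * H.a := by gcongr; linarith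
        have : C₂ * ε * (H.K * q t - p t) ≤ C₂ * ε * (H.K * H.a + 1) := by
          gcongr; linarith [h'.hp₁']
        linarith
      refine ⟨?_, by linarith, by linarith, by linarith, abs_le.2 ⟨by linarith, by linarith⟩⟩
      have f2 : p t₁ ≤ H.K * (3 / 4 * ρ₁) := by
        refine w3.trans ?_
        rw [hqt₁, sub_sub_cancel]
        calc 3 / 2 * k * ρ₁ * (H.a - ρ₁) ≤ 3 / 2 * H.kh * ρ₁ * H.a := by
              have : 0 < H.a - ρ₁ := by linarith [h.hρ₁a]
              have := hk0.trans_le hkh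
              gcongr
              linarith
          _ = H.M * (3 / 4 * ρ₁) := by unfold M; ring
          _ ≤ _ := by gcongr; linarith
      have f3 := h'.hp₁ρ
      have : H.K * (H.a - 2 * ρ₁) ≤ H.K * q t := by rw [hqt₁] at e0; linarith
      exact le_of_mul_le_mul_left this hK0
    have key := barrier_pos (n := 5) ![fun t => H.K * q t - p t - (H.K * q t₁ - p t₁) + p₁,
      fun t => -(p t - k * q t * (H.a - q t)) - k * σ * q t, fun t => H.a - σ / 2 - q t,
      fun t => C₂ * ε * (H.K * q t - p t) - (u t - H.ua),
      fun t => C₂ * ε * (H.K * q t - p t) + (u t - H.ua)] (s := t₁) (T := S) ?_ ?_ ?_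
    · intro t ht
      have := key t ht
      simp only [Fin.forall_fin_succ, Matrix.cons_val_zero, Matrix.cons_val_succ,
        IsEmpty.forall_iff, and_true] at this
      obtain ⟨e0, e1, e2, e3, e4⟩ := this
      exact hunder t ht e0.le (by linarith) e2.le e3.le e4.le
    · simp only [Fin.forall_fin_succ, Matrix.cons_val_zero, Matrix.cons_val_succ,
        IsEmpty.forall_iff, and_true]
      refine ⟨?_, ?_, ?_, ?_, ?_⟩ <;> exact Continuous.continuousOn (by fun_prop)
    · simp only [Fin.forall_fin_succ, Matrix.cons_val_zero, Matrix.cons_val_succ,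
        IsEmpty.forall_iff, and_true]
      have f : C * ε * q t₁ < C₂ * ε * (H.K * q t₁ - p t₁) := by
        have f1 : (H.M + 1) * q t₁ ≤ H.K * q t₁ := by gcongr
        have f2 : C * ε * q t₁ < C₂ * ε * q t₁ := by have := h'.hC₂; gcongr
        have f3 : C₂ * ε * q t₁ ≤ C₂ * ε * (H.K * q t₁ - p t₁) := by gcongr; linarith
        linarith
      obtain ⟨g1, g2⟩ := abs_le.1 hn
      exact ⟨by linarith, by linarith, by linarith, by linarith, by linarith⟩
    · intro t ht hall
      have ht' := Set.Ioc_subset_Icc_self ht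
      simp only [Fin.forall_fin_succ, Matrix.cons_val_zero, Matrix.cons_val_succ,
        IsEmpty.forall_iff, and_true] at hall ⊢
      obtain ⟨e0, e1, e2, e3, e4⟩ := hall
      have hu := hunder t ht' e0 (by linarith) e2 e3 e4
      obtain ⟨b1, b2, b3, b4, hbox⟩ := hu.bounds h' h.hP hk
      have hgr := hu.growth h' h.hP hk
      obtain ⟨-, -, -, hpl, hun⟩ := hu
      have dq := T.dq t hbox
      have dp := T.dp t hbox
      have du := T.du t hbox
      have dV := (dq.const_mul H.K).sub dp
      have hq₂0 := H.q₂_pos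
      have hqt : 0 < q t := by linarith
      have hG := abs_G_le hbox.2.2 hqt.le (by linarith [H.hq₃]) μ
      have hC₂c : ε * H.Cg < C₂ * ε * (H.K * p t - H.pdot k μ (q t) (p t) (u t)) := by
        calc ε * H.Cg < ε * (C₂ * c) := by have := h'.hC₂c; gcongr
          _ = C₂ * ε * c := by ring
          _ ≤ _ := by gcongr
      have hεG : |ε * H.G (q t) (u t) μ| ≤ ε * H.Cg := by
        rw [abs_mul, abs_of_pos hε]; gcongr
      obtain ⟨g1, g2⟩ := abs_le.1 hεG
      refine ⟨fun _ => ⟨_, hc.trans_le hgr, (dV.sub_const _).add_const _⟩, fun hz => ?_,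
        fun hz => ⟨-p t, ?_, dq.const_sub _⟩,
        fun _ => ⟨_, by linarith, (dV.const_mul _).sub (du.sub_const _)⟩,
        fun _ => ⟨_, by linarith, (dV.const_mul _).add (du.sub_const _)⟩⟩
      · refine ⟨_, ?_, (T.hasDerivAt_y hbox).neg.sub (dq.const_mul (k * σ))⟩
        have hα := H.α_pos (H.hkl.trans_le H.hkh)
        refine under_face hk hs h'.hδ hσ h'.hσb h'.hRσ h'.hδb hqt (by linarith) (by linarith)
          (Θ := H.M * H.a + 1 + H.q₃ + |H.e|) ?_ ?_
        · refine (abs_add_le _ _).trans ?_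
          have : |p t - q t| ≤ H.M * H.a + 1 + H.q₃ := by
            have := H.hq₃
            have := h'.hp₁'
            have : 0 < H.M * H.a := by positivity
            exact abs_le.2 ⟨by linarith, by linarith⟩
          linarith
        · have hΘ : 0 < H.M * H.a + 1 + H.q₃ + |H.e| := by
            have := H.q₃_pos
            positivity
          calc H.α H.kh * |u t - H.ua| * (H.M * H.a + 1 + H.q₃ + |H.e|) ≤
              H.α H.kh * v * (H.M * H.a + 1 + H.q₃ + |H.e|) := by gcongr
            _ < H.kl ^ 2 * σ * (H.a - H.b) * H.q₂ := by rw [hv]; linarith [h'.herr₂]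
            _ ≤ _ := by
              have : 0 < H.a - H.b := by linarith [H.hba]
              gcongr
      · have : 0 < k * (σ / 2) * q t := by positivity
        have hqe : H.a - q t = σ / 2 := by linarith
        rw [hqe] at e1
        linarith
  obtain ⟨t₂, ht₂, he, hall⟩ := reach_level (f := fun t => -p t)
    (V := fun t => H.K * q t - p t) (c := p₁) (κ := c) (B := H.K * H.a + p₁) (s := t₁)
    (P := fun t => H.Under k ρ₁ σ p₁ v (q t) (p t) (u t)) hcp.neg hc (by linarith) hP
    (fun t _ hu _ => by
      obtain ⟨-, -, -, -, hbox⟩ := hu.bounds h' h.hP hk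
      exact ⟨_, hu.growth h' h.hP hk, ((T.dq t hbox).const_mul H.K).sub (T.dp t hbox)⟩)
    (fun t _ hu hp => by
      obtain ⟨b1, b2, -, -, -⟩ := hu.bounds h' h.hP hk
      have : H.K * q t ≤ H.K * H.a := by gcongr; linarith
      linarith)
  refine ⟨t₂, by linarith, ?_, ?_⟩
  · have hu := (hall t₂ ⟨ht₂.le, le_rfl⟩).2
    obtain ⟨b1, b2, -, -, hbox⟩ := hu.bounds h' h.hP hk
    obtain ⟨-, c2, -, -, c5⟩ := hu
    have hqq : q t₂ ∈ Set.Icc H.q₂ H.q₃ := ⟨b1.le, by linarith [H.hq₃]⟩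
    have hY := Y_neg (μ := μ) hε.le hqq hbox.2.2 hp₁.le (by linarith : p t₂ ≤ -p₁)
    have hZ := Z_le (u := u t₂) hqq (by linarith)
    have hYn : H.Y ε μ (q t₂) (p t₂) (u t₂) < 0 := by linarith [h'.hY]
    refine ⟨b1, by linarith, ?_⟩
    have : H.Z (q t₂) (u t₂) < -(zs * ε) := by
      have : H.ζ₀ * (σ / 2) ≤ H.ζ₀ * (H.a - q t₂) := by
        have := H.hζ₀
        gcongr; linarith
      linarith [h'.hz]
    have := mul_lt_mul_of_pos_left this hL
    linarith
  · intro t ht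
    rcases le_total t t₁ with htt | htt
    · exact (hwedge t ⟨ht.1, htt⟩).not_touch h ha' hk (Or.inl rfl)
    · have hu := (hall t ⟨htt, ht.2⟩).2
      obtain ⟨b1, b2, b3, -, hbox⟩ := hu.bounds h' h.hP hk
      obtain ⟨-, c2, -, -, c5⟩ := hu
      have hkh0 := hk0.trans_le hkh
      refine not_touch_right hε hL ha'.hzs (by linarith) hbox.2.2
        (by positivity : 0 ≤ H.kh * H.a * (H.a - q t)) b3 c5 ?_
      have h2 : (H.a - q t) * (2 * H.ζ₁ * H.kh * H.a + 1) ≤ (H.a - q t) * (L * H.ζ₀) := by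
        gcongr; exact ha'.hL
      have h3 : 0 ≤ H.ζ₁ * H.kh * (H.a - q t) * H.a := by
        have := H.ζ₁_pos
        positivity
      linarith [h'.hup]

end Layer

/-- Retraction of `ℝ` onto `[a, b]`. -/
def clampIcc (a b x : ℝ) : ℝ := max a (min b x)

theorem lipschitzWith_clampIcc (a b : ℝ) : LipschitzWith 1 (clampIcc a b) :=
  (LipschitzWith.id.const_min b).const_max a

theorem clampIcc_mem {a b : ℝ} (h : a ≤ b) (x : ℝ) : clampIcc a b x ∈ Set.Icc a b :=
  ⟨le_max_left _ _, max_le h (min_le_left _ _)⟩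

theorem clampIcc_eq {a b x : ℝ} (hx : x ∈ Set.Icc a b) : clampIcc a b x = x := by
  unfold clampIcc
  rw [min_eq_right hx.2, max_eq_right hx.1]

theorem HasDerivAt.fst' {E F : Type*} [NormedAddCommGroup E] [NormedSpace ℝ E]
    [NormedAddCommGroup F] [NormedSpace ℝ F] {f : ℝ → E × F} {f' : E × F} {t : ℝ}
    (h : HasDerivAt f f' t) : HasDerivAt (fun t => (f t).1) f'.1 t :=
  (ContinuousLinearMap.fst ℝ E F).hasFDerivAt.comp_hasDerivAt t h

theorem HasDerivAt.snd' {E F : Type*} [NormedAddCommGroup E] [NormedSpace ℝ E]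
    [NormedAddCommGroup F] [NormedSpace ℝ F] {f : ℝ → E × F} {f' : E × F} {t : ℝ}
    (h : HasDerivAt f f' t) : HasDerivAt (fun t => (f t).2) f'.2 t :=
  (ContinuousLinearMap.snd ℝ E F).hasFDerivAt.comp_hasDerivAt t h

/-- Composing a `C¹` vector field on a convex compact set with a Lipschitz retraction onto this
set gives a globally Lipschitz and bounded field. -/
theorem exists_lipschitz_extension {E : Type*} [NormedAddCommGroup E] [NormedSpace ℝ E]
    {W c : E → E} {S : Set E} (hS : Convex ℝ S) (hS' : IsCompact S) (hW : ContDiffOn ℝ 1 W S)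
    {Kc : NNReal} (hc : LipschitzWith Kc c) (hcS : ∀ x, c x ∈ S) :
    ∃ K M : NNReal, LipschitzWith K (W ∘ c) ∧ ∀ x, ‖(W ∘ c) x‖ ≤ M := by
  obtain ⟨K, hK⟩ := hW.exists_lipschitzOnWith one_ne_zero hS hS'
  obtain ⟨M, hM⟩ := hS'.exists_bound_of_continuousOn hW.continuousOn
  refine ⟨K * Kc, M.toNNReal, ?_, fun x => (hM _ (hcS x)).trans (Real.le_coe_toNNReal M)⟩
  have := hK.comp hc.lipschitzOnWith (s := Set.univ) (fun x _ => hcS x)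
  exact lipschitzOnWith_univ.1 this

namespace Layer
variable {H : Layer}

/-- The layer system together with its constant parameters `k` and `μ`. -/
def field (H : Layer) (ε : ℝ) (x : ℝ × ℝ × ℝ × ℝ × ℝ) : ℝ × ℝ × ℝ × ℝ × ℝ :=
  (x.2.1, H.pdot x.2.2.2.1 x.2.2.2.2 x.1 x.2.1 x.2.2.1, ε * H.G x.1 x.2.2.1 x.2.2.2.2, 0, 0)

/-- Retraction onto the region where the layer system is solved. -/
def clampBox (H : Layer) (P : ℝ) (x : ℝ × ℝ × ℝ × ℝ × ℝ) : ℝ × ℝ × ℝ × ℝ × ℝ :=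
  (clampIcc (-1) (H.q₃ + 1) x.1, clampIcc (-P) P x.2.1, clampIcc H.ulo H.uhi x.2.2.1,
    clampIcc H.kl H.kh x.2.2.2.1, clampIcc H.μl H.μh x.2.2.2.2)

def bigBox (H : Layer) (P : ℝ) : Set (ℝ × ℝ × ℝ × ℝ × ℝ) :=
  Set.Icc (-1) (H.q₃ + 1) ×ˢ Set.Icc (-P) P ×ˢ Set.Icc H.ulo H.uhi ×ˢ Set.Icc H.kl H.kh ×ˢ
    Set.Icc H.μl H.μh

theorem contDiffOn_field (ε P : ℝ) : ContDiffOn ℝ 1 (H.field ε) (H.bigBox P) := by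
  have h1 : ContDiffOn ℝ 1 (fun x : ℝ × ℝ × ℝ × ℝ × ℝ => (x.2.1,
      H.pdot x.2.2.2.1 x.2.2.2.2 x.1 x.2.1 x.2.2.1,
      ε * (H.gn x.1 x.2.2.1 / (x.2.2.1 + H.ζ + x.2.2.2.2)), (0 : ℝ), (0 : ℝ))) (H.bigBox P) := by
    have hd : ∀ x ∈ H.bigBox P, x.2.2.1 + H.ζ + x.2.2.2.2 ≠ 0 := by
      rintro x ⟨-, -, hu, -, hμ⟩
      have := (H.hden _ hu _ hμ).1
      linarith [H.hd₀]
    unfold pdot α F gn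
    fun_prop (disch := assumption)
  refine h1.congr ?_
  rintro x ⟨-, -, hu, hk, hμ⟩
  unfold field G
  rw [den_eq ⟨hk, hμ⟩ hu]

/-- The flow of the layer system, cut off outside of `Box P`. -/
theorem exists_flow (H : Layer) (ε : ℝ) {P : ℝ} (hP : 0 ≤ P) (hμ : H.μl ≤ H.μh) :
    ∃ Φ : ℝ × ℝ × ℝ × ℝ × ℝ → ℝ → ℝ × ℝ × ℝ × ℝ × ℝ, (∀ x, Φ x 0 = x) ∧
      (∀ x s t, Φ (Φ x s) t = Φ x (s + t)) ∧ Continuous (Function.uncurry Φ) ∧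
      (∀ x t, (Φ x t).2.2.2 = x.2.2.2) ∧
      ∀ x, H.Par x.2.2.2.1 x.2.2.2.2 → H.Traj ε x.2.2.2.1 x.2.2.2.2 P (fun t => (Φ x t).1)
        (fun t => (Φ x t).2.1) (fun t => (Φ x t).2.2.1) := by
  have hq₃ := H.q₃_pos
  have hconv : Convex ℝ (H.bigBox P) := (convex_Icc _ _).prod ((convex_Icc _ _).prod
    ((convex_Icc _ _).prod ((convex_Icc _ _).prod (convex_Icc _ _))))
  have hcomp : IsCompact (H.bigBox P) := isCompact_Icc.prod (isCompact_Icc.prod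
    (isCompact_Icc.prod (isCompact_Icc.prod isCompact_Icc)))
  have hlip : LipschitzWith _ (H.clampBox P) :=
    ((lipschitzWith_clampIcc _ _).comp LipschitzWith.prod_fst).prodMk <|
    ((lipschitzWith_clampIcc _ _).comp (LipschitzWith.prod_fst.comp LipschitzWith.prod_snd)).prodMk
    <| ((lipschitzWith_clampIcc _ _).comp (LipschitzWith.prod_fst.comp
      (LipschitzWith.prod_snd.comp LipschitzWith.prod_snd))).prodMk <|
    ((lipschitzWith_clampIcc _ _).comp (LipschitzWith.prod_fst.comp
      (LipschitzWith.prod_snd.comp (LipschitzWith.prod_snd.comp LipschitzWith.prod_snd)))).prodMk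
    ((lipschitzWith_clampIcc _ _).comp (LipschitzWith.prod_snd.comp
      (LipschitzWith.prod_snd.comp (LipschitzWith.prod_snd.comp LipschitzWith.prod_snd))))
  have hmem : ∀ x, H.clampBox P x ∈ H.bigBox P := fun x =>
    ⟨clampIcc_mem (by linarith) _, clampIcc_mem (by linarith) _,
      clampIcc_mem (H.hua.1.trans H.hua.2).le _, clampIcc_mem H.hkh _, clampIcc_mem hμ _⟩
  obtain ⟨K, M, hK, hM⟩ := exists_lipschitz_extension hconv hcomp (H.contDiffOn_field ε P) hlip hmem
  obtain ⟨Φ, h0, hd, hs, hc⟩ := exists_global_flow hK hM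
  have hpar : ∀ x t, (Φ x t).2.2.2 = x.2.2.2 := fun x t => by
    have h : ∀ t, HasDerivAt (fun t => (Φ x t).2.2.2) 0 t := fun t => (hd x t).snd'.snd'.snd'
    have := is_const_of_deriv_eq_zero (fun t => (h t).differentiableAt) (fun t => (h t).deriv) t 0
    simpa [h0] using this
  have hcx : ∀ x, Continuous (Φ x) := fun x => hc.comp (Continuous.prodMk_right x)
  have hcl : ∀ x t, H.Par x.2.2.2.1 x.2.2.2.2 → H.Box P (Φ x t).1 (Φ x t).2.1 (Φ x t).2.2.1 →
      H.clampBox P (Φ x t) = ((Φ x t).1, (Φ x t).2.1, (Φ x t).2.2.1, x.2.2.2) := by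
    intro x t hp hb
    unfold clampBox
    rw [hpar, clampIcc_eq hb.1, clampIcc_eq hb.2.1, clampIcc_eq hb.2.2, clampIcc_eq hp.1,
      clampIcc_eq hp.2]
  refine ⟨Φ, h0, hs, hc, hpar, fun x hp => ⟨hp, (hcx x).fst, (hcx x).snd.fst, (hcx x).snd.snd.fst,
    fun t hb => ?_, fun t hb => ?_, fun t hb => ?_⟩⟩
  · have := (hd x t).fst'
    simpa only [Function.comp_apply, hcl x t hp hb, field] using this
  · have := (hd x t).snd'.fst'
    simpa only [Function.comp_apply, hcl x t hp hb, field] using this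
  · have := (hd x t).snd'.snd'.fst'
    simpa only [Function.comp_apply, hcl x t hp hb, field] using this

end Layer

/-- The curve `φ` reaches `E` in forward time before it meets `T`. -/
def ReachesBefore {X : Type*} (φ : ℝ → X) (E T : Set X) : Prop :=
  ∃ t ≥ 0, φ t ∈ E ∧ ∀ t' ∈ Set.Icc 0 t, φ t' ∉ T

theorem isOpen_reachesBefore {X : Type*} [TopologicalSpace X] {Φ : X → ℝ → X}
    (hΦ : Continuous (Function.uncurry Φ)) {E T : Set X} (hE : IsOpen E) (hT : IsClosed T) :
    IsOpen {x | ReachesBefore (Φ x) E T} := by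
  have hrw : {x | ReachesBefore (Φ x) E T} =
      ⋃ t ∈ Set.Ici (0 : ℝ), ({x | Φ x t ∈ E} ∩ {x | ∀ t' ∈ Set.Icc 0 t, Φ x t' ∉ T}) := by
    ext x
    simp [ReachesBefore, and_left_comm]
  rw [hrw]
  refine isOpen_biUnion fun t _ => (hE.preimage (hΦ.comp (Continuous.prodMk_left t))).inter ?_
  refine isOpen_iff_eventually.2 fun x hx => ?_
  refine isCompact_Icc.eventually_forall_of_forall_eventually (P := fun x t' => Φ x t' ∉ T)
    fun t' ht' => ?_
  exact (hT.isOpen_compl.preimage hΦ).mem_nhds (hx t' ht')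

theorem ReachesBefore.not_reachesBefore {X : Type*} {φ : ℝ → X} {E T E' T' : Set X}
    (hE : E ⊆ T) (hE' : E' ⊆ T') (h : ReachesBefore φ E T') : ¬ReachesBefore φ E' T := by
  rintro ⟨t', ht', h1', h2'⟩
  obtain ⟨t, ht, h1, h2⟩ := h
  rcases le_total t t' with htt | htt
  · exact h2' t ⟨ht, htt⟩ (hE h1)
  · exact h2 t' ⟨ht', htt⟩ (hE' h1')

namespace Layer
variable (H : Layer)

def exitSet (L zs ε s : ℝ) : Set (ℝ × ℝ × ℝ × ℝ × ℝ) :=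
  {x | H.Exit L zs ε x.2.2.2.2 s x.1 x.2.1 x.2.2.1}

def touchSet (L zs ε s : ℝ) : Set (ℝ × ℝ × ℝ × ℝ × ℝ) :=
  {x | H.Touch L zs ε x.2.2.2.2 s x.1 x.2.1 x.2.2.1}

/-- Initial point of the shooting argument at height `q` for the parameters `θ = (k, μ)`. -/
def start (q : ℝ) (θ : ℝ × ℝ) : ℝ × ℝ × ℝ × ℝ × ℝ :=
  (q, q * (θ.1 * (H.a - q) + (θ.1 * (H.ua + θ.2) - H.R * (H.a - 2 * H.b) / 2)), H.ua, θ)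

/-- Solutions of the layer system from `(0, 0, ua)` to `(qT, 0, uT)`. -/
structure Connection (ε k μ : ℝ) (q p u : ℝ → ℝ) : Prop where
  hu : ∀ t, u t ∈ Set.Icc H.ulo H.uhi
  dq : ∀ t, HasDerivAt q (p t) t
  dp : ∀ t, HasDerivAt p (H.pdot k μ (q t) (p t) (u t)) t
  du : ∀ t, HasDerivAt u (ε * H.G (q t) (u t) μ) t
  q_bot : Tendsto q atBot (𝓝 0)
  p_bot : Tendsto p atBot (𝓝 0)
  u_bot : Tendsto u atBot (𝓝 H.ua)
  q_top : Tendsto q atTop (𝓝 H.qT)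
  p_top : Tendsto p atTop (𝓝 0)
  u_top : Tendsto u atTop (𝓝 H.uT)

variable {H}

theorem continuous_Z_param :
    Continuous fun x : ℝ × ℝ × ℝ × ℝ × ℝ => H.Z x.1 x.2.2.1 := by
  unfold Z; fun_prop

theorem continuous_Y_param (ε : ℝ) :
    Continuous fun x : ℝ × ℝ × ℝ × ℝ × ℝ => H.Y ε x.2.2.2.2 x.1 x.2.1 x.2.2.1 := by
  have h : Continuous fun x : ℝ × ℝ × ℝ × ℝ × ℝ => H.G x.1 x.2.2.1 x.2.2.2.2 := by
    unfold G
    refine Continuous.div (by unfold gn; fun_prop) (by unfold den; fun_prop)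
      fun x => (H.den_pos _ _).ne'
  unfold Y dZ
  fun_prop

theorem isOpen_exitSet (L zs ε s : ℝ) : IsOpen (H.exitSet L zs ε s) := by
  have h2 := H.continuous_Y_param ε
  have h3 := H.continuous_Z_param
  exact (isOpen_lt continuous_const continuous_fst).inter
    ((isOpen_lt continuous_const (continuous_const.mul h2)).inter
      (isOpen_lt continuous_const (continuous_const.mul (h2.add (continuous_const.mul h3)))))

theorem isClosed_touchSet (L zs ε s : ℝ) : IsClosed (H.touchSet L zs ε s) := by
  have h2 := H.continuous_Y_param ε
  have h3 := H.continuous_Z_param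
  exact (isClosed_le continuous_const continuous_fst).inter
    ((isClosed_le continuous_const (continuous_const.mul h2)).inter
      (isClosed_le continuous_const (continuous_const.mul (h2.add (continuous_const.mul h3)))))

theorem exitSet_subset (L zs ε s : ℝ) : H.exitSet L zs ε s ⊆ H.touchSet L zs ε s :=
  fun _ h => Exit.touch h

theorem isClosed_wedge_param (ρ₁ τ C ε : ℝ) :
    IsClosed {x : ℝ × ℝ × ℝ × ℝ × ℝ | H.Wedge x.2.2.2.1 ρ₁ τ C ε x.1 x.2.1 x.2.2.1} := by
  refine (isClosed_le continuous_const continuous_fst).inter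
    ((isClosed_le continuous_fst continuous_const).inter (IsClosed.inter ?_ ?_))
  · refine isClosed_le (f := fun x : ℝ × ℝ × ℝ × ℝ × ℝ =>
      |x.2.1 - x.2.2.2.1 * x.1 * (H.a - x.1)| * (H.a - x.1) ^ 3) (g := fun x => τ * x.1) ?_ ?_ <;>
      fun_prop
  · refine isClosed_le (f := fun x : ℝ × ℝ × ℝ × ℝ × ℝ => |x.2.2.1 - H.ua|)
      (g := fun x => C * ε * x.1) ?_ ?_ <;> fun_prop

theorem isClosed_blk_param (L ρ ε : ℝ) :
    IsClosed {x : ℝ × ℝ × ℝ × ℝ × ℝ | H.Blk L ρ ε x.2.2.2.2 x.1 x.2.1 x.2.2.1} := by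
  have h2 := H.continuous_Y_param ε
  have h3 := H.continuous_Z_param
  exact (isClosed_Icc.preimage continuous_fst).inter ((isClosed_Icc.preimage (by fun_prop)).inter
    ((isClosed_le h3.abs continuous_const).inter (isClosed_le h2.abs continuous_const)))

theorem continuous_start (q : ℝ) : Continuous (H.start q) := by
  unfold start; fun_prop

theorem start_isStart {q : ℝ} (hq : 0 < q) {θ : ℝ × ℝ} (hθ : H.Par θ.1 θ.2) :
    H.Start θ.1 θ.2 (H.start q θ).1 (H.start q θ).2.1 (H.start q θ).2.2.1 := by
  have := hθ.k_pos
  refine ⟨hq, ?_, rfl⟩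
  simp only [start, s]
  field_simp

theorem abs_Z_le {q u : ℝ} (hq : q ∈ Set.Icc H.q₂ H.q₃) (hqa : q ≤ H.a) :
    |H.Z q u| ≤ H.ζ₁ * (H.a - q) + |u - H.ua| := by
  have h0 := Z_le (u := u) hq hqa
  have h1 := (H.hζ q hq).2
  have h2 := (H.hζ H.a ⟨H.hq₂.le, H.hq₃.le⟩).2
  have h3 : H.Z q u = -((H.a - q) * (H.z₂ * (q + H.a) + H.z₁)) - H.ν * (u - H.ua) := by
    unfold Z; linear_combination H.hZa
  have h4 : (H.a - q) * (H.z₂ * (q + H.a) + H.z₁) ≤ (H.a - q) * H.ζ₁ := by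
    gcongr
    linarith
  have h5 : |H.ν * (u - H.ua)| ≤ 1 * |u - H.ua| := by
    rw [abs_mul, abs_of_nonneg H.hν₀]
    have := H.hν₁
    gcongr
  have h6 : 0 ≤ H.ζ₀ * (H.a - q) := mul_nonneg H.hζ₀.le (by linarith)
  have h7 : 0 ≤ H.ζ₁ * (H.a - q) := mul_nonneg ζ₁_pos.le (by linarith)
  rw [abs_le]
  constructor
  · rw [h3]
    linarith [le_abs_self (H.ν * (u - H.ua))]
  · linarith

theorem exists_connection {ε P δ ρ₁ τ C L zs ρ η : ℝ} (h : H.WedgeHyp ε P δ ρ₁ τ C)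
    (ha' : H.AvoidHyp ε ρ₁ C L zs) (hb : H.BlockHyp ε P ρ η L zs) (hq₂ : H.q₂ < H.a - ρ₁)
    (hZ : H.ζ₁ * ρ₁ + C * ε * H.a < ρ)
    {Φ : ℝ × ℝ × ℝ × ℝ × ℝ → ℝ → ℝ × ℝ × ℝ × ℝ × ℝ} (hΦ0 : ∀ x, Φ x 0 = x)
    (hΦs : ∀ x s t, Φ (Φ x s) t = Φ x (s + t)) (hΦc : Continuous (Function.uncurry Φ))
    (hΦp : ∀ x t, (Φ x t).2.2.2 = x.2.2.2)
    (hΦT : ∀ x, H.Par x.2.2.2.1 x.2.2.2.2 → H.Traj ε x.2.2.2.1 x.2.2.2.2 P (fun t => (Φ x t).1)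
      (fun t => (Φ x t).2.1) (fun t => (Φ x t).2.2.1))
    {θ : ℕ → ℝ × ℝ} {θ' : ℝ × ℝ} {qs : ℕ → ℝ} (hqs : ∀ j, 0 < qs j ∧ qs j < H.a - ρ₁)
    (hqs0 : Tendsto qs atTop (𝓝 0)) (hθ : ∀ j, H.Par (θ j).1 (θ j).2)
    (hs : ∀ j, |H.s (θ j).1 (θ j).2| ≤ δ) (hlim : Tendsto θ atTop (𝓝 θ'))
    (hno : ∀ j, ∀ s, s = 1 ∨ s = -1 → ¬ReachesBefore (Φ (H.start (qs j) (θ j)))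
      (H.exitSet L zs ε s) (H.touchSet L zs ε (-s))) :
    ∃ q p u, H.Connection ε θ'.1 θ'.2 q p u := by
  have hε := h.hε
  have hM := M_pos (H := H)
  have hρ₁ := h.hρ₁
  have ha := H.ha
  have hCε : 0 < C * ε := mul_pos h.hC₀ hε
  have hT := fun j => hΦT (H.start (qs j) (θ j)) (hθ j)
  have hst := fun j => start_isStart (hqs j).1 (hθ j)
  have hw : ∀ j, ∃ t > 0, (Φ (H.start (qs j) (θ j)) t).1 = H.a - ρ₁ ∧
      ∀ t' ∈ Set.Icc 0 t, H.Wedge (θ j).1 ρ₁ τ C ε (Φ (H.start (qs j) (θ j)) t').1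
        (Φ (H.start (qs j) (θ j)) t').2.1 (Φ (H.start (qs j) (θ j)) t').2.2.1 := by
    intro j
    refine (hT j).wedge h (hs j) ?_ ?_
    · simp only [hΦ0]; exact hst j
    · simp only [hΦ0]; exact (hqs j).2
  choose t ht hqt hw using hw
  have hblk : ∀ j, ∀ t' ≥ t j, H.Blk L ρ ε (θ j).2 (Φ (H.start (qs j) (θ j)) t').1
        (Φ (H.start (qs j) (θ j)) t').2.1 (Φ (H.start (qs j) (θ j)) t').2.2.1 := by
    intro j
    have hwt := hw j (t j) ⟨(ht j).le, le_rfl⟩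
    have hu : |(Φ (H.start (qs j) (θ j)) (t j)).2.2.1 - H.ua| < C * ε * H.a := by
      refine hwt.2.2.2.trans_lt ?_
      rw [hqt j]
      gcongr
      linarith
    have hq3 : H.a - ρ₁ < H.q₃ := by linarith [H.hq₃]
    refine (hT j).stay_forever hb ha'.hL₀ ha'.hzs (ht j).le ?_ ?_ ?_ ?_ ?_ ?_
    · simpa only [hqt j] using hq₂
    · simpa only [hqt j] using hq3
    · have := abs_Z_le (u := (Φ (H.start (qs j) (θ j)) (t j)).2.2.1) (q := H.a - ρ₁)
        ⟨hq₂.le, hq3.le⟩ (by linarith)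
      simp only [hqt j]
      rw [sub_sub_cancel] at this
      linarith
    · have := abs_lt.1 hu
      constructor
      · linarith [h.hlo]
      · linarith [h.hhi]
    · intro t' ht' s hs
      exact (hw j t' ht').not_touch h ha' (hθ j) hs
    · intro s hs t₁ ht₁ hE
      by_contra! hc
      exact hno j s hs ⟨t₁, ht₁, by simpa only [exitSet, Set.mem_ofPred_eq, hΦp] using hE,
        fun t' ht' => by simpa only [touchSet, Set.mem_ofPred_eq, hΦp] using hc t' ht'⟩
  have htop : Tendsto t atTop atTop := by
    refine tendsto_atTop.2 fun B => ?_
    have h1 : 0 < (H.a - ρ₁) * Real.exp (-(H.M * B)) :=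
      mul_pos (by linarith [h.hρ₁a]) (Real.exp_pos _)
    filter_upwards [hqs0.eventually (gt_mem_nhds h1)] with j hj
    have h2 := growth_of_hasDerivAt (V := fun t => -((Φ (H.start (qs j) (θ j)) t).1 *
      Real.exp (-(H.M * t)))) (κ := 0) (ht j).le (fun t' ht' => by
        obtain ⟨-, -, -, e1, -, e2⟩ := (hw j t' ht').bounds h (hθ j)
        have hexp : HasDerivAt (fun t => Real.exp (-(H.M * t)))
            (Real.exp (-(H.M * t')) * (-(H.M * 1))) t' :=
          (((hasDerivAt_id' t').const_mul H.M).neg).exp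
        refine ⟨_, ?_, (((hT j).dq t' e2).mul hexp).neg⟩
        have := Real.exp_pos (-(H.M * t'))
        nlinarith)
    simp only [hΦ0, hqt j, mul_zero, neg_zero, Real.exp_zero, mul_one, zero_mul, add_zero] at h2
    have h3 : (H.a - ρ₁) * Real.exp (-(H.M * t j)) < (H.a - ρ₁) * Real.exp (-(H.M * B)) := by
      have : (H.start (qs j) (θ j)).1 = qs j := rfl
      linarith
    have h4 := Real.exp_lt_exp.1 (lt_of_mul_lt_mul_left h3 (by linarith [h.hρ₁a]))
    nlinarith
  have hcomp : IsCompact (H.bigBox P) := isCompact_Icc.prod (isCompact_Icc.prod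
    (isCompact_Icc.prod (isCompact_Icc.prod isCompact_Icc)))
  obtain ⟨x, -, φ, hφ, hx⟩ := hcomp.tendsto_subseq
    (x := fun j => Φ (H.start (qs j) (θ j)) (t j)) (fun j => by
      obtain ⟨-, -, -, -, -, e⟩ := (hw j (t j) ⟨(ht j).le, le_rfl⟩).bounds h (hθ j)
      refine ⟨e.1, e.2.1, e.2.2, ?_, ?_⟩
      · rw [hΦp]; exact (hθ j).1
      · rw [hΦp]; exact (hθ j).2)
  have hpar : x.2.2.2 = θ' := by
    refine tendsto_nhds_unique ((continuous_snd.comp (continuous_snd.comp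
      continuous_snd)).continuousAt.tendsto.comp hx) ?_
    simpa only [Function.comp_def, hΦp, start] using hlim.comp hφ.tendsto_atTop
  have hxt : ∀ s, Tendsto (fun j => Φ (H.start (qs (φ j)) (θ (φ j))) (t (φ j) + s)) atTop
      (𝓝 (Φ x s)) := by
    intro s
    have := (hΦc.comp (Continuous.prodMk_left s)).continuousAt.tendsto.comp hx
    simpa only [Function.comp_def, Function.uncurry_apply_pair, hΦs] using this
  have hPar : H.Par x.2.2.2.1 x.2.2.2.2 := by
    rw [hpar]
    exact (isClosed_Icc.prod isClosed_Icc).mem_of_tendsto (s := Set.Icc H.kl H.kh ×ˢ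
      Set.Icc H.μl H.μh) hlim (Eventually.of_forall fun j => hθ j)
  have hback : ∀ s ≤ 0, H.Wedge x.2.2.2.1 ρ₁ τ C ε (Φ x s).1 (Φ x s).2.1 (Φ x s).2.2.1 := by
    intro s hs0
    have := (isClosed_wedge_param ρ₁ τ C ε).mem_of_tendsto (hxt s) (by
      filter_upwards [(htop.comp hφ.tendsto_atTop).eventually_ge_atTop (-s)] with j hj
      simp only [Function.comp_apply] at hj
      simp only [hΦp]
      exact hw (φ j) _ ⟨by linarith, by linarith⟩)
    simpa only [Set.mem_ofPred_eq, hΦp] using this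
  have hfwd : ∀ s ≥ 0, H.Blk L ρ ε x.2.2.2.2 (Φ x s).1 (Φ x s).2.1 (Φ x s).2.2.1 := by
    intro s hs0
    have := (isClosed_blk_param L ρ ε).mem_of_tendsto (hxt s) (Eventually.of_forall fun j => by
      simp only [Set.mem_ofPred_eq, hΦp]
      exact hblk (φ j) _ (by linarith))
    simpa only [Set.mem_ofPred_eq, hΦp] using this
  have hTx := hΦT x hPar
  have hbox : ∀ s, H.Box P (Φ x s).1 (Φ x s).2.1 (Φ x s).2.2.1 := by
    intro s
    rcases le_total s 0 with hs0 | hs0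
    · exact ((hback s hs0).bounds h hPar).2.2.2.2.2
    · exact hb.box (hfwd s hs0)
  have hk := hPar.k_pos
  have hq0 : Tendsto (fun t => (Φ x t).1) atBot (𝓝 0) := by
    set c := x.2.2.2.1 * ρ₁ / 2 with hc
    have hc0 : 0 < c := by positivity
    have hle : ∀ s ≤ 0, (Φ x s).1 ≤ (Φ x 0).1 * Real.exp (c * s) := by
      intro s hs0
      have h2 := growth_of_hasDerivAt (V := fun t => (Φ x t).1 * Real.exp (-(c * t))) (κ := 0) hs0
        (fun t' ht' => by
          have e1 : c * (Φ x t').1 ≤ (Φ x t').2.1 := ((hback t' ht'.2).bounds h hPar).1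
          have hexp : HasDerivAt (fun t => Real.exp (-(c * t)))
              (Real.exp (-(c * t')) * (-(c * 1))) t' :=
            (((hasDerivAt_id' t').const_mul c).neg).exp
          refine ⟨_, ?_, (hTx.dq t' (hbox t')).mul hexp⟩
          have := mul_nonneg (sub_nonneg.2 e1) (Real.exp_pos (-(c * t'))).le
          simp only [ge_iff_le]
          linarith)
      simp only [mul_zero, neg_zero, Real.exp_zero, mul_one, zero_mul, add_zero] at h2
      rw [Real.exp_neg] at h2
      have := Real.exp_pos (c * s)
      rwa [← div_eq_mul_inv, div_le_iff₀ this] at h2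
    have hlim0 : Tendsto (fun s => (Φ x 0).1 * Real.exp (c * s)) atBot (𝓝 0) := by
      simpa using (Real.tendsto_exp_atBot.comp (tendsto_id.const_mul_atBot hc0)).const_mul (Φ x 0).1
    refine tendsto_of_tendsto_of_tendsto_of_le_of_le' tendsto_const_nhds hlim0 ?_ ?_
    · filter_upwards [eventually_le_atBot 0] with s hs0 using (hback s hs0).1
    · filter_upwards [eventually_le_atBot 0] with s hs0 using hle s hs0
  obtain ⟨hqT, hpT, huT⟩ := hTx.tendsto hb hfwd
  have hkθ : x.2.2.2.1 = θ'.1 := by rw [hpar]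
  have hμθ : x.2.2.2.2 = θ'.2 := by rw [hpar]
  refine ⟨fun t => (Φ x t).1, fun t => (Φ x t).2.1, fun t => (Φ x t).2.2.1,
    fun s => (hbox s).2.2, fun s => hTx.dq s (hbox s), fun s => ?_, fun s => ?_, hq0, ?_, ?_,
    hqT, hpT, huT⟩
  · rw [← hkθ, ← hμθ]; exact hTx.dp s (hbox s)
  · rw [← hμθ]; exact hTx.du s (hbox s)
  · refine tendsto_of_tendsto_of_tendsto_of_le_of_le' tendsto_const_nhds
      (by simpa using hq0.const_mul H.M) ?_ ?_
    · filter_upwards [eventually_le_atBot 0] with s hs0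
      have := ((hback s hs0).bounds h hPar).1
      have := (hback s hs0).1
      refine le_trans ?_ ((hback s hs0).bounds h hPar).1
      positivity
    · filter_upwards [eventually_le_atBot 0] with s hs0
      exact ((hback s hs0).bounds h hPar).2.2.2.1
  · rw [tendsto_iff_dist_tendsto_zero]
    refine tendsto_of_tendsto_of_tendsto_of_le_of_le' tendsto_const_nhds
      (by simpa using hq0.const_mul (C * ε)) (Eventually.of_forall fun s => dist_nonneg) ?_
    filter_upwards [eventually_le_atBot 0] with s hs0
    exact (hback s hs0).2.2.2

end Layer

namespace Layer
variable {H : Layer}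

/-- Open sets of parameters for which the trajectories started at height `q₁ / (n + 2)`
leave the block on either side; parameters that avoid both sets in the limit `n → ∞` have a
connection. -/
theorem exists_separation_of_hyps {ε P δ ρ₁ τ C L zs ρ η σ p₁ c C₂ C' : ℝ} (hμ : H.μl ≤ H.μh)
    (h : H.WedgeHyp ε P δ ρ₁ τ C) (ha' : H.AvoidHyp ε ρ₁ C L zs)
    (hb : H.BlockHyp ε P ρ η L zs) (hu : H.UnderHyp ε P δ ρ₁ C σ p₁ c C₂ L zs)
    (ho : H.OverHyp ε P δ σ C' L zs) (hq₂ : H.q₂ < H.a - ρ₁)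
    (hZ : H.ζ₁ * ρ₁ + C * ε * H.a < ρ) :
    ∃ Ap Am : ℕ → Set (ℝ × ℝ), (∀ n, IsOpen (Ap n)) ∧ (∀ n, IsOpen (Am n)) ∧
      (∀ n, Disjoint (Ap n) (Am n)) ∧
      (∀ n θ, H.Par θ.1 θ.2 → H.s θ.1 θ.2 = δ → θ ∈ Ap n) ∧
      (∀ n θ, H.Par θ.1 θ.2 → H.s θ.1 θ.2 = -δ → θ ∈ Am n) ∧
      ∀ (θ : ℕ → ℝ × ℝ) (θ' : ℝ × ℝ) (ψ : ℕ → ℕ), Tendsto ψ atTop atTop →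
        (∀ j, H.Par (θ j).1 (θ j).2) → (∀ j, |H.s (θ j).1 (θ j).2| ≤ δ) →
        (∀ j, θ j ∉ Ap (ψ j) ∧ θ j ∉ Am (ψ j)) → Tendsto θ atTop (𝓝 θ') →
        ∃ q p u, H.Connection ε θ'.1 θ'.2 q p u := by
  have hP : 0 ≤ P := zero_le_one.trans hb.hP
  obtain ⟨Φ, h0, hs, hc, hp, hT⟩ := H.exists_flow ε hP hμ
  have hr : 0 < H.a - ρ₁ := sub_pos.2 h.hρ₁a
  set qs : ℕ → ℝ := fun n => (H.a - ρ₁) / (n + 2) with hqs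
  have hqs0 : ∀ n, 0 < qs n ∧ qs n < H.a - ρ₁ := fun n =>
    ⟨by positivity, div_lt_self hr (by linarith [(Nat.cast_nonneg n : (0 : ℝ) ≤ n)])⟩
  have hqsl : Tendsto qs atTop (𝓝 0) := by
    refine Tendsto.div_atTop tendsto_const_nhds ?_
    exact tendsto_atTop_add_const_right _ _ tendsto_natCast_atTop_atTop
  have hopen : ∀ s, ∀ n, IsOpen {θ : ℝ × ℝ | ReachesBefore (Φ (H.start (qs n) θ))
      (H.exitSet L zs ε s) (H.touchSet L zs ε (-s))} := fun s n =>
    (isOpen_reachesBefore hc (isOpen_exitSet _ _ _ _) (isClosed_touchSet _ _ _ _)).preimage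
      (continuous_start (qs n))
  have hTs : ∀ n θ, H.Par θ.1 θ.2 → H.Traj ε θ.1 θ.2 P (fun t => (Φ (H.start (qs n) θ) t).1)
      (fun t => (Φ (H.start (qs n) θ) t).2.1) (fun t => (Φ (H.start (qs n) θ) t).2.2.1) :=
    fun n θ hθ => hT (H.start (qs n) θ) hθ
  have hst : ∀ n θ, H.Par θ.1 θ.2 → H.Start θ.1 θ.2 (Φ (H.start (qs n) θ) 0).1
      (Φ (H.start (qs n) θ) 0).2.1 (Φ (H.start (qs n) θ) 0).2.2.1 := fun n θ hθ => by
    rw [h0]; exact start_isStart (hqs0 n).1 hθ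
  refine ⟨fun n => {θ | ReachesBefore (Φ (H.start (qs n) θ)) (H.exitSet L zs ε 1)
      (H.touchSet L zs ε (-1))}, fun n => {θ | ReachesBefore (Φ (H.start (qs n) θ))
      (H.exitSet L zs ε (-1)) (H.touchSet L zs ε 1)}, hopen 1, fun n => ?_, fun n => ?_,
      fun n θ hθ hsθ => ?_, fun n θ hθ hsθ => ?_, fun θ θ' ψ hψ hθ hsθ hno hlim => ?_⟩
  · simpa only [neg_neg] using hopen (-1) n
  · rw [Set.disjoint_left]
    exact fun θ h1 h2 => h1.not_reachesBefore (exitSet_subset _ _ _ _) (exitSet_subset _ _ _ _) h2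
  · obtain ⟨t, ht, h1, h2⟩ := (hTs n θ hθ).overshoot ho hsθ (hst n θ hθ) (by
      rw [h0]; exact (hqs0 n).2.trans (by linarith [h.hρ₁]))
    exact ⟨t, ht, by simp only [exitSet, Set.mem_ofPred_eq, hp]; exact h1, fun t' ht' => by
      simp only [touchSet, Set.mem_ofPred_eq, hp]; exact h2 t' ht'⟩
  · obtain ⟨t, ht, h1, h2⟩ := (hTs n θ hθ).undershoot h ha' hu hsθ (hst n θ hθ) (by
      rw [h0]; exact (hqs0 n).2)
    exact ⟨t, ht, by simp only [exitSet, Set.mem_ofPred_eq, hp]; exact h1, fun t' ht' => by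
      simp only [touchSet, Set.mem_ofPred_eq, hp]; exact h2 t' ht'⟩
  · refine exists_connection h ha' hb hq₂ hZ h0 hs hc hp hT (qs := fun j => qs (ψ j))
      (fun j => hqs0 (ψ j)) (hqsl.comp hψ) hθ hsθ hlim fun j s hs' => ?_
    rcases hs' with rfl | rfl
    · exact (hno j).1
    · rw [neg_neg]; exact (hno j).2

theorem exists_pos_le_four {a b c d : ℝ} (ha : 0 < a) (hb : 0 < b) (hc : 0 < c) (hd : 0 < d) :
    ∃ x > 0, x ≤ a ∧ x ≤ b ∧ x ≤ c ∧ x ≤ d :=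
  ⟨min (min a b) (min c d), by positivity, by simp, by simp, by simp, by simp⟩

theorem eventually_mul_lt (A : ℝ) {B : ℝ} (hB : 0 < B) : ∀ᶠ ε : ℝ in 𝓝[>] 0, A * ε < B := by
  have h : Tendsto (fun ε : ℝ => A * ε) (𝓝[>] 0) (𝓝 (A * 0)) :=
    ((continuous_const_mul A).tendsto 0).mono_left nhdsWithin_le_nhds
  rw [mul_zero] at h
  exact h.eventually (gt_mem_nhds hB)

theorem exists_blockHyp (hB : 0 ≤ H.B₁) :
    ∃ L zs ρ η, 0 < L ∧ 0 < zs ∧ 0 < ρ ∧ 2 * H.ζ₁ * H.kh * H.a + 1 ≤ L * H.ζ₀ ∧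
      ∀ P ≥ 1, ∀ᶠ ε in 𝓝[>] 0, H.BlockHyp ε P ρ η L zs := by
  have hCe := Ce_nonneg hB
  have hA₀ := H.A₀_pos
  have hζ₀ := H.hζ₀
  have hCg := H.Cg_pos
  have hC₀ := H.hC₀
  have hc₀ := H.hc₀
  obtain ⟨hT1, hT2⟩ := H.huT
  set L := max 1 (max (H.B₁ + 2 * H.Ce + H.A₁ + 1) ((2 * H.ζ₁ * H.kh * H.a + 1) / H.ζ₀)) with hLdef
  have hL0 : 0 < L := lt_max_of_lt_left one_pos
  have hL1 : H.B₁ + 2 * H.Ce + H.A₁ + 1 ≤ L := (le_max_left _ _).trans (le_max_right _ _)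
  have hL2 : 2 * H.ζ₁ * H.kh * H.a + 1 ≤ L * H.ζ₀ := by
    rw [← div_le_iff₀ hζ₀]
    exact (le_max_right _ _).trans (le_max_right _ _)
  have hs : 0 < Real.sqrt H.A₀ := Real.sqrt_pos.2 hA₀
  obtain ⟨η, hη, hη1, hη2, -, -⟩ := exists_pos_le_four (a := 1)
    (b := Real.sqrt H.A₀ / (4 * (H.Ce + 1))) (c := 1) (d := 1) one_pos (by positivity) one_pos
    one_pos
  obtain ⟨ρ, hρ, hρ1, hρ2, hρ3, hρ4⟩ := exists_pos_le_four (a := H.ρ₀)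
    (b := H.ζ₀ * η / (4 * L)) (c := H.c₀ * (H.uhi - H.uT) / (2 * H.C₀))
    (d := H.c₀ * (H.uT - H.ulo) / (2 * H.C₀)) H.hρ₀ (by positivity)
    (div_pos (mul_pos hc₀ (sub_pos.2 hT2)) (by positivity))
    (div_pos (mul_pos hc₀ (sub_pos.2 hT1)) (by positivity))
  rw [le_div_iff₀ (by positivity)] at hη2 hρ2 hρ3 hρ4
  have hu1 := mul_pos hc₀ (sub_pos.2 hT2)
  have hu2 := mul_pos hc₀ (sub_pos.2 hT1)
  refine ⟨L, (H.Ce * H.Cg + 1) / H.A₀, ρ, η, hL0, by positivity, hρ, hL2, fun P hP => ?_⟩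
  filter_upwards [self_mem_nhdsWithin, eventually_mul_lt 1 one_pos, eventually_mul_lt 1 hη,
    eventually_mul_lt ((H.Ce * H.Cg + 1) / H.A₀) hρ,
    eventually_mul_lt H.Cg (by positivity : 0 < H.ζ₀ * η / 2),
    eventually_mul_lt (((H.Ce + 1) * (H.C₀ / H.d₀)) ^ 2 / (H.c₀ / H.d₁) +
      2 * H.Ce * (H.C₀ / H.d₀) + H.α H.kh * H.Cg) (by positivity : 0 < H.A₀ / 2)]
    with ε hε h1 h2 h3 h4 h5
  rw [one_mul] at h1 h2
  simp only [Set.mem_Ioi] at hε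
  refine ⟨hε, h1.le, hP, hρ, hρ1, ?_, h3.le, hL1, ?_, hη1, ?_, ?_, ?_, ?_⟩
  · rw [mul_div_cancel₀ _ hA₀.ne']; linarith
  · linarith
  · have h6 : H.Ce * (η + ε) ≤ Real.sqrt H.A₀ / 2 := by nlinarith
    calc (H.Ce * (η + ε)) ^ 2 ≤ (Real.sqrt H.A₀ / 2) ^ 2 := by gcongr
      _ = H.A₀ / 4 := by rw [div_pow, Real.sq_sqrt hA₀.le]; norm_num
  · rw [mul_comm]; exact h5.le
  · linarith
  · linarith

theorem exists_separation (H : Layer) (hμ : H.μl ≤ H.μh) :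
    ∃ η > 0, ∀ δ, 0 < δ → δ ≤ η → ∀ᶠ ε in 𝓝[>] 0,
    ∃ Ap Am : ℕ → Set (ℝ × ℝ), (∀ n, IsOpen (Ap n)) ∧ (∀ n, IsOpen (Am n)) ∧
      (∀ n, Disjoint (Ap n) (Am n)) ∧
      (∀ n θ, H.Par θ.1 θ.2 → H.s θ.1 θ.2 = δ → θ ∈ Ap n) ∧
      (∀ n θ, H.Par θ.1 θ.2 → H.s θ.1 θ.2 = -δ → θ ∈ Am n) ∧
      ∀ (θ : ℕ → ℝ × ℝ) (θ' : ℝ × ℝ) (ψ : ℕ → ℕ), Tendsto ψ atTop atTop →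
        (∀ j, H.Par (θ j).1 (θ j).2) → (∀ j, |H.s (θ j).1 (θ j).2| ≤ δ) →
        (∀ j, θ j ∉ Ap (ψ j) ∧ θ j ∉ Am (ψ j)) → Tendsto θ atTop (𝓝 θ') →
        ∃ q p u, H.Connection ε θ'.1 θ'.2 q p u := by
  have hB : 0 ≤ H.B₁ := Par.B₁_nonneg (k := H.kl) (μ := H.μl)
    ⟨⟨le_rfl, H.hkh⟩, le_rfl, hμ⟩
  obtain ⟨L, zs, ρ, ηb, hL, hzs, hρ, hLζ, hblock⟩ := exists_blockHyp hB
  have hR := H.hR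
  have hkl := H.hkl
  have hkh := hkl.trans_le H.hkh
  have ha := H.ha
  have hb := H.hb
  have hba := sub_pos.2 H.hba
  have hq₂ := H.q₂_pos
  have hq₂b := sub_pos.2 H.hq₂b
  have hq₂a := sub_pos.2 H.hq₂
  have hq₃ := sub_pos.2 H.hq₃
  have hq₃0 := H.q₃_pos
  have hζ₁ := H.ζ₁_pos
  have hζ₀ := H.hζ₀
  have hd₀ := H.hd₀
  have hM := M_pos (H := H)
  have hCg := H.Cg_pos
  have hK : 0 < H.K := by linarith [M_lt_K hB]
  have hαh := H.α_pos hkh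
  have hαl := H.α_pos hkl
  have he := abs_nonneg H.e
  obtain ⟨hua1, hua2⟩ := H.hua
  have hua1' := sub_pos.2 hua1
  have hua2' := sub_pos.2 hua2
  obtain ⟨ρ₁, hρ₁, hρ₁1, hρ₁2, hρ₁3, -⟩ := exists_pos_le_four (a := (H.a - H.q₂) / 4)
    (b := ρ / (2 * H.ζ₁)) (c := H.a / 2) (d := 1) (by positivity) (by positivity) (by positivity)
    one_pos
  rw [le_div_iff₀ (by positivity)] at hρ₁2
  set τ := H.kl * ρ₁ ^ 4 * (H.a + 2 * H.b) / (6 * H.a) with hτdef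
  have hτ : 0 < τ := by positivity
  set C := 9 / (H.kl * ρ₁ * H.d₀) with hCdef
  have hC : 0 < C := by positivity
  have hC9 : C * H.kl * ρ₁ * H.d₀ = 9 := by rw [hCdef]; field_simp
  obtain ⟨η, hη, hη1, hη2, hη3, hη4⟩ := exists_pos_le_four (a := τ / (2 * (H.kh * H.a ^ 3)))
    (b := τ * H.kl * (H.a + 2 * H.b) / (4 * H.a ^ 3 * (H.α H.kh * H.M)))
    (c := H.kl * (H.a - H.b) / H.α H.kh) (d := H.a) (by positivity) (by positivity)
    (by positivity) ha
  refine ⟨η, hη, fun δ hδ hδη => ?_⟩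
  replace hη1 := hδη.trans hη1
  replace hη2 := hδη.trans hη2
  replace hη3 := hδη.trans hη3
  replace hη4 := hδη.trans hη4
  rw [le_div_iff₀ (by positivity)] at hη1 hη2 hη3
  obtain ⟨σ', hσ', hσ1', hσ2', -, -⟩ := exists_pos_le_four (a := δ / 2) (b := ρ₁) (c := 1) (d := 1)
    (by positivity) hρ₁ one_pos one_pos
  obtain ⟨σ, hσ, hσ1, hσ2, hσ3, hσ4⟩ := exists_pos_le_four (a := σ') (b := (H.a - H.b) / 4)
    (c := 2 * H.kl * δ / (3 * H.R)) (d := H.q₃ - H.a) hσ' (by positivity) (by positivity) hq₃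
  rw [le_div_iff₀ (by positivity)] at hσ3
  set c := H.α H.kl * H.R * H.q₂ * (H.q₂ - H.b) * σ / 4 with hcdef
  have hc : 0 < c := by positivity
  obtain ⟨p₁, hp₁, hp₁1, hp₁2, hp₁3, -⟩ := exists_pos_le_four (a := 1) (b := ρ₁ * H.K / 8)
    (c := c / (2 * (H.K + H.B₁))) (d := 1) one_pos (by positivity) (by positivity) one_pos
  rw [le_div_iff₀ (by positivity)] at hp₁3
  set C₂ := C + H.Cg / c + 1 with hC₂def
  have hC₂ : 0 < C₂ := by positivity
  have hC₂c : H.Cg < C₂ * c := by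
    have : H.Cg / c * c = H.Cg := by field_simp
    have := mul_pos hC hc
    rw [hC₂def]; linarith
  set C' := 9 / (H.kl * σ * H.d₀) with hC'def
  have hC' : 0 < C' := by positivity
  have hC'9 : C' * H.kl * σ * H.d₀ = 9 := by rw [hC'def]; field_simp
  have hMa : 0 < H.M * H.a := by positivity
  have hKq : 0 < H.K * H.q₃ := by positivity
  have hPb : (1 : ℝ) ≤ 1 + H.M * H.a + H.K * H.q₃ := by linarith
  filter_upwards [self_mem_nhdsWithin, hblock (1 + H.M * H.a + H.K * H.q₃) hPb,
    eventually_mul_lt (2 * H.a ^ 3 * (H.α H.kh * (C * (H.M * H.a + H.a + |H.e|))))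
      (by positivity : 0 < τ * H.kl * (H.a + 2 * H.b) / 2),
    eventually_mul_lt (C * H.a) hua1', eventually_mul_lt (C * H.a) hua2',
    eventually_mul_lt (H.Cg + L * C * H.a) hρ₁,
    eventually_mul_lt H.Cg (by positivity : 0 < H.ζ₀ * (H.kl * ρ₁ / 2 * H.q₂)),
    eventually_mul_lt (C * H.a) (by positivity : 0 < ρ / 2),
    eventually_mul_lt (H.α H.kh * C * (H.M * H.a + 1 + H.q₃ + |H.e|))
      (by positivity : 0 < H.kl ^ 2 * σ * (H.a - H.b)),
    eventually_mul_lt (H.α H.kh * (C₂ * (H.K * H.a + 1)) * (H.M * H.a + 1 + H.q₃ + |H.e|))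
      (by positivity : 0 < H.kl ^ 2 * σ * (H.a - H.b) * H.q₂),
    eventually_mul_lt (H.α H.kh * (H.q₃ + |H.e|) * (C₂ * (H.K * H.a + 1)))
      (by positivity : 0 < c / 2),
    eventually_mul_lt (C₂ * (H.K * H.a + 1)) hua1',
    eventually_mul_lt (C₂ * (H.K * H.a + 1)) hua2',
    eventually_mul_lt H.Cg (by positivity : 0 < H.ζ₀ * p₁),
    eventually_mul_lt (zs + C₂ * (H.K * H.a + 1)) (by positivity : 0 < H.ζ₀ * (σ / 2)),
    eventually_mul_lt (H.Cg + L * (C₂ * (H.K * H.a + 1))) (by positivity : 0 < σ / 2),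
    eventually_mul_lt C' one_pos, eventually_mul_lt (C' * H.q₃) hua1',
    eventually_mul_lt (C' * H.q₃) hua2',
    eventually_mul_lt (H.α H.kh * C' * (H.K * H.q₃ + H.q₃ + |H.e|))
      (by positivity : 0 < 2 * H.kl ^ 2 * σ * (H.a - H.b)),
    eventually_mul_lt H.Cg (by positivity : 0 < H.ζ₀ * (H.kl * σ / 2 * H.q₂)),
    eventually_mul_lt (zs + C' * H.q₃) (by positivity : 0 < H.ζ₀ * (σ / 2))]
    with ε hε hbl w1 w2 w3 a1 a2 z1 u1 u2 u3 u4 u5 u6 u7 u8 o1 o2 o3 o4 o5 o6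
  simp only [Set.mem_Ioi] at hε
  have hw : H.WedgeHyp ε (1 + H.M * H.a + H.K * H.q₃) δ ρ₁ τ C := by
    refine ⟨hε, hδ.le, hρ₁, by linarith, hτ, hC, ?_, ?_, by linarith, by linarith, by linarith,
      by linarith, by linarith⟩
    · rw [hτdef]; exact le_of_eq (by field_simp)
    · linarith
  have hu : H.UnderHyp ε (1 + H.M * H.a + H.K * H.q₃) δ ρ₁ C σ p₁ c C₂ L zs := by
    refine ⟨hδ, hσ, hp₁, hc, by linarith, by linarith, by linarith, by linarith, by linarith,
      by linarith, hp₁1, by linarith, by linarith, ?_, by linarith, ?_, hC₂c, u1, u2, u3.le, u4.le,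
      u5.le, u6, u7, u8⟩
    · rw [hcdef]; linarith
    · rw [hC₂def]
      have : 0 < H.Cg / c := by positivity
      linarith
  have ho : H.OverHyp ε (1 + H.M * H.a + H.K * H.q₃) δ σ C' L zs :=
    ⟨hε, hσ, hC', hL, by linarith, hη4, by linarith, by linarith, by linarith, o1.le, o2, o3,
      by linarith, o4, o5, o6⟩
  exact exists_separation_of_hyps hμ hw ⟨hLζ, hL, hzs, a1, a2⟩ hbl hu ho (by linarith)
    (by linarith)

end Layer

/-- Parameters of the singular heteroclinic loop: `1 ± Sf` and `1 ± Sb` are the zeros of the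
reaction term at `u = 2` and `u = ub`. -/
structure LoopData (r ub Sf Sb : ℝ) : Prop where
  hr : 2 / 3 < r
  hub₁ : 6 / 5 < ub
  hub₂ : ub < 4 / 3
  hSf : (r + 1 / 10) * Sf ^ 2 = r
  hSb : (r + 1 / 10) * Sb ^ 2 = r + ub - 2
  hSb₀ : 0 < Sb
  hSbf : Sb < Sf
  hSf₁ : Sf < 1
  hg : 2 - ub + 2 * (1 + Sb) * (1 - ub) = 0

namespace LoopData
variable {r ub Sf Sb ζ kl kh μl μh : ℝ}

theorem abs_add_le_of_mem {u μ : ℝ} (hu : u ∈ Set.Icc (1 : ℝ) 3) (hμ : μ ∈ Set.Icc μl μh) :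
    |u + μ| ≤ 3 + |μl| + |μh| := by
  rw [abs_le]
  constructor <;> linarith [hu.1, hu.2, hμ.1, hμ.2, neg_abs_le μl, le_abs_self μh, abs_nonneg μl,
    abs_nonneg μh]

theorem sq_mem_Icc_of_abs_add_one_le {w y : ℝ} (hy : y ≤ 1 / 2) (h₁ : -1 - y ≤ w)
    (h₂ : w ≤ -1 + y) : w ^ 2 ∈ Set.Icc (1 - 2 * y) 4 :=
  ⟨by nlinarith, by nlinarith⟩

theorem front_slow (h : LoopData r ub Sf Sb) {q u Z : ℝ} (hq : q ∈ Set.Icc (1 + Sb / 2) 3)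
    (hZ : Z = (r + 1 / 10) * (q - 1) ^ 2 - (r + u - 2)) :
    (u - ub) * (-1 * (u - 2) + 2 * 1 * q * (1 - u)) ≤
      -1 * (u - ub) ^ 2 + (7 + 1 / ((r + 1 / 10) * Sb)) * |Z| * |u - ub| ∧
    |-1 * (u - 2) + 2 * 1 * q * (1 - u)| ≤
      (7 + 1 / ((r + 1 / 10) * Sb)) * (|u - ub| + |Z|) ∧
    |q - (1 + Sb)| ≤ (7 + 1 / ((r + 1 / 10) * Sb)) * (|Z| + |u - ub|) := by
  obtain ⟨hr, hub₁, hub₂, -, hSb, hSb₀, hSbf, hSf₁, hg⟩ := h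
  obtain ⟨hq1, hq2⟩ := hq
  set κ := 1 / ((r + 1 / 10) * Sb) with hκ
  have hκ0 : 0 < κ := by positivity
  set m := q - (1 + Sb) with hm
  set v := u - ub with hv
  set D := (r + 1 / 10) * (q - 1 + Sb) with hD
  have hDκ : 1 ≤ D * κ := by
    have : (r + 1 / 10) * Sb * κ = 1 := by rw [hκ]; field_simp
    have : (r + 1 / 10) * Sb ≤ D := by rw [hD]; gcongr; linarith
    nlinarith
  have hD0 : 0 < D := by
    rw [hD]
    have : 0 < q - 1 + Sb := by linarith
    positivity
  have hDm : D * m = Z + v := by rw [hD, hm, hv, hZ]; linear_combination (-1) * hSb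
  have hgn : -1 * (u - 2) + 2 * 1 * q * (1 - u) = -v * (1 + 2 * q) - 2 * (ub - 1) * m := by
    rw [hm, hv]; linear_combination hg
  have hma : |m| ≤ κ * (|Z| + |v|) := by
    have h1 : D * |m| ≤ |Z| + |v| := by
      rw [← abs_of_pos hD0, ← abs_mul, hDm]; exact abs_add_le _ _
    have h2 : |m| ≤ D * κ * |m| := le_mul_of_one_le_left (abs_nonneg _) hDκ
    nlinarith
  have hvm : -(κ * (|Z| * |v|)) ≤ v * m := by
    have h1 : -(|Z| * |v|) ≤ D * (v * m) := by
      have : D * (v * m) = Z * v + v ^ 2 := by linear_combination v * hDm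
      rw [this, ← abs_mul]
      nlinarith [neg_abs_le (Z * v)]
    by_contra! hc
    have h3 : 0 ≤ |Z| * |v| := by positivity
    nlinarith
  have hZ0 := abs_nonneg Z
  have hv0 := abs_nonneg v
  have hm0 := abs_nonneg m
  rw [hgn]
  refine ⟨?_, ?_, ?_⟩
  · have h1 : v * (-v * (1 + 2 * q) - 2 * (ub - 1) * m) =
        -v ^ 2 * (1 + 2 * q) - 2 * (ub - 1) * (v * m) := by ring
    have h2 : 0 ≤ |Z| * |v| := by positivity
    have h3 : 0 ≤ κ * (|Z| * |v|) := by positivity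
    rw [h1]
    nlinarith [sq_nonneg v]
  · have h1 : |-v * (1 + 2 * q) - 2 * (ub - 1) * m| ≤ |v| * 7 + 1 * |m| := by
      refine (abs_sub _ _).trans ?_
      rw [abs_mul, abs_neg, abs_mul, abs_of_pos (by linarith : 0 < 1 + 2 * q),
        abs_of_pos (by linarith : 0 < 2 * (ub - 1))]
      gcongr <;> linarith
    linarith
  · linarith

theorem exists_front (h : LoopData r ub Sf Sb) (hkl : 0 < kl) (hkh : kl ≤ kh)
    (hζ : 0 < ub + ζ + μl) :
    ∃ H : Layer, H.R = r + 1 / 10 ∧ H.a = 1 + Sf ∧ H.b = 1 - Sf ∧ H.e = 0 ∧ H.ua = 2 ∧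
      H.uT = ub ∧ H.qT = 1 + Sb ∧ H.c₁ = 1 ∧ H.σ = 1 ∧ H.ζ = ζ ∧ H.kl = kl ∧ H.kh = kh ∧
      H.μl = μl ∧ H.μh = μh := by
  have h' := h
  obtain ⟨hr, hub₁, hub₂, hSf, hSb, hSb₀, hSbf, hSf₁, hg⟩ := h
  have hR : 0 < r + 1 / 10 := by linarith
  obtain ⟨x, hx, hx1, hx2, hx3, -⟩ := Layer.exists_pos_le_four (a := 1 / 10)
    (b := (ub + ζ + μl) / 4) (c := (r + 1 / 10) * Sb ^ 2 / 4) (d := 1) (by norm_num)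
    (by positivity) (by positivity) one_pos
  have hRS : (r + 1 / 10) * Sb ^ 2 ≤ r + 1 / 10 := by nlinarith
  refine ⟨{ R := r + 1 / 10, a := 1 + Sf, b := 1 - Sf, e := 0, ua := 2, uT := ub, qT := 1 + Sb
            c₁ := 1, σ := 1, z₂ := r + 1 / 10, z₁ := -2 * (r + 1 / 10), z₀ := r + 1 / 10 - r + 2
            ν := 1, ζ := ζ, q₂ := 1 + Sb / 2, q₃ := 3, ulo := ub - x, uhi := 2 + x
            kl := kl, kh := kh, μl := μl, μh := μh, ρ₀ := x, ω₀ := 1, ω₁ := 3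
            ζ₀ := (r + 1 / 10) * Sb, ζ₁ := 4 * (r + 1 / 10), c₀ := 1
            C₀ := 7 + 1 / ((r + 1 / 10) * Sb), d₀ := (ub + ζ + μl) / 2
            d₁ := 2 + x + ζ + μh, cm := 3 + |μl| + |μh|, ω := fun q _ => q
            hR := hR, hb := by linarith, hba := by linarith, hc₁ := zero_le_one
            hσ := by simp, hν₀ := zero_le_one, hν₁ := le_rfl, hq₂b := by linarith
            hq₂ := by linarith, hq₃ := by linarith, hulo := by linarith, huhi := by linarith
            hua := ⟨by linarith, by linarith⟩, huT := ⟨by linarith, by linarith⟩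
            hkl := hkl, hkh := hkh, hd₀ := by linarith
            hden := fun u hu μ hμ => ⟨by linarith [hu.1, hμ.1], by linarith [hu.2, hμ.2]⟩
            hcm := fun u hu μ hμ =>
              abs_add_le_of_mem ⟨by linarith [hu.1], by linarith [hu.2]⟩ hμ
            hρ₀ := hx, hω₀ := one_pos, hζ₀ := by positivity, hc₀ := one_pos
            hC₀ := by positivity
            hF := fun q u => by linear_combination q * hSf
            hq := fun q hq u hu hZ => ?_
            hω := fun q hq u hu hZ => ⟨by linarith [hq.1], hq.2⟩
            hζ := fun q hq => ⟨by nlinarith [hq.1], by nlinarith [hq.2]⟩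
            hZa := by linear_combination hSf
            hslow := fun q hq u hu => h'.front_slow hq (by ring) },
      rfl, rfl, rfl, rfl, rfl, rfl, rfl, rfl, rfl, rfl, rfl, rfl, rfl, rfl⟩
  obtain ⟨hZ1, hZ2⟩ := abs_le.1 hZ
  have hu1 := hu.1
  have hu2 := hu.2
  have e : (r + 1 / 10) * q ^ 2 + -2 * (r + 1 / 10) * q + (r + 1 / 10 - r + 2) - 1 * u =
    (r + 1 / 10) * (q - 1) ^ 2 - (r + u - 2) := by ring
  rw [e] at hZ1 hZ2
  have hRS0 : 0 < (r + 1 / 10) * Sb ^ 2 := by positivity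
  constructor
  · by_contra! hc
    have : q = 1 + Sb / 2 := le_antisymm hc hq.1
    have e2 : (r + 1 / 10) * (q - 1) ^ 2 = (r + 1 / 10) * Sb ^ 2 / 4 := by rw [this]; ring
    linarith
  · by_contra! hc
    have : q = 3 := le_antisymm hq.2 hc
    have e2 : (r + 1 / 10) * (q - 1) ^ 2 = (r + 1 / 10) * 4 := by rw [this]; norm_num
    linarith

theorem back_slow (h : LoopData r ub Sf Sb) {q u : ℝ} (hu : u ∈ Set.Icc (1 : ℝ) 3) :
    (u - 2) * (-(1 + 2 * (1 + Sb)) * (u - ub) + 2 * -1 * q * (1 - u)) ≤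
      -1 * (u - 2) ^ 2 + 4 * |q - (1 + Sb)| * |u - 2| ∧
    |-(1 + 2 * (1 + Sb)) * (u - ub) + 2 * -1 * q * (1 - u)| ≤
      4 * (|u - 2| + |q - (1 + Sb)|) ∧
    |q - (1 + Sb)| ≤ 4 * (|q - (1 + Sb)| + |u - 2|) := by
  have hg := h.hg
  have hgn : -(1 + 2 * (1 + Sb)) * (u - ub) + 2 * -1 * q * (1 - u) =
      -(u - 2) - 2 * (1 - u) * (q - (1 + Sb)) := by linear_combination -hg
  have hu1 : |2 * (1 - u)| ≤ 4 := abs_le.2 ⟨by linarith [hu.2], by linarith [hu.1]⟩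
  have hZ0 := abs_nonneg (q - (1 + Sb))
  have hv0 := abs_nonneg (u - 2)
  have h1 : |2 * (1 - u) * (q - (1 + Sb))| ≤ 4 * |q - (1 + Sb)| := by
    rw [abs_mul]; gcongr
  rw [hgn]
  refine ⟨?_, ?_, by linarith⟩
  · have h2 : |2 * (1 - u) * (q - (1 + Sb)) * (u - 2)| ≤ 4 * |q - (1 + Sb)| * |u - 2| := by
      rw [abs_mul]; gcongr
    linarith [neg_abs_le (2 * (1 - u) * (q - (1 + Sb)) * (u - 2))]
  · refine (abs_sub _ _).trans ?_
    rw [abs_neg]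
    linarith

theorem exists_back (h : LoopData r ub Sf Sb) (hkl : 0 < kl) (hkh : kl ≤ kh)
    (hζ : 0 < ub + ζ + μl) :
    ∃ H : Layer, H.R = r + 1 / 10 ∧ H.a = 1 + Sb ∧ H.b = 2 * Sb ∧ H.e = 1 + Sb ∧ H.ua = ub ∧
      H.uT = 2 ∧ H.qT = 1 + Sb ∧ H.c₁ = 1 + 2 * (1 + Sb) ∧ H.σ = -1 ∧ H.ζ = ζ ∧ H.kl = kl ∧
      H.kh = kh ∧ H.μl = μl ∧ H.μh = μh := by
  have h' := h
  obtain ⟨hr, hub₁, hub₂, hSf, hSb, hSb₀, hSbf, hSf₁, hg⟩ := h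
  have hR : 0 < r + 1 / 10 := by linarith
  obtain ⟨x, hx, hx1, hx2, hx3, -⟩ := Layer.exists_pos_le_four (a := 1 / 40)
    (b := (ub + ζ + μl) / 4) (c := (r + 1 / 10) * Sb ^ 2 / 4) (d := 1) (by norm_num)
    (by positivity) (by positivity) one_pos
  obtain ⟨y, hy, hy1, hy2, hy3, -⟩ := Layer.exists_pos_le_four (a := 1 / 2)
    (b := (1 - Sb) / 4) (c := 1 / (80 * (r + 1 / 10))) (d := 1) (by norm_num)
    (by linarith) (by positivity) one_pos
  rw [le_div_iff₀ (by positivity)] at hy3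
  refine ⟨{ R := r + 1 / 10, a := 1 + Sb, b := 2 * Sb, e := 1 + Sb, ua := ub, uT := 2
            qT := 1 + Sb, c₁ := 1 + 2 * (1 + Sb), σ := -1, z₂ := 0, z₁ := 1, z₀ := -(1 + Sb)
            ν := 0, ζ := ζ, q₂ := 1 + Sb - 2 * y, q₃ := 1 + Sb + 2 * y
            ulo := ub - x, uhi := 2 + x
            kl := kl, kh := kh, μl := μl, μh := μh, ρ₀ := y, ω₀ := 1 / 40
            ω₁ := 4 * (r + 1 / 10), ζ₀ := 1, ζ₁ := 1, c₀ := 1, C₀ := 4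
            d₀ := (ub + ζ + μl) / 2, d₁ := 2 + x + ζ + μh, cm := 3 + |μl| + |μh|
            ω := fun q u => (r + 1 / 10) * (Sb - q) ^ 2 - (r + u - 2)
            hR := hR, hb := by linarith, hba := by linarith, hc₁ := by linarith
            hσ := by simp, hν₀ := le_rfl, hν₁ := zero_le_one, hq₂b := by linarith
            hq₂ := by linarith, hq₃ := by linarith, hulo := by linarith, huhi := by linarith
            hua := ⟨by linarith, by linarith⟩, huT := ⟨by linarith, by linarith⟩
            hkl := hkl, hkh := hkh, hd₀ := by linarith
            hden := fun u hu μ hμ => ⟨by linarith [hu.1, hμ.1], by linarith [hu.2, hμ.2]⟩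
            hcm := fun u hu μ hμ =>
              abs_add_le_of_mem ⟨by linarith [hu.1], by linarith [hu.2]⟩ hμ
            hρ₀ := hy, hω₀ := by norm_num, hζ₀ := one_pos, hc₀ := one_pos
            hC₀ := by norm_num
            hF := fun q u => by linear_combination (q - (1 + Sb)) * hSb
            hq := fun q hq u hu hZ => ?_
            hω := fun q hq u hu hZ => ?_
            hζ := fun q hq => ⟨by linarith, by linarith⟩
            hZa := by ring
            hslow := fun q hq u hu => ?_ },
      rfl, rfl, rfl, rfl, rfl, rfl, rfl, rfl, rfl, rfl, rfl, rfl, rfl, rfl⟩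
  · obtain ⟨hZ1, hZ2⟩ := abs_le.1 hZ
    constructor <;> linarith
  · obtain ⟨hZ1, hZ2⟩ := abs_le.1 hZ
    have hu1 := hu.1
    have hu2 := hu.2
    obtain ⟨e1, e2⟩ := sq_mem_Icc_of_abs_add_one_le (w := Sb - q) (y := y) (by linarith)
      (by linarith) (by linarith)
    have e3 : (r + 1 / 10) * (1 - 2 * y) ≤ (r + 1 / 10) * (Sb - q) ^ 2 := by gcongr
    have e4 : (r + 1 / 10) * (Sb - q) ^ 2 ≤ (r + 1 / 10) * 4 := by gcongr
    have hRS0 : 0 < (r + 1 / 10) * Sb ^ 2 := by positivity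
    constructor <;> linarith
  · have e : 0 * q ^ 2 + 1 * q + -(1 + Sb) - 0 * u = q - (1 + Sb) := by ring
    rw [e]
    exact h'.back_slow ⟨by linarith [hu.1], by linarith [hu.2]⟩

end LoopData

/-- A family of solvability sets that eventually meets every small ball around the origin admits
a selection converging to the origin. -/
theorem exists_tendsto_selection {E : Type*} [NormedAddCommGroup E] {Good : ℝ → E → Prop} {η : ℝ}
    (hη : 0 < η)
    (h : ∀ δ, 0 < δ → δ ≤ η → ∀ᶠ ε in 𝓝[>] (0 : ℝ), ∃ s, ‖s‖ ≤ δ ∧ Good ε s) :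
    ∃ f : ℝ → E, Tendsto f (𝓝[>] 0) (𝓝 0) ∧ ∀ᶠ ε in 𝓝[>] (0 : ℝ), Good ε (f ε) := by
  have key : ∀ ε : ℝ, ∃ s, 0 < ε → (∃ s', Good ε s') →
      Good ε s ∧ ∀ s', Good ε s' → ‖s‖ ≤ ‖s'‖ + ε := by
    intro ε
    by_cases hc : 0 < ε ∧ ∃ s', Good ε s'
    · obtain ⟨hε, s₀, hs₀⟩ := hc
      have hbdd : BddBelow (norm '' {s | Good ε s}) :=
        ⟨0, by rintro _ ⟨s, -, rfl⟩; exact norm_nonneg s⟩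
      obtain ⟨_, ⟨s, hs, rfl⟩, hlt⟩ := exists_lt_of_csInf_lt
        (Set.Nonempty.image norm ⟨s₀, hs₀⟩) (lt_add_of_pos_right (sInf (norm '' {s | Good ε s})) hε)
      refine ⟨s, fun _ _ => ⟨hs, fun s' hs' => hlt.le.trans ?_⟩⟩
      gcongr
      exact csInf_le hbdd ⟨s', hs', rfl⟩
    · exact ⟨0, fun h1 h2 => (hc ⟨h1, h2⟩).elim⟩
  choose f hf using key
  refine ⟨f, ?_, ?_⟩
  · rw [Metric.tendsto_nhds]
    intro x hx
    filter_upwards [h (min η (x / 2)) (by positivity) (min_le_left _ _), self_mem_nhdsWithin,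
      Ioo_mem_nhdsGT (show (0 : ℝ) < x / 2 by positivity)] with ε ⟨s, hs, hg⟩ hε hε'
    rw [dist_zero_right]
    have h1 := (hf ε hε ⟨s, hg⟩).2 s hg
    linarith [hε'.2, min_le_right η (x / 2)]
  · filter_upwards [h η hη le_rfl, self_mem_nhdsWithin] with ε ⟨s, hs, hg⟩ hε
    exact (hf ε hε ⟨s, hg⟩).1

namespace Layer

/-- Two layers whose singular splitting functions serve as coordinates on the parameter plane
are connected simultaneously at a parameter close to the singular one. -/
theorem eventually_exists_connections {Hf Hb : Layer} (hf : Hf.μl ≤ Hf.μh) (hb : Hb.μl ≤ Hb.μh)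
    {Θ : ℝ × ℝ → ℝ × ℝ} (hΘ : Continuous Θ) {η : ℝ} (hη : 0 < η)
    (hΘf : ∀ s, ‖s‖ ≤ η → Hf.Par (Θ s).1 (Θ s).2 ∧ Hf.s (Θ s).1 (Θ s).2 = s.1)
    (hΘb : ∀ s, ‖s‖ ≤ η → Hb.Par (Θ s).1 (Θ s).2 ∧ Hb.s (Θ s).1 (Θ s).2 = s.2) :
    ∃ η' > 0, ∀ δ, 0 < δ → δ ≤ η' → ∀ᶠ ε in 𝓝[>] (0 : ℝ), ∃ s : ℝ × ℝ, ‖s‖ ≤ δ ∧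
      (∃ q p u, Hf.Connection ε (Θ s).1 (Θ s).2 q p u) ∧
      ∃ q p u, Hb.Connection ε (Θ s).1 (Θ s).2 q p u := by
  obtain ⟨ηf, hηf, Kf⟩ := Hf.exists_separation hf
  obtain ⟨ηb, hηb, Kb⟩ := Hb.exists_separation hb
  refine ⟨min η (min ηf ηb), by positivity, fun δ hδ hδ' => ?_⟩
  have hδη : δ ≤ η := hδ'.trans (min_le_left _ _)
  filter_upwards [Kf δ hδ (hδ'.trans ((min_le_right _ _).trans (min_le_left _ _))),
    Kb δ hδ (hδ'.trans ((min_le_right _ _).trans (min_le_right _ _)))] with ε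
    ⟨A₁, A₂, hA₁, hA₂, hA, hA₁s, hA₂s, Lf⟩ ⟨B₁, B₂, hB₁, hB₂, hB, hB₁s, hB₂s, Lb⟩
  let T : ℝ × ℝ → ℝ × ℝ := fun z => (δ * z.1, δ * z.2)
  have hT : Continuous T := by fun_prop
  have hTn : ∀ x ∈ Set.Icc (-1 : ℝ) 1, ∀ y ∈ Set.Icc (-1 : ℝ) 1,
      |δ * x| ≤ δ ∧ |δ * y| ≤ δ ∧ ‖T (x, y)‖ ≤ δ := by
    intro x hx y hy
    have h1 : |δ * x| ≤ δ := by
      rw [abs_mul, abs_of_pos hδ]; exact mul_le_of_le_one_right hδ.le (abs_le.2 hx)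
    have h2 : |δ * y| ≤ δ := by
      rw [abs_mul, abs_of_pos hδ]; exact mul_le_of_le_one_right hδ.le (abs_le.2 hy)
    exact ⟨h1, h2, max_le h1 h2⟩
  have m1 : (1 : ℝ) ∈ Set.Icc (-1 : ℝ) 1 := by norm_num
  have m2 : (-1 : ℝ) ∈ Set.Icc (-1 : ℝ) 1 := by norm_num
  have hc := hΘ.comp hT
  have key : ∀ n, ∃ z : ℝ × ℝ, z ∈ Set.Icc (-1 : ℝ) 1 ×ˢ Set.Icc (-1 : ℝ) 1 ∧
      (Θ (T z) ∉ A₁ n ∧ Θ (T z) ∉ A₂ n) ∧ Θ (T z) ∉ B₁ n ∧ Θ (T z) ∉ B₂ n := by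
    intro n
    obtain ⟨x, hx, y, hy, e1, e2, e3, e4⟩ := exists_mem_square_notMem
      ((hA₁ n).preimage hc) ((hA₂ n).preimage hc) ((hB₁ n).preimage hc) ((hB₂ n).preimage hc)
      ((hA n).preimage _) ((hB n).preimage _)
      (fun y hy => by
        have := hΘf _ ((hTn 1 m1 y hy).2.2.trans hδη)
        exact hA₁s n _ this.1 (this.2.trans (mul_one δ)))
      (fun y hy => by
        have := hΘf _ ((hTn (-1) m2 y hy).2.2.trans hδη)
        exact hA₂s n _ this.1 (this.2.trans (mul_neg_one δ)))
      (fun x hx => by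
        have := hΘb _ ((hTn x hx 1 m1).2.2.trans hδη)
        exact hB₁s n _ this.1 (this.2.trans (mul_one δ)))
      (fun x hx => by
        have := hΘb _ ((hTn x hx (-1) m2).2.2.trans hδη)
        exact hB₂s n _ this.1 (this.2.trans (mul_neg_one δ)))
    exact ⟨(x, y), ⟨hx, hy⟩, ⟨e1, e2⟩, e3, e4⟩
  choose z hz hzA hzB using key
  obtain ⟨z', hz', ψ, hψ, hlim⟩ := (isCompact_Icc.prod isCompact_Icc).tendsto_subseq hz
  have hzn : ∀ j, ‖T (z j)‖ ≤ η := fun j => (hTn _ (hz j).1 _ (hz j).2).2.2.trans hδη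
  have hlim' : Tendsto (fun j => Θ (T (z (ψ j)))) atTop (𝓝 (Θ (T z'))) :=
    (hc.tendsto z').comp hlim
  refine ⟨T z', (hTn _ hz'.1 _ hz'.2).2.2, ?_, ?_⟩
  · refine Lf _ _ ψ hψ.tendsto_atTop (fun j => (hΘf _ (hzn _)).1) (fun j => ?_)
      (fun j => hzA (ψ j)) hlim'
    rw [(hΘf _ (hzn _)).2]
    exact (hTn _ (hz (ψ j)).1 _ (hz (ψ j)).2).1
  · refine Lb _ _ ψ hψ.tendsto_atTop (fun j => (hΘb _ (hzn _)).1) (fun j => ?_)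
      (fun j => hzB (ψ j)) hlim'
    rw [(hΘb _ (hzn _)).2]
    exact (hTn _ (hz (ψ j)).1 _ (hz (ψ j)).2).2.1

end Layer

namespace Layer

/-- A connection of a layer, read in the original coordinates, solves the traveling-wave
system. -/
theorem Connection.isTWSol {H : Layer} {ε k μ r χ : ℝ} {q p u : ℝ → ℝ}
    (c : H.Connection ε k μ q p u) (hP : H.Par k μ)
    (hfq : ∀ q u, fq (χ + H.σ * q) u r = H.σ * H.F q u)
    (hgq : ∀ q u, gq (χ + H.σ * q) u = H.gn q u) :
    IsTWSol (H.R / (2 * k ^ 2)) μ (-H.ζ - μ) ε r (fun t => χ + H.σ * q t)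
        (fun t => H.σ * p t) u ∧
      Tendsto (fun t => (χ + H.σ * q t, H.σ * p t, u t)) atBot (𝓝 (χ, 0, H.ua)) ∧
      Tendsto (fun t => (χ + H.σ * q t, H.σ * p t, u t)) atTop
        (𝓝 (χ + H.σ * H.qT, 0, H.uT)) := by
  have hden : ∀ t, u t - (-H.ζ - μ) = H.den (u t) μ := fun t => by
    rw [H.den_eq hP (c.hu t)]; ring
  have hden₀ : ∀ t, 0 < H.den (u t) μ := fun t => H.hd₀.trans_le (H.d₀_le_den _ _)
  refine ⟨⟨fun t h => ?_, fun t => ((c.dq t).const_mul _).const_add _, fun t => ?_, fun t => ?_⟩,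
    ?_, ?_⟩
  · have := hden t
    exact (hden₀ t).ne (by rw [← this, h, sub_self])
  · refine ((c.dp t).const_mul H.σ).congr_deriv ?_
    rw [hfq, pdot, α]
    field_simp
  · refine (c.du t).congr_deriv ?_
    rw [hgq, hden, G, mul_div_assoc]
  · have := ((c.q_bot.const_mul H.σ).const_add χ).prodMk_nhds
      ((c.p_bot.const_mul H.σ).prodMk_nhds c.u_bot)
    simpa only [mul_zero, add_zero] using this
  · have := ((c.q_top.const_mul H.σ).const_add χ).prodMk_nhds
      ((c.p_top.const_mul H.σ).prodMk_nhds c.u_top)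
    simpa only [mul_zero] using this

end Layer

namespace LoopData
variable {r ub Sf Sb ζ : ℝ}

theorem lt_add_singularSpeed (h : LoopData r ub Sf Sb) (hζ : 2 / 5 < ζ) :
    0 < 3 * Sf - 1 + (3 * Sb - 1) ∧
      0 < ub + ζ + (-2 + (3 * Sf - 1) * (2 - ub) / (3 * Sf - 1 + (3 * Sb - 1))) := by
  obtain ⟨hr, hub₁, hub₂, hSf, hSb, hSb₀, hSbf, hSf₁, hg⟩ := h
  have h1 : 2 / 3 < Sf := by
    by_contra! hc
    nlinarith
  have h2 : 0 < 3 * Sf - 1 + (3 * Sb - 1) := by linarith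
  refine ⟨h2, ?_⟩
  have h3 : ub + ζ + (-2 + (3 * Sf - 1) * (2 - ub) / (3 * Sf - 1 + (3 * Sb - 1))) =
      ζ - (2 - ub) * (3 * Sb - 1) / (3 * Sf - 1 + (3 * Sb - 1)) := by
    field_simp; ring
  rw [h3, sub_pos]
  refine lt_of_le_of_lt ?_ hζ
  rw [div_le_iff₀ h2]
  rcases le_total (3 * Sb - 1) 0 with h | h <;> nlinarith

/-- The heteroclinic loop persists for small `ε > 0`. -/
theorem exists_loop (h : LoopData r ub Sf Sb) (hζ : 2 / 5 < ζ) :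
    ∃ ε₀ > 0, ∃ Dh μh : ℝ → ℝ,
      Tendsto Dh (𝓝[>] 0)
        (𝓝 (2 * (2 - ub) ^ 2 / ((r + 1 / 10) * (3 * Sf - 1 + (3 * Sb - 1)) ^ 2))) ∧
      Tendsto μh (𝓝[>] 0)
        (𝓝 (-2 + (3 * Sf - 1) * (2 - ub) / (3 * Sf - 1 + (3 * Sb - 1)))) ∧
      ∀ ε ∈ Set.Ioo (0 : ℝ) ε₀,
        0 < Dh ε ∧
        (∃ Q P U : ℝ → ℝ,
          IsTWSol (Dh ε) (μh ε) (-ζ - μh ε) ε r Q P U ∧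
          Tendsto (fun ξ => (Q ξ, P ξ, U ξ)) atBot (𝓝 (0, 0, 2)) ∧
          Tendsto (fun ξ => (Q ξ, P ξ, U ξ)) atTop (𝓝 (1 + Sb, 0, ub))) ∧
        (∃ Q P U : ℝ → ℝ,
          IsTWSol (Dh ε) (μh ε) (-ζ - μh ε) ε r Q P U ∧
          Tendsto (fun ξ => (Q ξ, P ξ, U ξ)) atBot (𝓝 (1 + Sb, 0, ub)) ∧
          Tendsto (fun ξ => (Q ξ, P ξ, U ξ)) atTop (𝓝 (0, 0, 2))) := by
  obtain ⟨hAB, hμ₀⟩ := h.lt_add_singularSpeed hζ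
  have hu2 : 0 < 2 - ub := by linarith [h.hub₂]
  have hR : 0 < r + 1 / 10 := by linarith [h.hr]
  set A := 3 * Sf - 1 with hA
  set B := 3 * Sb - 1 with hB
  set R := r + 1 / 10 with hRdef
  set μ₀ := -2 + A * (2 - ub) / (A + B) with hμ₀def
  set w := (ub + ζ + μ₀) / 2 with hw
  have hw₀ : 0 < w := by positivity
  set C := R * (A + B) / 2 with hC
  have hC₀ : 0 < C := by positivity
  set l₀ := (2 - ub) / C with hl₀
  have hl₀p : 0 < l₀ := by positivity
  let l : ℝ × ℝ → ℝ := fun s => l₀ - (s.1 - s.2) / C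
  let Θ : ℝ × ℝ → ℝ × ℝ := fun s => (1 / max (l s) (l₀ / 2), s.1 - 2 + R * A / 2 * l s)
  have hmax : ∀ s, 0 < max (l s) (l₀ / 2) := fun s => lt_max_of_lt_right (by positivity)
  have hl : Continuous l := by fun_prop
  have hΘ : Continuous Θ :=
    (continuous_const.div (hl.max continuous_const) fun s => (hmax s).ne').prodMk (by fun_prop)
  have hl0 : l 0 = l₀ := by simp [l]
  have hΘ0 : Θ 0 = (1 / l₀, μ₀) := by
    have e1 : max (l 0) (l₀ / 2) = l₀ := by rw [hl0]; exact max_eq_left (by linarith)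
    have e2 : R * A / 2 * l₀ = A * (2 - ub) / (A + B) := by
      rw [hl₀, hC]; field_simp
    refine Prod.ext (by simp only [Θ, e1]) ?_
    simp only [Θ, hl0, e2, hμ₀def, Prod.fst_zero]
    ring
  obtain ⟨Hf, fR, fa, fb, fe, fua, fuT, fqT, fc, fσ, fζ, fkl, fkh, fμl, fμh⟩ :=
    h.exists_front (ζ := ζ) (kl := 1 / (2 * l₀)) (kh := 2 / l₀) (μl := μ₀ - w) (μh := μ₀ + w)
      (by positivity) (by rw [div_le_div_iff₀ (by positivity) hl₀p]; linarith)
      (by linarith)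
  obtain ⟨Hb, bR, ba, bb, be, bua, buT, bqT, bc, bσ, bζ, bkl, bkh, bμl, bμh⟩ :=
    h.exists_back (ζ := ζ) (kl := 1 / (2 * l₀)) (kh := 2 / l₀) (μl := μ₀ - w) (μh := μ₀ + w)
      (by positivity) (by rw [div_le_div_iff₀ (by positivity) hl₀p]; linarith)
      (by linarith)
  have hnear : ∀ᶠ s in 𝓝 (0 : ℝ × ℝ), l₀ / 2 < l s ∧
      Θ s ∈ Set.Ioo (1 / (2 * l₀)) (2 / l₀) ×ˢ Set.Ioo (μ₀ - w) (μ₀ + w) := by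
    refine (hl.continuousAt.eventually_const_lt (by rw [hl0]; linarith)).and
      (hΘ.continuousAt.eventually ?_)
    rw [hΘ0]
    refine (isOpen_Ioo.prod isOpen_Ioo).mem_nhds ⟨⟨?_, ?_⟩, by simp [hw₀], by simp [hw₀]⟩
    · simp only; gcongr; linarith
    · simp only; gcongr; norm_num
  obtain ⟨η, hη, hball⟩ := Metric.nhds_basis_closedBall.mem_iff.1 hnear
  have hs : ∀ s : ℝ × ℝ, ‖s‖ ≤ η → l₀ / 2 < l s ∧
      Θ s ∈ Set.Ioo (1 / (2 * l₀)) (2 / l₀) ×ˢ Set.Ioo (μ₀ - w) (μ₀ + w) := fun s hs =>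
    hball (mem_closedBall_zero_iff.2 hs)
  have hinv : ∀ s, l₀ / 2 < l s → ∀ c, c / (2 * (Θ s).1) = c / 2 * l s := by
    intro s h c
    simp only [Θ, max_eq_left h.le]
    field_simp
  have hCl : ∀ s, C * l s = 2 - ub - (s.1 - s.2) := by
    intro s
    simp only [l, hl₀]
    field_simp
  have hΘf : ∀ s, ‖s‖ ≤ η → Hf.Par (Θ s).1 (Θ s).2 ∧ Hf.s (Θ s).1 (Θ s).2 = s.1 := by
    intro s hsη
    obtain ⟨h1, h2, h3⟩ := hs s hsη
    refine ⟨⟨by rw [fkl, fkh]; exact Set.Ioo_subset_Icc_self h2,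
      by rw [fμl, fμh]; exact Set.Ioo_subset_Icc_self h3⟩, ?_⟩
    rw [Layer.s, hinv s h1, fua, fR, fa, fb]
    simp only [Θ, hA]
    ring
  have hΘb : ∀ s, ‖s‖ ≤ η → Hb.Par (Θ s).1 (Θ s).2 ∧ Hb.s (Θ s).1 (Θ s).2 = s.2 := by
    intro s hsη
    obtain ⟨h1, h2, h3⟩ := hs s hsη
    refine ⟨⟨by rw [bkl, bkh]; exact Set.Ioo_subset_Icc_self h2,
      by rw [bμl, bμh]; exact Set.Ioo_subset_Icc_self h3⟩, ?_⟩
    rw [Layer.s, hinv s h1, bua, bR, ba, bb]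
    simp only [Θ]
    linear_combination hCl s
  obtain ⟨η', hη', hconn⟩ := Layer.eventually_exists_connections
    (by rw [fμl, fμh]; linarith) (by rw [bμl, bμh]; linarith) hΘ hη hΘf hΘb
  obtain ⟨f, hf, hfe⟩ := exists_tendsto_selection (lt_min hη hη') fun δ hδ hδ' =>
    (hconn δ hδ (hδ'.trans (min_le_right _ _))).mono fun ε ⟨s, hsδ, hs⟩ =>
      (⟨s, hsδ, hsδ.trans (hδ'.trans (min_le_left _ _)), hs⟩ : ∃ s : ℝ × ℝ, ‖s‖ ≤ δ ∧
        ‖s‖ ≤ η ∧ (∃ q p u, Hf.Connection ε (Θ s).1 (Θ s).2 q p u) ∧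
          ∃ q p u, Hb.Connection ε (Θ s).1 (Θ s).2 q p u)
  obtain ⟨ε₀, hε₀, hsub⟩ := mem_nhdsGT_iff_exists_Ioo_subset.1 hfe
  have hlim : Tendsto (fun ε => Θ (f ε)) (𝓝[>] 0) (𝓝 (1 / l₀, μ₀)) :=
    hΘ0 ▸ (hΘ.tendsto 0).comp hf
  have hlim₁ := (continuous_fst.tendsto _).comp hlim
  have hlim₂ := (continuous_snd.tendsto _).comp hlim
  refine ⟨ε₀, hε₀, fun ε => R / (2 * (Θ (f ε)).1 ^ 2), fun ε => (Θ (f ε)).2, ?_, hlim₂, ?_⟩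
  · have e : 2 * (2 - ub) ^ 2 / (R * (A + B) ^ 2) = R / (2 * (1 / l₀) ^ 2) := by
      rw [hl₀, hC]; field_simp
    rw [e]
    exact tendsto_const_nhds.div ((hlim₁.pow 2).const_mul 2) (by positivity)
  intro ε hε
  obtain ⟨hn, ⟨q, p, u, cf⟩, q', p', u', cb⟩ := hsub hε
  have hk : 0 < (Θ (f ε)).1 := one_div_pos.2 (hmax _)
  refine ⟨by positivity, ?_, ?_⟩
  · have := cf.isTWSol (χ := 0) (r := r) (hΘf _ hn).1
      (fun q u => by
        rw [fq, Layer.F, fσ, fR, fa, fb, fe, fua]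
        linear_combination -q * h.hSf)
      (fun q u => by rw [gq, Layer.gn, fσ, fc, fua]; ring)
    rw [fR, fζ, fσ, fua, fuT, fqT, zero_add, one_mul] at this
    exact ⟨_, _, _, this⟩
  · have := cb.isTWSol (χ := 1 + Sb) (r := r) (hΘb _ hn).1
      (fun q u => by
        rw [fq, Layer.F, bσ, bR, ba, bb, be, bua]
        linear_combination (q - (1 + Sb)) * h.hSb)
      (fun q u => by rw [gq, Layer.gn, bσ, bc, bua]; linear_combination h.hg)
    rw [bR, bζ, bσ, bua, buT, bqT, neg_one_mul, add_neg_cancel] at this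
    exact ⟨_, _, _, this⟩

/-- The algebraic relations of the singular loop follow from the vanishing of `Kc`. -/
theorem of_Kc (hr : 2 / 3 < r) (hub : ub ∈ Set.Ioo (6 / 5 : ℝ) (4 / 3)) (hK : Kc ub r = 0) :
    LoopData r ub (Real.sqrt (r / (r + 1 / 10))) (Real.sqrt ((r + ub - 2) / (r + 1 / 10))) := by
  obtain ⟨h1, h2⟩ := hub
  have hR : 0 < r + 1 / 10 := by linarith
  have hu1 : 0 < ub - 1 := by linarith
  set S := (4 - 3 * ub) / (2 * (ub - 1)) with hS
  have hS₀ : 0 < S := div_pos (by linarith) (by positivity)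
  have hSR : (r + 1 / 10) * S ^ 2 = r + ub - 2 := by
    rw [hS]
    field_simp
    rw [Kc] at hK
    linear_combination (-1) * hK
  have e1 : Real.sqrt ((r + ub - 2) / (r + 1 / 10)) = S := by
    rw [← hSR, mul_div_cancel_left₀ _ hR.ne', Real.sqrt_sq hS₀.le]
  have e2 : Real.sqrt (r / (r + 1 / 10)) ^ 2 = r / (r + 1 / 10) :=
    Real.sq_sqrt (by apply div_nonneg <;> linarith)
  refine ⟨hr, h1, h2, ?_, ?_, ?_, ?_, ?_, ?_⟩
  · rw [e2]; field_simp
  · rw [e1, hSR]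
  · rwa [e1]
  · exact Real.sqrt_lt_sqrt (by rw [← hSR]; positivity) (by gcongr; linarith)
  · rw [Real.sqrt_lt' one_pos, one_pow, div_lt_one hR]; linarith
  · rw [e1, hS]; field_simp; ring

end LoopData

theorem stmt17 (ζ r ubr : ℝ) (hζ : 2/5 < ζ) (hr : 2/3 < r)
    (hub : ubr ∈ Set.Ioo (6/5 : ℝ) (4/3)) (hK : Kc ubr r = 0)
    (hM : Mhat r ubr ≠ 0) :
    ∃ ε₀ > 0, ∃ Dh μh : ℝ → ℝ,
      Tendsto Dh (nhdsWithin 0 (Set.Ioi 0)) (nhds (D0 r ubr)) ∧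
      Tendsto μh (nhdsWithin 0 (Set.Ioi 0)) (nhds (mu0 r ubr)) ∧
      ∀ ε ∈ Set.Ioo (0:ℝ) ε₀,
        0 < Dh ε ∧
        (∃ Q P U : ℝ → ℝ,
          IsTWSol (Dh ε) (μh ε) (-ζ - μh ε) ε r Q P U ∧
          Tendsto (fun ξ => (Q ξ, P ξ, U ξ)) atBot (nhds ((0:ℝ), (0:ℝ), (2:ℝ))) ∧
          Tendsto (fun ξ => (Q ξ, P ξ, U ξ)) atTop (nhds (qbp r ubr, (0:ℝ), ubr))) ∧
        (∃ Q P U : ℝ → ℝ,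
          IsTWSol (Dh ε) (μh ε) (-ζ - μh ε) ε r Q P U ∧
          Tendsto (fun ξ => (Q ξ, P ξ, U ξ)) atBot (nhds (qbp r ubr, (0:ℝ), ubr)) ∧
          Tendsto (fun ξ => (Q ξ, P ξ, U ξ)) atTop (nhds ((0:ℝ), (0:ℝ), (2:ℝ)))) := by
  have h := LoopData.of_Kc hr hub hK
  have hAB := (h.lt_add_singularSpeed hζ).1
  have key := h.exists_loop hζ
  rw [D0, mu0, qbp, qbm, qfp, qfm]
  set Sf := Real.sqrt (r / (r + 1 / 10))
  set Sb := Real.sqrt ((r + ubr - 2) / (r + 1 / 10))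
  have e1 : (r + 1 / 10) * (2 * (1 - Sb) - (1 + Sb) + 2 * (1 - Sf) - (1 + Sf)) ^ 2 =
      (r + 1 / 10) * (3 * Sf - 1 + (3 * Sb - 1)) ^ 2 := by ring
  have e2 : (2 * (2 * (1 - Sb) - (1 + Sb)) + ubr * (2 * (1 - Sf) - (1 + Sf))) /
      (1 + Sb - 2 * (1 - Sb) + (1 + Sf) - 2 * (1 - Sf)) =
      -2 + (3 * Sf - 1) * (2 - ubr) / (3 * Sf - 1 + (3 * Sb - 1)) := by
    have e3 : 1 + Sb - 2 * (1 - Sb) + (1 + Sf) - 2 * (1 - Sf) =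
      3 * Sf - 1 + (3 * Sb - 1) := by ring
    rw [e3, div_eq_iff hAB.ne', add_mul, div_mul_cancel₀ _ hAB.ne']
    ring
  rw [e1, e2]
  exact key
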